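/- (Virial identity) If u is a smooth, rapidly decaying solution of i∂_t u + Δu + |u|^{4/d} u = 0, then d²/dt² ∫_{ℝ^d} |x|² |u(t,x)|² dx = 16 E(u(t)), where E(v) = (1/2)∫|∇v|² − (d/(2d+4))∫|v|^{2+4/d}. -/

import Mathlib

open scoped BigOperators

noncomputable section

/-- The `i`-th standard basis vector of `ℝᵈ`. -/
def stdVec (d : ℕ) (i : Fin d) : EuclideanSpace ℝ (Fin d) := EuclideanSpace.single i 1

/-- Directional derivative of a complex-valued function on `ℝᵈ`. -/
def dirDeriv {d : ℕ} (f : EuclideanSpace ℝ (Fin d) → ℂ)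
    (v x : EuclideanSpace ℝ (Fin d)) : ℂ :=
  deriv (fun s : ℝ => f (x + s • v)) 0

/-- The Laplacian of a complex-valued function on `ℝᵈ`, as a sum of repeated
directional derivatives along the coordinate directions. -/
def lap {d : ℕ} (f : EuclideanSpace ℝ (Fin d) → ℂ) (x : EuclideanSpace ℝ (Fin d)) : ℂ :=
  ∑ i : Fin d, dirDeriv (fun y => dirDeriv f (stdVec d i) y) (stdVec d i) x

/-- `u` solves the focusing mass-critical NLS `i ∂_t u + Δ u + |u|^{4/d} u = 0`. -/
def IsNLSSolution (d : ℕ) (u : ℝ → EuclideanSpace ℝ (Fin d) → ℂ) : Prop :=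
  ∀ t : ℝ, ∀ x : EuclideanSpace ℝ (Fin d),
    Complex.I * deriv (fun s => u s x) t + lap (u t) x
      + ((‖u t x‖ ^ ((4 : ℝ) / d) : ℝ) : ℂ) * u t x = 0

/-- `u` solves the focusing mass-critical NLS on the time set `I`. -/
def IsNLSSolutionOn (d : ℕ) (I : Set ℝ) (u : ℝ → EuclideanSpace ℝ (Fin d) → ℂ) : Prop :=
  ∀ t ∈ I, ∀ x : EuclideanSpace ℝ (Fin d),
    Complex.I * deriv (fun s => u s x) t + lap (u t) x
      + ((‖u t x‖ ^ ((4 : ℝ) / d) : ℝ) : ℂ) * u t x = 0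

/-- `f` decays rapidly (Schwartz-type decay): every derivative decays faster than any
polynomial. -/
def SchwartzDecay {d : ℕ} (f : EuclideanSpace ℝ (Fin d) → ℂ) : Prop :=
  ∀ k n : ℕ, ∃ C : ℝ, ∀ x, ‖x‖ ^ k * ‖iteratedFDeriv ℝ n f x‖ ≤ C

/-- The energy `E(f) = (1/2)∫|∇f|² - (d/(2d+4))∫|f|^{2+4/d}`. -/
def energy (d : ℕ) (f : EuclideanSpace ℝ (Fin d) → ℂ) : ℝ :=
  (1 / 2) * (∫ x, ∑ i : Fin d, ‖dirDeriv f (stdVec d i) x‖ ^ 2)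
    - ((d : ℝ) / (2 * d + 4)) * (∫ x, ‖f x‖ ^ ((2 : ℝ) + 4 / d))

section
open MeasureTheory Set Filter Topology SchwartzMap
open scoped ENNReal NNReal

noncomputable section

section Marcinkiewicz

variable {E : Type*} [NormedAddCommGroup E] [InnerProductSpace ℝ E] [FiniteDimensional ℝ E]
  [MeasurableSpace E] [BorelSpace E]

lemma schwartz_split (f : E → ℂ) (hfc : HasCompactSupport f) (hf : ContDiff ℝ (⊤ : ℕ∞) f) (a : ℝ)
    (ha : 0 < a) :
    ∃ g h : 𝓢(E, ℂ), (∀ x, f x = g x + h x) ∧ (∀ x, ‖g x‖ ≤ ‖f x‖) ∧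
      (∀ x, 2 * a < ‖f x‖ → g x = 0) ∧ (∀ x, ‖h x‖ ≤ ‖f x‖) ∧ (∀ x, ‖f x‖ < a → h x = 0) := by
  obtain ⟨θ, hθd⟩ : ∃ θ : E → ℝ, ∀ x, θ x = Real.smoothTransition (2 - ‖f x‖ ^ 2 / a ^ 2) :=
    ⟨_, fun x => rfl⟩
  have hθ : ContDiff ℝ (⊤ : ℕ∞) θ := by
    rw [show θ = fun x => Real.smoothTransition (2 - ‖f x‖ ^ 2 / a ^ 2) from funext hθd]
    have h1 : ContDiff ℝ (⊤ : ℕ∞) (fun x => 2 - ‖f x‖ ^ 2 / a ^ 2) :=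
      contDiff_const.sub ((hf.norm_sq ℝ).div_const _)
    exact (Real.smoothTransition.contDiff (n := (⊤ : ℕ∞))).comp h1
  have hθ0 : ∀ x, 0 ≤ θ x := fun x => by rw [hθd]; exact Real.smoothTransition.nonneg _
  have hθ1 : ∀ x, θ x ≤ 1 := fun x => by rw [hθd]; exact Real.smoothTransition.le_one _
  have hg : ContDiff ℝ (⊤ : ℕ∞) (fun x => (θ x) • f x) := ContDiff.smul hθ hf
  have hh : ContDiff ℝ (⊤ : ℕ∞) (fun x => (1 - θ x) • f x) := (contDiff_const.sub hθ).smul hf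
  have hcs : ∀ ρ : E → ℝ, HasCompactSupport (fun x => (ρ x) • f x) := fun ρ =>
    hfc.mono (fun x hx hfx => hx (by simp [hfx]))
  have hgc : HasCompactSupport (fun x => (θ x) • f x) := hcs _
  have hhc : HasCompactSupport (fun x => (1 - θ x) • f x) := hcs _
  obtain ⟨g, hgx⟩ : ∃ g : 𝓢(E, ℂ), ∀ x, g x = (θ x) • f x :=
    ⟨hgc.toSchwartzMap hg, fun x => rfl⟩
  obtain ⟨h, hhx⟩ : ∃ g : 𝓢(E, ℂ), ∀ x, g x = (1 - θ x) • f x :=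
    ⟨hhc.toSchwartzMap hh, fun x => rfl⟩
  refine ⟨g, h, ?_, ?_, ?_, ?_, ?_⟩
  · intro x
    rw [hgx, hhx]
    rw [← add_smul]; simp
  · intro x
    simp only [hgx, hhx, norm_smul, Real.norm_eq_abs]
    rw [abs_of_nonneg (hθ0 x)]
    exact mul_le_of_le_one_left (norm_nonneg _) (hθ1 x)
  · intro x hx
    rw [hgx]
    have : θ x = 0 := by
      rw [hθd]
      apply Real.smoothTransition.zero_of_nonpos
      rw [sub_nonpos, le_div_iff₀ (by positivity)]
      nlinarith
    simp [this]
  · intro x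
    simp only [hgx, hhx, norm_smul, Real.norm_eq_abs]
    rw [abs_of_nonneg (by linarith [hθ1 x])]
    exact mul_le_of_le_one_left (norm_nonneg _) (by linarith [hθ0 x])
  · intro x hx
    rw [hhx]
    have : θ x = 1 := by
      rw [hθd]
      apply Real.smoothTransition.one_of_one_le
      have : ‖f x‖ ^ 2 / a ^ 2 ≤ 1 := by
        rw [div_le_one (by positivity)]
        nlinarith [norm_nonneg (f x)]
      linarith
    simp [this]

/-- Off-diagonal Marcinkiewicz interpolation between `L² → L²` and `L¹ → L^∞`. -/
lemma marcinkiewicz (T : 𝓢(E, ℂ) → E → ℂ) (hTc : ∀ f, Continuous (T f))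
    (hadd : ∀ f g h : 𝓢(E, ℂ), (∀ x, f x = g x + h x) → ∀ x, T f x = T g x + T h x)
    (h2 : ∀ f, ∫⁻ x, ENNReal.ofReal (‖T f x‖ ^ 2) ≤ ∫⁻ x, ENNReal.ofReal (‖f x‖ ^ 2))
    (κ : ℝ) (hκ : 0 < κ) (hinf : ∀ f x, ‖T f x‖ ≤ κ * ∫ y, ‖f y‖)
    (r q : ℝ) (hr : 2 < r) (hq : q = r / (r - 1))
    (f : 𝓢(E, ℂ)) (hf : HasCompactSupport f) :
    ∫⁻ x, ENNReal.ofReal (‖T f x‖ ^ r) ≤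
      ENNReal.ofReal (4 * r / (r - 2) * 2 ^ (r - q) * κ ^ (r - 2) *
        (∫ x, ‖f x‖ ^ q) ^ (r - 1)) := by
  have hr1 : 0 < r - 1 := by linarith
  have hr2 : 0 < r - 2 := by linarith
  have hq1 : 1 < q := by rw [hq, lt_div_iff₀ hr1]; linarith
  have hqr : (q - 1) * (r - 1) = 1 := by rw [hq]; field_simp; ring
  have hqr2 : (q - 1) * (r - 2) = 2 - q := by linarith
  have hq2 : q < 2 := by nlinarith
  set N : ℝ := ∫ x, ‖f x‖ ^ q with hN
  have hfcont : Continuous f := f.continuous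
  have hNint : Integrable (fun x => ‖f x‖ ^ q) := by
    apply Continuous.integrable_of_hasCompactSupport
    · exact hfcont.norm.rpow_const (fun x => Or.inr (by linarith))
    · apply hf.norm.comp_left (g := fun t : ℝ => t ^ q)
      exact Real.zero_rpow (by linarith)
  have hN0 : 0 ≤ N := integral_nonneg (fun x => by positivity)
  rcases hN0.eq_or_lt with hN0 | hNpos
  · have hz : ∀ x, f x = 0 := by
      have := (integral_eq_zero_iff_of_nonneg (fun x => by positivity) hNint).1 hN0.symm
      have h' : (fun x => ‖f x‖ ^ q) = 0 := by
        apply (Continuous.ae_eq_iff_eq volume _ continuous_const).1 this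
        exact hfcont.norm.rpow_const (fun x => Or.inr (by linarith))
      intro x
      have := congrFun h' x
      simp only [Pi.zero_apply] at this
      rw [Real.rpow_eq_zero (norm_nonneg _) (by linarith)] at this
      simpa using this
    have hT0 : ∀ x, T f x = 0 := by
      intro x
      have := hinf f x
      simp only [hz, norm_zero, integral_zero, mul_zero] at this
      simpa using this
    simp [hT0, Real.zero_rpow (show r ≠ 0 by linarith)]
  -- main case
  let Λ : E → ℝ := fun x => 2 * κ * N * (‖f x‖ / 2) ^ (-(q - 1))
  have hΛm : Measurable Λ := by
    apply Measurable.const_mul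
    exact (hfcont.norm.measurable.div_const 2).pow_const _
  let G : ℝ → E → ℝ≥0∞ := fun t x =>
    {p : ℝ × E | p.1 ≤ Λ p.2}.indicator (fun p => ENNReal.ofReal (‖f p.2‖ ^ 2)) (t, x)
  have hGm : Measurable (Function.uncurry G) := by
    have hs : MeasurableSet {p : ℝ × E | p.1 ≤ Λ p.2} :=
      measurableSet_le measurable_fst (hΛm.comp measurable_snd)
    have hm : Measurable (fun p : ℝ × E => ENNReal.ofReal (‖f p.2‖ ^ 2)) := by
      have : Continuous (fun p : ℝ × E => (‖f p.2‖ ^ 2)) := by fun_prop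
      exact this.measurable.ennreal_ofReal
    exact hm.indicator hs
  have key : ∀ t ∈ Ioi (0 : ℝ), volume {x | t < ‖T f x‖} ≤
      ENNReal.ofReal (4 / t ^ 2) * ∫⁻ x, G t x := by
    intro t ht
    simp only [mem_Ioi] at ht
    have hb : 0 < 2 * κ * N / t := by positivity
    set a : ℝ := (2 * κ * N / t) ^ (r - 1) with ha
    have hapos : 0 < a := by positivity
    obtain ⟨g, h, hfgh, hg1, hg2, hh1, hh2⟩ := schwartz_split f hf (f.smooth ⊤) a hapos
    have hth : ∀ x, ‖T h x‖ ≤ t / 2 := by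
      intro x
      refine (hinf h x).trans ?_
      have : ∫ y, ‖h y‖ ≤ a ^ (1 - q) * N := by
        rw [hN, ← integral_const_mul]
        apply integral_mono_of_nonneg (Eventually.of_forall fun x => norm_nonneg _)
          (hNint.const_mul _)
        refine Eventually.of_forall fun y => ?_
        by_cases hy : ‖f y‖ < a
        · simp only [hh2 y hy, norm_zero]; positivity
        · push Not at hy
          have hfy : 0 < ‖f y‖ := lt_of_lt_of_le hapos hy
          refine (hh1 y).trans ?_
          have e : ‖f y‖ = ‖f y‖ ^ (1 - q) * ‖f y‖ ^ q := by
            rw [← Real.rpow_add hfy]; simp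
          show ‖f y‖ ≤ a ^ (1 - q) * ‖f y‖ ^ q
          calc ‖f y‖ = ‖f y‖ ^ (1 - q) * ‖f y‖ ^ q := e
            _ ≤ a ^ (1 - q) * ‖f y‖ ^ q := by
              apply mul_le_mul_of_nonneg_right _ (by positivity)
              exact Real.rpow_le_rpow_of_nonpos hapos hy (by linarith)
      calc κ * ∫ y, ‖h y‖ ≤ κ * (a ^ (1 - q) * N) := by gcongr
        _ = t / 2 := by
          rw [ha, ← Real.rpow_mul hb.le, show (r - 1) * (1 - q) = -1 by linarith,
            Real.rpow_neg_one]
          field_simp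
    have hsub : {x | t < ‖T f x‖} ⊆
        {x | ENNReal.ofReal (t ^ 2 / 4) ≤ ENNReal.ofReal (‖T g x‖ ^ 2)} := by
      intro x hx
      simp only [mem_ofPred_eq] at hx ⊢
      apply ENNReal.ofReal_le_ofReal
      have h1 : ‖T f x‖ ≤ ‖T g x‖ + ‖T h x‖ := by
        rw [hadd f g h hfgh x]; exact norm_add_le _ _
      have h2 := hth x
      have : t / 2 ≤ ‖T g x‖ := by linarith
      nlinarith
    have hmeas : AEMeasurable (fun x => ENNReal.ofReal (‖T g x‖ ^ 2)) volume := by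
      have : Continuous (fun x => ‖T g x‖ ^ 2) := ((hTc g).norm.pow 2)
      exact this.measurable.ennreal_ofReal.aemeasurable
    have hcheb := mul_meas_ge_le_lintegral₀ hmeas (ENNReal.ofReal (t ^ 2 / 4))
    have hle : ∫⁻ x, ENNReal.ofReal (‖T g x‖ ^ 2) ≤ ∫⁻ x, G t x := by
      refine (h2 g).trans (lintegral_mono fun x => ?_)
      by_cases hx : 2 * a < ‖f x‖
      · simp [hg2 x hx]
      · push Not at hx
        by_cases hfx : f x = 0
        · have : ‖g x‖ ≤ 0 := by simpa [hfx] using hg1 x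
          simp [le_antisymm this (norm_nonneg _)]
        · have hfx' : 0 < ‖f x‖ := norm_pos_iff.2 hfx
          have hmem : t ≤ Λ x := by
            have h3 : (‖f x‖ / 2) ^ (q - 1) ≤ 2 * κ * N / t := by
              calc (‖f x‖ / 2) ^ (q - 1) ≤ a ^ (q - 1) := by
                    apply Real.rpow_le_rpow (by positivity) (by linarith) (by linarith)
                _ = 2 * κ * N / t := by
                    rw [ha, ← Real.rpow_mul hb.le, show (r - 1) * (q - 1) = 1 by linarith,
                      Real.rpow_one]
            have h4 : 0 < (‖f x‖ / 2) ^ (q - 1) := by positivity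
            show t ≤ 2 * κ * N * (‖f x‖ / 2) ^ (-(q - 1))
            rw [Real.rpow_neg (by positivity), ← div_eq_mul_inv, le_div_iff₀ h4]
            rw [le_div_iff₀ ht] at h3
            linarith
          have : G t x = ENNReal.ofReal (‖f x‖ ^ 2) := by
            show Set.indicator _ _ _ = _
            rw [Set.indicator_of_mem]
            exact hmem
          rw [this]
          apply ENNReal.ofReal_le_ofReal
          have := hg1 x
          gcongr
    have h5 : ENNReal.ofReal (t ^ 2 / 4) * volume {x | t < ‖T f x‖} ≤ ∫⁻ x, G t x :=
      (mul_le_mul_right (measure_mono hsub) _).trans (hcheb.trans hle)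
    calc volume {x | t < ‖T f x‖}
        = ENNReal.ofReal (4 / t ^ 2) * (ENNReal.ofReal (t ^ 2 / 4) * volume {x | t < ‖T f x‖}) := by
          rw [← mul_assoc, ← ENNReal.ofReal_mul (by positivity)]
          have : 4 / t ^ 2 * (t ^ 2 / 4) = 1 := by field_simp
          rw [this]; simp
      _ ≤ _ := mul_le_mul_right h5 _
  rw [lintegral_rpow_eq_lintegral_meas_lt_mul volume (Eventually.of_forall fun x => norm_nonneg _)
    (hTc f).norm.measurable.aemeasurable (by linarith : 0 < r)]
  have step1 : ∫⁻ t in Ioi (0:ℝ), volume {x | t < ‖T f x‖} * ENNReal.ofReal (t ^ (r - 1)) ≤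
      ∫⁻ t in Ioi (0:ℝ), ∫⁻ x, ENNReal.ofReal (4 * t ^ (r - 3)) * G t x := by
    apply setLIntegral_mono_ae' measurableSet_Ioi
    refine Eventually.of_forall fun t ht => ?_
    have ht' : 0 < t := ht
    rw [lintegral_const_mul]
    · calc _ ≤ (ENNReal.ofReal (4 / t ^ 2) * ∫⁻ x, G t x) * ENNReal.ofReal (t ^ (r - 1)) :=
            mul_le_mul_left (key t ht) _
        _ = _ := by
            rw [mul_right_comm, ← ENNReal.ofReal_mul (by positivity)]
            congr 2
            rw [show r - 3 = (r - 1) - (2 : ℕ) by push_cast; ring, Real.rpow_sub_natCast ht'.ne']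
            field_simp
    · exact hGm.comp (measurable_const.prodMk measurable_id)
  have step2 : ∫⁻ t in Ioi (0:ℝ), ∫⁻ x, ENNReal.ofReal (4 * t ^ (r - 3)) * G t x =
      ∫⁻ x, ∫⁻ t in Ioi (0:ℝ), ENNReal.ofReal (4 * t ^ (r - 3)) * G t x := by
    apply lintegral_lintegral_swap
    apply Measurable.aemeasurable
    apply Measurable.mul _ hGm
    apply Measurable.ennreal_ofReal
    exact (measurable_fst.pow_const _).const_mul _
  have step3 : ∀ x, ∫⁻ t in Ioi (0:ℝ), ENNReal.ofReal (4 * t ^ (r - 3)) * G t x ≤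
      ENNReal.ofReal (4 / (r - 2) * 2 ^ (r - q) * κ ^ (r - 2) * N ^ (r - 2) * ‖f x‖ ^ q) := by
    intro x
    by_cases hfx : f x = 0
    · have : ∀ t, G t x = 0 := by
        intro t
        show Set.indicator _ _ _ = _
        simp [Set.indicator_apply, hfx]
      simp [this]
    have hfx' : 0 < ‖f x‖ := norm_pos_iff.2 hfx
    have hΛpos : 0 < Λ x := by
      show 0 < 2 * κ * N * (‖f x‖ / 2) ^ (-(q - 1))
      positivity
    have e1 : ∀ t, ENNReal.ofReal (4 * t ^ (r - 3)) * G t x =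
        (Iic (Λ x)).indicator (fun t => ENNReal.ofReal (4 * t ^ (r - 3)) *
          ENNReal.ofReal (‖f x‖ ^ 2)) t := by
      intro t
      show _ * Set.indicator _ _ _ = _
      by_cases h : t ≤ Λ x
      · rw [Set.indicator_of_mem, Set.indicator_of_mem]
        · exact h
        · exact h
      · rw [Set.indicator_of_notMem, Set.indicator_of_notMem, mul_zero]
        · exact h
        · exact h
    simp_rw [e1]
    rw [lintegral_indicator measurableSet_Iic, Measure.restrict_restrict measurableSet_Iic,
      inter_comm, Ioi_inter_Iic, lintegral_mul_const _ (by fun_prop)]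
    have hint : IntegrableOn (fun t : ℝ => 4 * t ^ (r - 3)) (Ioc 0 (Λ x)) := by
      have := (intervalIntegral.intervalIntegrable_rpow' (a := 0) (b := Λ x)
        (show -1 < r - 3 by linarith)).const_mul 4
      rwa [intervalIntegrable_iff_integrableOn_Ioc_of_le hΛpos.le] at this
    rw [← ofReal_integral_eq_lintegral_ofReal hint]
    · rw [← intervalIntegral.integral_of_le hΛpos.le, intervalIntegral.integral_const_mul,
        integral_rpow (Or.inl (by linarith)), ← ENNReal.ofReal_mul]
      · apply le_of_eq
        congr 1
        rw [Real.zero_rpow (by linarith), show r - 3 + 1 = r - 2 by ring, sub_zero]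
        show 4 * ((2 * κ * N * (‖f x‖ / 2) ^ (-(q - 1))) ^ (r - 2) / (r - 2)) * ‖f x‖ ^ 2 = _
        rw [Real.mul_rpow (by positivity) (by positivity), ← Real.rpow_mul (by positivity),
          show -(q - 1) * (r - 2) = q - 2 by linarith, Real.div_rpow (by positivity) (by positivity),
          Real.mul_rpow (by positivity) (by positivity),
          Real.mul_rpow (by positivity) (by positivity)]
        have e2 : ‖f x‖ ^ q = ‖f x‖ ^ (q - 2) * ‖f x‖ ^ 2 := by
          rw [← Real.rpow_natCast, ← Real.rpow_add hfx']; norm_num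
        have e3 : (2 : ℝ) ^ (r - q) = 2 ^ (r - 2) / 2 ^ (q - 2) := by
          rw [← Real.rpow_sub (by norm_num)]; congr 1; ring
        rw [e2, e3]; field_simp
      · rw [Real.zero_rpow (by linarith), show r - 3 + 1 = r - 2 by ring, sub_zero]
        positivity
    · rw [EventuallyLE, ae_restrict_iff' measurableSet_Ioc]
      refine Eventually.of_forall fun t ht => ?_
      have := ht.1
      simp only [Pi.zero_apply]
      positivity
  calc _ ≤ ENNReal.ofReal r * ∫⁻ x, ENNReal.ofReal
        (4 / (r - 2) * 2 ^ (r - q) * κ ^ (r - 2) * N ^ (r - 2) * ‖f x‖ ^ q) := by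
        apply mul_le_mul_right
        exact step1.trans (step2.le.trans (lintegral_mono step3))
    _ = _ := by
        rw [← ofReal_integral_eq_lintegral_ofReal (hNint.const_mul _)
          (Eventually.of_forall fun x => by positivity), integral_const_mul, ← hN,
          ← ENNReal.ofReal_mul (by linarith)]
        congr 1
        have : N ^ (r - 1) = N ^ (r - 2) * N := by
          rw [← Real.rpow_add_one hNpos.ne']; congr 1; ring
        rw [this]; ring

end Marcinkiewicz

end
end

section
open MeasureTheory Set Filter Topology SchwartzMap FourierTransform
open scoped ENNReal NNReal

noncomputable section

set_option linter.unusedSectionVars false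

section Gen

variable {V W : Type*} [NormedAddCommGroup V] [NormedSpace ℝ V] [NormedAddCommGroup W]
  [NormedSpace ℝ W] [MeasurableSpace V] [BorelSpace V] [SecondCountableTopology V]

/-- abstract oscillatory field -/
def oscField (L : V →L[ℝ] W →L[ℝ] ℝ) (μ : Measure V) (F : V → ℂ) (w : W) : ℂ :=
  ∫ v, Complex.exp (((-(2 * Real.pi * L v w) : ℝ) : ℂ) * Complex.I) * F v ∂μ

lemma oscField_eq (L : V →L[ℝ] W →L[ℝ] ℝ) (μ : Measure V) (F : V → ℂ) :
    oscField L μ F = VectorFourier.fourierIntegral Real.fourierChar μ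
      (ContinuousLinearMap.toLinearMap₁₂ L) F := by
  funext w
  rw [oscField, VectorFourier.fourierIntegral]
  congr 1; funext v
  rw [Circle.smul_def, Real.fourierChar_apply, smul_eq_mul]
  congr 3
  change _ = ((2 * Real.pi * -(L v w) : ℝ) : ℂ)
  congr 1; ring

lemma oscField_contDiff (L : V →L[ℝ] W →L[ℝ] ℝ) (μ : Measure V) (F : V → ℂ)
    (hF : ∀ n : ℕ, Integrable (fun v => ‖v‖ ^ n * ‖F v‖) μ) :
    ContDiff ℝ (⊤ : ℕ∞) (oscField L μ F) := by
  rw [oscField_eq]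
  exact VectorFourier.contDiff_fourierIntegral L (fun n _ => hF n)

lemma oscField_fderiv (L : V →L[ℝ] W →L[ℝ] ℝ) (μ : Measure V) (F : V → ℂ) (hFc : Continuous F)
    (hF : ∀ n : ℕ, Integrable (fun v => ‖v‖ ^ n * ‖F v‖) μ) (p w : W) :
    fderiv ℝ (oscField L μ F) p w =
      oscField L μ (fun v => ((-(2 * Real.pi * L v w) : ℝ) : ℂ) * Complex.I * F v) p := by
  have h0 := hF 0
  have h1 := hF 1
  simp only [pow_zero, one_mul, pow_one] at h0 h1
  have h0' := (integrable_norm_iff hFc.aestronglyMeasurable).1 h0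
  have hd := VectorFourier.hasFDerivAt_fourierIntegral L h0' h1 p
  rw [oscField_eq, oscField_eq, hd.fderiv, VectorFourier.fourierIntegral, VectorFourier.fourierIntegral]
  have hs : Continuous (fun v : V => VectorFourier.fourierSMulRight L F v) := by
    unfold VectorFourier.fourierSMulRight
    fun_prop
  have hk : Continuous fun v : V => -(((ContinuousLinearMap.toLinearMap₁₂ L) v) p) := by
    have : Continuous fun v : V => -(L v p) := by fun_prop
    exact this
  have hcont := (Real.continuous_fourierChar.comp hk).smul hs
  have hint : Integrable (fun v : V => Real.fourierChar
      (-(((ContinuousLinearMap.toLinearMap₁₂ L) v) p)) • VectorFourier.fourierSMulRight L F v) μ := by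
    refine (h1.const_mul (2 * Real.pi * ‖L‖)).mono' hcont.aestronglyMeasurable
      (Eventually.of_forall fun w => ?_)
    simp only [Circle.smul_def]
    rw [norm_smul, Circle.norm_coe, one_mul]
    refine (VectorFourier.norm_fourierSMulRight_le _ _ _).trans (le_of_eq ?_)
    ring
  rw [ContinuousLinearMap.integral_apply hint]
  congr 1
  funext v
  rw [Circle.smul_def, Circle.smul_def, smul_apply,
    VectorFourier.fourierSMulRight_apply, smul_eq_mul]
  congr 1
  simp only [smul_eq_mul, Complex.real_smul]
  push_cast
  ring

variable {F : Type*} [NormedAddCommGroup F] [NormedSpace ℝ F]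

def stL (B : F →L[ℝ] F →L[ℝ] ℝ) : (ℝ × F) →L[ℝ] (ℝ × F) →L[ℝ] ℝ :=
  (ContinuousLinearMap.mul ℝ ℝ).bilinearComp (ContinuousLinearMap.fst ℝ ℝ F)
    (ContinuousLinearMap.fst ℝ ℝ F) +
  B.bilinearComp (ContinuousLinearMap.snd ℝ ℝ F) (ContinuousLinearMap.snd ℝ ℝ F)

lemma stL_apply (B : F →L[ℝ] F →L[ℝ] ℝ) (v w : ℝ × F) : stL B v w = v.1 * w.1 + B v.2 w.2 := rfl

variable [MeasurableSpace F] [BorelSpace F] [SecondCountableTopology F]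

def stField (B : F →L[ℝ] F →L[ℝ] ℝ) (μ : Measure (ℝ × F)) (G : ℝ × F → ℂ) : ℝ × F → ℂ :=
  oscField (stL B) μ G

lemma stField_apply (B : F →L[ℝ] F →L[ℝ] ℝ) (μ : Measure (ℝ × F)) (G : ℝ × F → ℂ) (w : ℝ × F) :
  stField B μ G w = ∫ v, Complex.exp (((-(2 * Real.pi * (v.1 * w.1 + B v.2 w.2)) : ℝ) : ℂ) *
    Complex.I) * G v ∂μ := rfl

lemma stField_contDiff (B : F →L[ℝ] F →L[ℝ] ℝ) (μ : Measure (ℝ × F)) (G : ℝ × F → ℂ)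
    (hF : ∀ n : ℕ, Integrable (fun v => ‖v‖ ^ n * ‖G v‖) μ) :
    ContDiff ℝ (⊤ : ℕ∞) (stField B μ G) := oscField_contDiff (stL B) μ G hF

lemma stField_fderiv (B : F →L[ℝ] F →L[ℝ] ℝ) (μ : Measure (ℝ × F)) (G : ℝ × F → ℂ)
    (hFc : Continuous G)
    (hF : ∀ n : ℕ, Integrable (fun v => ‖v‖ ^ n * ‖G v‖) μ) (p w : ℝ × F) :
    fderiv ℝ (stField B μ G) p w =
      stField B μ (fun v => ((-(2 * Real.pi * (v.1 * w.1 + B v.2 w.2)) : ℝ) : ℂ) *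
        Complex.I * G v) p := oscField_fderiv (stL B) μ G hFc hF p w

end Gen

section Schrod

variable {E : Type*} [NormedAddCommGroup E] [InnerProductSpace ℝ E] [FiniteDimensional ℝ E]
  [MeasurableSpace E] [BorelSpace E]

def schMult (s : ℝ) (ξ : E) : ℂ := Complex.exp (((-(4 * Real.pi ^ 2 * s) * ‖ξ‖ ^ 2 : ℝ) : ℂ) * Complex.I)

lemma expI_tg : Function.HasTemperateGrowth (fun x : ℝ => Complex.exp ((x : ℂ) * Complex.I)) := by
  have hd : ∀ n : ℕ, iteratedDeriv n (fun x : ℝ => Complex.exp ((x : ℂ) * Complex.I)) =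
      fun x : ℝ => Complex.I ^ n * Complex.exp ((x : ℂ) * Complex.I) := by
    intro n
    induction n with
    | zero => simp
    | succ n ih =>
      rw [iteratedDeriv_succ, ih]
      funext x
      have h1 : HasDerivAt (fun x : ℝ => Complex.exp ((x : ℂ) * Complex.I))
          (Complex.exp ((x : ℂ) * Complex.I) * (1 * Complex.I)) x :=
        ((Complex.ofRealCLM.hasDerivAt (x := x)).mul_const Complex.I).cexp
      rw [(h1.const_mul _).deriv]
      ring
  refine ⟨?_, fun n => ⟨0, 1, fun x => ?_⟩⟩
  · have : ContDiff ℝ (⊤ : ℕ∞) (fun x : ℝ => (x : ℂ) * Complex.I) :=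
      Complex.ofRealCLM.contDiff.mul contDiff_const
    exact this.cexp
  · rw [norm_iteratedFDeriv_eq_norm_iteratedDeriv, hd]
    simp [Complex.norm_exp_ofReal_mul_I]

lemma schMult_tg (s : ℝ) : Function.HasTemperateGrowth (schMult (E := E) s) := by
  have h : Function.HasTemperateGrowth (fun ξ : E => -(4 * Real.pi ^ 2 * s) * ‖ξ‖ ^ 2) :=
    (Function.HasTemperateGrowth.const _).mul (Function.hasTemperateGrowth_norm_sq E)
  exact expI_tg.comp h

lemma norm_schMult (s : ℝ) (ξ : E) : ‖schMult s ξ‖ = 1 := Complex.norm_exp_ofReal_mul_I _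

def schEvol (s : ℝ) (f : 𝓢(E, ℂ)) : 𝓢(E, ℂ) :=
  FourierTransformInv.fourierInv (smulLeftCLM ℂ (schMult s) (FourierTransform.fourier f))

lemma schEvol_l2 (s : ℝ) (f : 𝓢(E, ℂ)) : ∫ x, ‖schEvol s f x‖ ^ 2 = ∫ x, ‖f x‖ ^ 2 := by
  rw [← SchwartzMap.integral_norm_sq_fourier (schEvol s f), ← SchwartzMap.integral_norm_sq_fourier f]
  congr 1
  funext ξ
  rw [schEvol, FourierTransform.fourier_fourierInv_eq, smulLeftCLM_apply_apply (schMult_tg s),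
    norm_smul, norm_schMult, one_mul]

/-- the space-time field generated by a frequency profile -/
def schField (g : 𝓢(E, ℂ)) (p : ℝ × E) : ℂ :=
  ∫ ξ, Complex.exp (((2 * Real.pi * inner ℝ ξ p.2 - 4 * Real.pi ^ 2 * p.1 * ‖ξ‖ ^ 2 : ℝ) : ℂ)
    * Complex.I) * g ξ

lemma schEvol_eq_field (s : ℝ) (f : 𝓢(E, ℂ)) (x : E) :
    schEvol s f x = schField (FourierTransform.fourier f) (s, x) := by
  rw [schEvol, SchwartzMap.fourierInv_coe, Real.fourierInv_eq', schField]
  congr 1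
  funext ξ
  rw [smulLeftCLM_apply_apply (schMult_tg s), smul_eq_mul, smul_eq_mul, ← mul_assoc, schMult,
    ← Complex.exp_add]
  congr 2
  push_cast
  ring

lemma schEvol_add (s : ℝ) (f g h : 𝓢(E, ℂ)) (hf : ∀ x, f x = g x + h x) (x : E) :
    schEvol s f x = schEvol s g x + schEvol s h x := by
  have : f = g + h := by ext x; exact hf x
  rw [this, schEvol, schEvol, schEvol, FourierTransform.fourier_add, map_add,
    FourierTransform.fourierInv_add]
  rfl

lemma schEvol_zero (f : 𝓢(E, ℂ)) (x : E) : schEvol 0 f x = f x := by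
  have : smulLeftCLM ℂ (schMult (E := E) 0) (FourierTransform.fourier f) =
      FourierTransform.fourier f := by
    ext ξ
    rw [smulLeftCLM_apply_apply (schMult_tg 0)]
    simp [schMult]
  rw [schEvol, this, FourierTransform.fourierInv_fourier_eq]

def innerB : E →L[ℝ] E →L[ℝ] ℝ := innerSL ℝ

lemma innerB_apply (x y : E) : innerB x y = inner ℝ x y := rfl

def stι (ξ : E) : ℝ × E := (2 * Real.pi * ‖ξ‖ ^ 2, -ξ)

lemma stι_cont : Continuous (stι (E := E)) := by unfold stι; fun_prop

lemma schField_eq (g : 𝓢(E, ℂ)) : schField g =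
    stField innerB (Measure.map stι (volume : Measure E)) (fun v : ℝ × E => g (-v.2)) := by
  funext p
  have h2 : Continuous fun v : ℝ × E => g (-v.2) := g.continuous.comp (by fun_prop)
  rw [stField_apply, integral_map stι_cont.measurable.aemeasurable]
  · rw [schField]
    congr 1
    funext ξ
    simp only [innerB_apply, stι, inner_neg_left, neg_neg]
    congr 3
    push_cast
    ring
  · apply Continuous.aestronglyMeasurable
    simp only [innerB_apply]
    fun_prop

lemma st_int (g : 𝓢(E, ℂ)) (n : ℕ) :
    Integrable (fun v : ℝ × E => ‖v‖ ^ n * ‖g (-v.2)‖) (Measure.map stι (volume : Measure E)) := by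
  have hc : Continuous (fun v : ℝ × E => ‖v‖ ^ n * ‖g (-v.2)‖) := by
    have h2 : Continuous fun v : ℝ × E => g (-v.2) := g.continuous.comp (by fun_prop)
    fun_prop
  rw [integrable_map_measure hc.aestronglyMeasurable stι_cont.measurable.aemeasurable]
  have h1 := (g.integrable_pow_mul volume (2 * n)).const_mul (2 ^ (n - 1) * (2 * Real.pi) ^ n)
  have h2 := (g.integrable_pow_mul volume n).const_mul (2 ^ (n - 1))
  refine (h1.add h2).mono' (hc.comp stι_cont).aestronglyMeasurable (Eventually.of_forall fun ξ => ?_)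
  have hpi := Real.pi_pos
  have hb : ‖stι ξ‖ ≤ 2 * Real.pi * ‖ξ‖ ^ 2 + ‖ξ‖ := by
    rw [stι, Prod.norm_def, norm_neg, Real.norm_of_nonneg (by positivity)]
    exact max_le (by simp) (by have : 0 ≤ 2 * Real.pi * ‖ξ‖ ^ 2 := by positivity
                               simpa using this)
  simp only [Function.comp, Pi.add_apply]
  rw [Real.norm_of_nonneg (by positivity)]
  have : ‖stι ξ‖ ^ n ≤ 2 ^ (n - 1) * ((2 * Real.pi * ‖ξ‖ ^ 2) ^ n + ‖ξ‖ ^ n) :=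
    (pow_le_pow_left₀ (norm_nonneg _) hb n).trans (add_pow_le (by positivity) (by positivity) n)
  have e : -(stι ξ).2 = ξ := by simp [stι]
  rw [e]
  calc _ ≤ (2 ^ (n - 1) * ((2 * Real.pi * ‖ξ‖ ^ 2) ^ n + ‖ξ‖ ^ n)) * ‖g ξ‖ := by gcongr
    _ = _ := by rw [pow_mul, mul_pow]; ring

lemma schField_contDiff (g : 𝓢(E, ℂ)) : ContDiff ℝ (⊤ : ℕ∞) (schField g) := by
  rw [schField_eq]
  exact stField_contDiff innerB _ _ (st_int g)

def phaseD (v : ℝ × E) (ξ : E) : ℂ :=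
  ((2 * Real.pi * inner ℝ ξ v.2 - 4 * Real.pi ^ 2 * v.1 * ‖ξ‖ ^ 2 : ℝ) : ℂ) * Complex.I

lemma phaseD_tg (v : ℝ × E) : Function.HasTemperateGrowth (phaseD v) := by
  have h : Function.HasTemperateGrowth (fun ξ : E => 2 * Real.pi * inner ℝ ξ v.2 -
      4 * Real.pi ^ 2 * v.1 * ‖ξ‖ ^ 2) :=
    ((Function.HasTemperateGrowth.const _).mul (Function.hasTemperateGrowth_inner_left v.2)).sub
      ((Function.HasTemperateGrowth.const _).mul (Function.hasTemperateGrowth_norm_sq E))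
  exact (Function.Complex.hasTemperateGrowth_ofReal.comp h).mul (Function.HasTemperateGrowth.const _)

lemma schField_fderiv (g : 𝓢(E, ℂ)) (p v : ℝ × E) :
    fderiv ℝ (schField g) p v = schField (smulLeftCLM ℂ (phaseD v) g) p := by
  have hc : Continuous fun v : ℝ × E => g (-v.2) := g.continuous.comp (by fun_prop)
  rw [schField_eq, stField_fderiv innerB _ _ hc (st_int g), stField_apply,
    integral_map stι_cont.measurable.aemeasurable, schField]
  · congr 1
    funext ξ
    rw [smulLeftCLM_apply_apply (phaseD_tg v)]
    simp only [innerB_apply, stι, inner_neg_left, neg_neg, phaseD, smul_eq_mul]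
    congr 1
    · congr 2
      push_cast
      ring
    · push_cast
      ring
  · apply Continuous.aestronglyMeasurable
    simp only [innerB_apply]
    fun_prop

lemma schField_add (g h : 𝓢(E, ℂ)) (p : ℝ × E) :
    schField (g + h) p = schField g p + schField h p := by
  have hi : ∀ g : 𝓢(E, ℂ), Integrable (fun ξ => Complex.exp (((2 * Real.pi * inner ℝ ξ p.2 -
      4 * Real.pi ^ 2 * p.1 * ‖ξ‖ ^ 2 : ℝ) : ℂ) * Complex.I) * g ξ) := by
    intro g
    refine g.integrable.norm.mono' ?_ (Eventually.of_forall fun ξ => ?_)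
    · apply Continuous.aestronglyMeasurable
      have := g.continuous
      fun_prop
    · rw [norm_mul, Complex.norm_exp_ofReal_mul_I, one_mul]
  rw [schField, schField, schField, ← integral_add (hi g) (hi h)]
  congr 1; funext ξ
  rw [add_apply, mul_add]

lemma schField_smul (c : ℂ) (g : 𝓢(E, ℂ)) (p : ℝ × E) :
    schField (c • g) p = c * schField g p := by
  rw [schField, schField, ← integral_const_mul]
  congr 1; funext ξ
  rw [smul_apply, smul_eq_mul]; ring

lemma schField_pde {ι : Type*} [Fintype ι] (b : OrthonormalBasis ι ℝ E) (g : 𝓢(E, ℂ)) (p : ℝ × E) :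
    fderiv ℝ (schField g) p (1, 0) = Complex.I * ∑ k,
      fderiv ℝ (fun p' => fderiv ℝ (schField g) p' (0, b k)) p (0, b k) := by
  have e : ∀ k, (fun p' => fderiv ℝ (schField g) p' (0, b k)) =
      schField (smulLeftCLM ℂ (phaseD (0, b k)) g) := fun k => funext fun p' => schField_fderiv _ _ _
  simp_rw [e, schField_fderiv]
  have hsum : ∀ (s : Finset ι) (G : ι → 𝓢(E, ℂ)), ∑ k ∈ s, schField (G k) p =
      schField (∑ k ∈ s, G k) p := by
    intro s G
    induction s using Finset.cons_induction with
    | empty => simp [schField]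
    | cons a s ha ih => rw [Finset.sum_cons, Finset.sum_cons, ih, schField_add]
  rw [hsum, ← schField_smul]
  congr 1
  ext ξ
  rw [smulLeftCLM_apply_apply (phaseD_tg _), smul_apply, sum_apply]
  simp_rw [smulLeftCLM_apply_apply (phaseD_tg _)]
  simp only [phaseD, smul_eq_mul]
  have hp : ‖ξ‖ ^ 2 = ∑ k, (inner ℝ ξ (b k)) ^ 2 := by
    rw [← b.sum_sq_norm_inner_left ξ]
    simp
  rw [Finset.mul_sum, hp]
  simp only [inner_zero_right, mul_zero, zero_sub, mul_one, zero_mul, sub_zero]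
  push_cast
  rw [Finset.mul_sum, ← Finset.sum_neg_distrib, Finset.sum_mul, Finset.sum_mul]
  refine Finset.sum_congr rfl fun k _ => ?_
  have := Complex.I_sq
  linear_combination (-4 * (Real.pi : ℂ) ^ 2 * (inner ℝ ξ (b k) : ℂ) ^ 2 * g ξ * Complex.I) * this

lemma schEvol_linf (s : ℝ) (hs : s ≠ 0) (f : 𝓢(E, ℂ)) (x : E) :
    ‖schEvol s f x‖ ≤ (4 * Real.pi * |s|) ^ (-(Module.finrank ℝ E : ℝ) / 2) * ∫ y, ‖f y‖ := by
  have hpi := Real.pi_pos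
  set g := FourierTransform.fourier f with hg
  let b : ℝ → ℂ := fun ε => ⟨ε, 4 * Real.pi ^ 2 * s⟩
  let G : ℝ → E → ℂ := fun ε ξ => Complex.exp (-b ε * ↑‖ξ‖ ^ 2 + 2 * ↑Real.pi * Complex.I * ↑(inner ℝ x ξ))
  have hGn : ∀ ε ξ, ‖G ε ξ‖ = Real.exp (-ε * ‖ξ‖ ^ 2) := by
    intro ε ξ
    rw [Complex.norm_exp]
    congr 1
    have : (-b ε * (‖ξ‖ : ℂ) ^ 2 + 2 * ↑Real.pi * Complex.I * ↑(inner ℝ x ξ)) =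
        ((‖ξ‖ ^ 2 : ℝ) : ℂ) * (-b ε) + ((2 * Real.pi * inner ℝ x ξ : ℝ) : ℂ) * Complex.I := by
      push_cast; ring
    rw [this, Complex.add_re, Complex.re_ofReal_mul, Complex.re_ofReal_mul]
    simp [b]
    ring
  have hGc : ∀ ε, Continuous (G ε) := by intro ε; simp only [G]; fun_prop
  have hbound : ∀ ε > 0, ‖∫ ξ, G ε ξ * g ξ‖ ≤
      (4 * Real.pi * |s|) ^ (-(Module.finrank ℝ E : ℝ) / 2) * ∫ y, ‖f y‖ := by
    intro ε hε
    have hGi : Integrable (G ε) := by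
      have := GaussianFourier.integrable_cexp_neg_mul_sq_norm_add (V := E) (b := b ε) hε
        (2 * ↑Real.pi * Complex.I) x
      exact this
    have hsa : ∫ ξ, G ε ξ * g ξ = ∫ y, FourierTransform.fourier (G ε) y * f y := by
      have := VectorFourier.integral_fourierIntegral_smul_eq_flip (L := innerₗ E)
        (μ := volume) (ν := volume)
        Real.continuous_fourierChar continuous_inner (f.integrable (μ := volume)) hGi
      rw [flip_innerₗ] at this
      have e2 : ∀ ξ, (FourierTransform.fourier f) ξ =
        VectorFourier.fourierIntegral Real.fourierChar volume (innerₗ E) (⇑f) ξ := fun ξ => by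
          rw [SchwartzMap.fourier_coe]; rfl
      simp only [hg, smul_eq_mul] at this ⊢
      calc _ = ∫ ξ, VectorFourier.fourierIntegral Real.fourierChar volume (innerₗ E) (⇑f) ξ * G ε ξ := by
            congr 1; funext ξ; rw [mul_comm]; rfl
        _ = _ := by rw [this]; congr 1; funext ξ; rw [mul_comm]; rfl
    rw [hsa]
    refine (norm_integral_le_integral_norm _).trans ?_
    rw [← integral_const_mul]
    refine integral_mono_of_nonneg (Eventually.of_forall fun y => norm_nonneg _)
      (f.integrable.norm.const_mul _) (Eventually.of_forall fun y => ?_)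
    simp only [norm_mul]
    refine mul_le_mul_of_nonneg_right ?_ (norm_nonneg _)
    have hbre : 0 < (b ε).re := hε
    have hbn : 0 < ‖b ε‖ := norm_pos_iff.2 (fun h => by rw [h] at hbre; simp at hbre)
    have := fourier_gaussian_innerProductSpace' hbre x y
    rw [show (FourierTransform.fourier (G ε) y) = _ from this, norm_mul]
    have e1 : ‖((Real.pi : ℂ) / b ε) ^ ((Module.finrank ℝ E : ℂ) / 2)‖ =
        (Real.pi / ‖b ε‖) ^ ((Module.finrank ℝ E : ℝ) / 2) := by
      have : ((Module.finrank ℝ E : ℂ) / 2) = (((Module.finrank ℝ E : ℝ) / 2 : ℝ) : ℂ) := by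
        push_cast; rfl
      rw [this, Complex.norm_cpow_real, norm_div, Complex.norm_real, Real.norm_of_nonneg hpi.le]
    have e2 : ‖Complex.exp (-↑Real.pi ^ 2 * ↑‖x - y‖ ^ 2 / b ε)‖ ≤ 1 := by
      rw [Complex.norm_exp]
      apply Real.exp_le_one_iff.2
      have : (-(Real.pi : ℂ) ^ 2 * (‖x - y‖ : ℂ) ^ 2 / b ε) =
          ((-(Real.pi ^ 2 * ‖x - y‖ ^ 2) : ℝ) : ℂ) * (b ε)⁻¹ := by
        push_cast; rw [div_eq_mul_inv]; ring
      rw [this, Complex.re_ofReal_mul, Complex.inv_re]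
      have h1 : 0 ≤ (b ε).re / Complex.normSq (b ε) := div_nonneg hbre.le (Complex.normSq_nonneg _)
      have h2 : 0 ≤ Real.pi ^ 2 * ‖x - y‖ ^ 2 := by positivity
      nlinarith
    have e3 : 4 * Real.pi ^ 2 * |s| ≤ ‖b ε‖ := by
      have := Complex.abs_im_le_norm (b ε)
      simp only [b, abs_mul] at this
      rwa [abs_of_nonneg (by positivity : (0:ℝ) ≤ 4), abs_of_nonneg (by positivity : (0:ℝ) ≤ Real.pi ^ 2)] at this
    have hsp : 0 < |s| := abs_pos.2 hs
    rw [e1]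
    calc _ ≤ (Real.pi / ‖b ε‖) ^ ((Module.finrank ℝ E : ℝ) / 2) * 1 := by gcongr
      _ ≤ (Real.pi / (4 * Real.pi ^ 2 * |s|)) ^ ((Module.finrank ℝ E : ℝ) / 2) := by
          rw [mul_one]
          gcongr
      _ = _ := by
          have : Real.pi / (4 * Real.pi ^ 2 * |s|) = (4 * Real.pi * |s|)⁻¹ := by field_simp
          rw [this, Real.inv_rpow (by positivity), neg_div, Real.rpow_neg (by positivity)]
  have hlim : Tendsto (fun n : ℕ => ∫ ξ, G (1 / ((n : ℝ) + 1)) ξ * g ξ) atTop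
      (𝓝 (∫ ξ, G 0 ξ * g ξ)) := by
    apply tendsto_integral_of_dominated_convergence (fun ξ => ‖g ξ‖)
    · intro n
      exact ((hGc _).mul g.continuous).aestronglyMeasurable
    · exact g.integrable.norm
    · intro n
      refine Eventually.of_forall fun ξ => ?_
      rw [norm_mul, hGn]
      refine mul_le_of_le_one_left (norm_nonneg _) (Real.exp_le_one_iff.2 ?_)
      have : 0 ≤ 1 / ((n : ℝ) + 1) * ‖ξ‖ ^ 2 := by positivity
      linarith
    · refine Eventually.of_forall fun ξ => ?_
      have hb : Continuous b := by
        have : b = fun ε : ℝ => (ε : ℂ) + ((4 * Real.pi ^ 2 * s : ℝ) : ℂ) * Complex.I := by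
          funext ε
          apply Complex.ext
          · rw [Complex.add_re, Complex.re_ofReal_mul]; simp [b]
          · rw [Complex.add_im, Complex.im_ofReal_mul]; simp [b]
        rw [this]; fun_prop
      have : Continuous (fun ε => G ε ξ * g ξ) := by simp only [G]; fun_prop
      exact (this.tendsto 0).comp tendsto_one_div_add_atTop_nhds_zero_nat
  have e0 : schEvol s f x = ∫ ξ, G 0 ξ * g ξ := by
    rw [schEvol_eq_field, schField]
    congr 1; funext ξ
    simp only [G, b, hg]
    congr 2
    have : (⟨0, 4 * Real.pi ^ 2 * s⟩ : ℂ) = ((4 * Real.pi ^ 2 * s : ℝ) : ℂ) * Complex.I := by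
      apply Complex.ext
      · rw [Complex.re_ofReal_mul]; simp
      · rw [Complex.im_ofReal_mul]; simp
    rw [this, real_inner_comm ξ x]
    push_cast
    ring
  rw [e0]
  exact le_of_tendsto hlim.norm (Eventually.of_forall fun n => hbound _ (by positivity))

/-- dispersive bound -/
lemma schEvol_lr (s : ℝ) (hs : s ≠ 0) (r q : ℝ) (hr : 2 < r) (hq : q = r / (r - 1)) (f : 𝓢(E, ℂ))
    (hf : HasCompactSupport f) :
    ∫⁻ x, ENNReal.ofReal (‖schEvol s f x‖ ^ r) ≤
      ENNReal.ofReal (4 * r / (r - 2) * 2 ^ (r - q) *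
        ((4 * Real.pi * |s|) ^ (-(Module.finrank ℝ E : ℝ) / 2)) ^ (r - 2) *
        (∫ x, ‖f x‖ ^ q) ^ (r - 1)) := by
  have hpi := Real.pi_pos
  have hsp : 0 < |s| := abs_pos.2 hs
  refine marcinkiewicz (fun f => schEvol s f) (fun f => (schEvol s f).continuous)
    (fun f g h hf x => schEvol_add s f g h hf x) ?_ _ (by positivity)
    (fun f x => schEvol_linf s hs f x) r q hr hq f hf
  intro f
  have hi : ∀ f : 𝓢(E, ℂ), Integrable (fun x => ‖f x‖ ^ 2) := by
    intro f
    have := (f.memLp 2 (μ := (volume : Measure E)))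
    exact this.integrable_norm_pow (by norm_num)
  rw [← ofReal_integral_eq_lintegral_ofReal (hi _) (Eventually.of_forall fun x => by positivity),
    ← ofReal_integral_eq_lintegral_ofReal (hi _) (Eventually.of_forall fun x => by positivity),
    schEvol_l2]

end Schrod

end
end

section
open MeasureTheory Set Filter Topology SchwartzMap FourierTransform
open scoped ENNReal NNReal

noncomputable section

set_option linter.unusedSectionVars false

lemma gn_cs {E : Type*} [MeasurableSpace E] {μ : Measure E} {F G : E → ℝ≥0∞}
    (hF : AEMeasurable F μ) (hG : AEMeasurable G μ) :
    ∫⁻ x, F x * G x ∂μ ≤ (∫⁻ x, F x ^ (2:ℝ) ∂μ) ^ (1/2:ℝ) * (∫⁻ x, G x ^ (2:ℝ) ∂μ) ^ (1/2:ℝ) := by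
  exact ENNReal.lintegral_mul_le_Lp_mul_Lq μ
    (by rw [Real.holderConjugate_iff]; norm_num) hF hG

lemma gn_algebra {D : ℝ} (hD : 2 ≤ D) {X M K c : ℝ≥0∞} (hX : X ≠ ⊤)
    (h : X ≤ c * ((M ^ (2/D) * X ^ ((D-2)/D)) ^ (1/2:ℝ) * K ^ (1/2:ℝ)) ^ (D/(D-1))) :
    X ≤ c ^ (2*(D-1)/D) * M ^ (2/D) * K := by
  have hD0 : 0 < D := by linarith
  have hD1 : 0 < D - 1 := by linarith
  rcases eq_or_ne X 0 with h0 | h0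
  · rw [h0]; exact zero_le
  have h1 := ENNReal.rpow_le_rpow h (z := 2*(D-1)/D) (by positivity)
  rw [ENNReal.mul_rpow_of_nonneg _ _ (by positivity), ← ENNReal.rpow_mul] at h1
  have e1 : D/(D-1) * (2*(D-1)/D) = 2 := by field_simp
  rw [e1, ENNReal.mul_rpow_of_nonneg _ _ (by norm_num), ← ENNReal.rpow_mul, ← ENNReal.rpow_mul] at h1
  norm_num at h1
  have e2 : 2*(D-1)/D = 1 + (D-2)/D := by field_simp; ring
  have h2 : X ^ (2*(D-1)/D) = X * X ^ ((D-2)/D) := by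
    rw [e2, ENNReal.rpow_add _ _ h0 hX, ENNReal.rpow_one]
  rw [h2] at h1
  have h3 : X ^ ((D-2)/D) ≠ 0 := by
    intro h; rw [ENNReal.rpow_eq_zero_iff] at h; tauto
  have h4 : X ^ ((D-2)/D) ≠ ⊤ := ENNReal.rpow_ne_top_of_nonneg (div_nonneg (by linarith) hD0.le) hX
  have h5 : X * X ^ ((D-2)/D) ≤ (c ^ (2*(D-1)/D) * M ^ (2/D) * K) * X ^ ((D-2)/D) := by
    refine h1.trans (le_of_eq ?_); ring
  exact (ENNReal.mul_le_mul_iff_left h3 h4).1 h5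

lemma gn_big (d : ℕ) (hd : 2 ≤ d) : ∃ C : ℝ≥0, ∀ g : EuclideanSpace ℝ (Fin d) → ℂ, ContDiff ℝ 1 g →
    HasCompactSupport g →
    ∫⁻ x, ‖g x‖ₑ ^ ((2:ℝ) + 4/d) ≤ C * (∫⁻ x, ‖g x‖ₑ ^ (2:ℝ)) ^ ((2:ℝ)/d)
      * ∫⁻ x, ‖fderiv ℝ g x‖ₑ ^ (2:ℝ) := by
  have hD : (2:ℝ) ≤ d := by exact_mod_cast hd
  set D : ℝ := (d:ℝ) with hDdef
  have hD0 : 0 < D := by linarith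
  have hD1 : 0 < D - 1 := by linarith
  set p : ℝ := D/(D-1)
  have hp0 : 0 < p := by positivity
  set a : ℝ≥0 := ⟨2*(D+2)*(D-1)/D^2, by positivity⟩
  have ha : (a:ℝ) = 2*(D+2)*(D-1)/D^2 := rfl
  have ha1 : (1:ℝ≥0) < a := by
    rw [← NNReal.coe_lt_coe, ha, lt_div_iff₀ (by positivity)]; norm_num; nlinarith
  set c : ℝ≥0 := lintegralPowLePowLIntegralFDerivConst
    (volume : Measure (EuclideanSpace ℝ (Fin d))) p * a ^ p
  refine ⟨c ^ (2*(D-1)/D), fun g hg hgc => ?_⟩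
  have hgcont := hg.continuous
  have hdc : Continuous (fderiv ℝ g) := hg.continuous_fderiv one_ne_zero
  have hm1 : Measurable (fun x => ‖g x‖ₑ) := hgcont.enorm.measurable
  have hm2 : Measurable (fun x => ‖fderiv ℝ g x‖ₑ) := hdc.enorm.measurable
  rw [ENNReal.coe_rpow_of_nonneg _ (by positivity)]
  refine gn_algebra hD ?_ ?_
  · have hint : Integrable (fun x => ‖g x‖ ^ ((2:ℝ) + 4/D)) := by
      refine Continuous.integrable_of_hasCompactSupport
        (hgcont.norm.rpow_const fun x => Or.inr (by positivity)) ?_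
      refine hgc.mono ?_
      intro x hx; contrapose hx
      simp only [Function.mem_support, not_not] at hx ⊢
      rw [hx, norm_zero, Real.zero_rpow (by positivity)]
    refine ne_of_lt (lt_of_eq_of_lt (lintegral_congr fun x => ?_) hint.2)
    rw [Real.enorm_rpow_of_nonneg (norm_nonneg _) (by positivity), enorm_norm]
  · have hv : ContDiff ℝ 1 (fun x => ‖g x‖ ^ (a:ℝ)) := hg.norm_rpow (by exact_mod_cast ha1)
    have hvc : HasCompactSupport (fun x => ‖g x‖ ^ (a:ℝ)) := by
      refine hgc.mono ?_
      intro x hx; contrapose hx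
      simp only [Function.mem_support, not_not] at hx ⊢
      rw [hx, norm_zero, Real.zero_rpow (by rw [ha]; positivity)]
    have h0 := lintegral_pow_le_pow_lintegral_fderiv (volume : Measure (EuclideanSpace ℝ (Fin d)))
      hv hvc (p := p) (by
        rw [Real.holderConjugate_iff, finrank_euclideanSpace_fin]
        refine ⟨by change 1 < D; linarith, ?_⟩
        change D⁻¹ + (D/(D-1))⁻¹ = 1
        field_simp; ring)
    have e1 : ∀ x, ‖‖g x‖ ^ (a:ℝ)‖ₑ ^ p = ‖g x‖ₑ ^ ((2:ℝ) + 4/D) := by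
      intro x
      rw [Real.enorm_rpow_of_nonneg (norm_nonneg _) a.coe_nonneg, enorm_norm, ← ENNReal.rpow_mul]
      congr 1
      rw [ha]; simp only [p]; field_simp; ring
    simp only [e1] at h0
    refine h0.trans ?_
    have h1 : ∫⁻ x, ‖fderiv ℝ (fun x => ‖g x‖ ^ (a:ℝ)) x‖ₑ ≤
        a * (((∫⁻ x, ‖g x‖ₑ ^ (2:ℝ)) ^ ((2:ℝ)/D) * (∫⁻ x, ‖g x‖ₑ ^ ((2:ℝ) + 4/D)) ^ ((D-2)/D)) ^ (1/2:ℝ)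
          * (∫⁻ x, ‖fderiv ℝ g x‖ₑ ^ (2:ℝ)) ^ (1/2:ℝ)) := by
      calc _ ≤ ∫⁻ x, a * (‖g x‖ₑ ^ ((a:ℝ) - 1) * ‖fderiv ℝ g x‖ₑ) := by
            refine lintegral_mono fun x => ?_
            rw [← mul_assoc]
            exact enorm_fderiv_norm_rpow_le (hg.differentiable one_ne_zero) ha1
        _ = a * ∫⁻ x, (‖g x‖ₑ ^ ((a:ℝ) - 1) * ‖fderiv ℝ g x‖ₑ) := by
            rw [lintegral_const_mul]
            exact (hm1.pow_const _).mul hm2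
        _ ≤ _ := by
            gcongr
            refine (gn_cs (hm1.pow_const _).aemeasurable hm2.aemeasurable).trans ?_
            gcongr
            have e2 : ∀ x, (‖g x‖ₑ ^ ((a:ℝ) - 1)) ^ (2:ℝ) =
                (‖g x‖ₑ ^ (2:ℝ)) ^ (2/D) * (‖g x‖ₑ ^ ((2:ℝ)+4/D)) ^ ((D-2)/D) := by
              intro x
              rw [← ENNReal.rpow_mul, ← ENNReal.rpow_mul, ← ENNReal.rpow_mul,
                ← ENNReal.rpow_add_of_nonneg]
              · congr 1; rw [ha]; field_simp; ring
              · positivity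
              · exact mul_nonneg (by positivity) (div_nonneg (by linarith) hD0.le)
            simp only [e2]
            refine ENNReal.lintegral_mul_norm_pow_le (hm1.pow_const _).aemeasurable
              (hm1.pow_const _).aemeasurable (by positivity) (div_nonneg (by linarith) hD0.le) ?_
            field_simp; ring
    refine (mul_le_mul_right (ENNReal.rpow_le_rpow h1 hp0.le) _).trans (le_of_eq ?_)
    rw [ENNReal.mul_rpow_of_nonneg _ _ hp0.le, ← mul_assoc]
    congr 1
    simp only [c]
    rw [ENNReal.coe_mul, ENNReal.coe_rpow_of_nonneg _ hp0.le]

lemma gn_one : ∃ C : ℝ≥0, ∀ g : EuclideanSpace ℝ (Fin 1) → ℂ, ContDiff ℝ 1 g →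
    HasCompactSupport g →
    ∫⁻ x, ‖g x‖ₑ ^ ((2:ℝ) + 4/(1:ℕ)) ≤ C * (∫⁻ x, ‖g x‖ₑ ^ (2:ℝ)) ^ ((2:ℝ)/(1:ℕ))
      * ∫⁻ x, ‖fderiv ℝ g x‖ₑ ^ (2:ℝ) := by
  refine ⟨4, fun g hg hgc => ?_⟩
  let b : OrthonormalBasis (Fin 1) ℝ ℝ :=
    (stdOrthonormalBasis ℝ ℝ).reindex (finCongr (Module.finrank_self ℝ))
  let e : ℝ ≃ₗᵢ[ℝ] EuclideanSpace ℝ (Fin 1) := b.repr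
  have he : MeasurePreserving e := e.measurePreserving
  have hgcont := hg.continuous
  have hdc : Continuous (fderiv ℝ g) := hg.continuous_fderiv one_ne_zero
  have hm1 : Measurable (fun x => ‖g x‖ₑ) := hgcont.enorm.measurable
  have hm2 : Measurable (fun x => ‖fderiv ℝ g x‖ₑ) := hdc.enorm.measurable
  set M := ∫⁻ x, ‖g x‖ₑ ^ (2:ℝ)
  set K := ∫⁻ x, ‖fderiv ℝ g x‖ₑ ^ (2:ℝ)
  have hh : ContDiff ℝ 1 (fun y => g (e y)) := hg.comp e.contDiff
  have hH : ContDiff ℝ 1 (fun y => ‖g (e y)‖ ^ ((2:ℝ≥0):ℝ)) := hh.norm_rpow (by norm_num)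
  have hHc : HasCompactSupport (fun y => ‖g (e y)‖ ^ ((2:ℝ≥0):ℝ)) := by
    have := hgc.comp_homeomorph e.toHomeomorph
    refine this.mono ?_
    intro x hx; contrapose hx
    simp only [Function.mem_support, not_not, Function.comp] at hx ⊢
    have hx' : g (e x) = 0 := hx
    rw [hx', norm_zero, Real.zero_rpow (by norm_num)]
  have key : ∀ x, ‖g x‖ₑ ^ (2:ℝ) ≤ 2 * (M ^ (1/2:ℝ) * K ^ (1/2:ℝ)) := by
    intro x
    have h1 := hHc.enorm_le_lintegral_Ici_deriv hH (e.symm x)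
    simp only [e.apply_symm_apply] at h1
    rw [Real.enorm_rpow_of_nonneg (norm_nonneg _) (by norm_num), enorm_norm] at h1
    change ‖g x‖ₑ ^ (2:ℝ) ≤ _ at h1
    refine (h1.trans (setLIntegral_le_lintegral _ _)).trans ?_
    calc _ ≤ ∫⁻ y, 2 * (‖g (e y)‖ₑ * ‖fderiv ℝ g (e y)‖ₑ) := by
          refine lintegral_mono fun y => ?_
          have h2 := enorm_fderiv_norm_rpow_le (x := y) (hh.differentiable one_ne_zero)
            (p := 2) (by norm_num)
          have h3 : ‖fderiv ℝ (fun y => g (e y)) y‖ₑ ≤ ‖fderiv ℝ g (e y)‖ₑ := by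
            rw [enorm_le_iff_norm_le]
            have : fderiv ℝ (fun y => g (e y)) y = (fderiv ℝ g (e y)).comp
                (e.toContinuousLinearEquiv : ℝ →L[ℝ] _) :=
              ((hg.differentiable one_ne_zero (e y)).hasFDerivAt.comp y
                e.toContinuousLinearEquiv.hasFDerivAt).fderiv
            rw [this]
            refine ContinuousLinearMap.opNorm_le_bound _ (norm_nonneg _) fun z => ?_
            have := (fderiv ℝ g (e y)).le_opNorm (e z)
            rw [e.norm_map] at this
            exact this
          rw [← enorm_norm, norm_deriv_eq_norm_fderiv, enorm_norm]
          refine h2.trans ?_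
          norm_num
          rw [mul_assoc]
          gcongr
      _ = 2 * ∫⁻ y, (‖g (e y)‖ₑ * ‖fderiv ℝ g (e y)‖ₑ) := by
          rw [lintegral_const_mul]
          exact (hm1.mul hm2).comp e.continuous.measurable
      _ = 2 * ∫⁻ y, (‖g y‖ₑ * ‖fderiv ℝ g y‖ₑ) := by
          congr 1
          exact he.lintegral_comp (hm1.mul hm2)
      _ ≤ _ := by
          gcongr
          exact gn_cs hm1.aemeasurable hm2.aemeasurable
  calc _ = ∫⁻ x, (‖g x‖ₑ ^ (2:ℝ)) ^ (2:ℝ) * ‖g x‖ₑ ^ (2:ℝ) := by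
        refine lintegral_congr fun x => ?_
        rw [← ENNReal.rpow_mul, ← ENNReal.rpow_add_of_nonneg _ _ (by norm_num) (by norm_num)]
        norm_num
    _ ≤ ∫⁻ x, (2 * (M ^ (1/2:ℝ) * K ^ (1/2:ℝ))) ^ (2:ℝ) * ‖g x‖ₑ ^ (2:ℝ) := by
        refine lintegral_mono fun x => ?_
        gcongr
        exact key x
    _ = (2 * (M ^ (1/2:ℝ) * K ^ (1/2:ℝ))) ^ (2:ℝ) * M := by
        rw [lintegral_const_mul]
        exact hm1.pow_const _
    _ = _ := by
        rw [ENNReal.mul_rpow_of_nonneg _ _ (by norm_num), ENNReal.mul_rpow_of_nonneg _ _ (by norm_num),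
          ← ENNReal.rpow_mul, ← ENNReal.rpow_mul]
        norm_num
        ring

lemma gn (d : ℕ) (hd : 0 < d) : ∃ C : ℝ≥0, ∀ g : EuclideanSpace ℝ (Fin d) → ℂ, ContDiff ℝ 1 g →
    HasCompactSupport g →
    ∫⁻ x, ‖g x‖ₑ ^ ((2:ℝ) + 4/d) ≤ C * (∫⁻ x, ‖g x‖ₑ ^ (2:ℝ)) ^ ((2:ℝ)/d)
      * ∫⁻ x, ‖fderiv ℝ g x‖ₑ ^ (2:ℝ) := by
  rcases Nat.lt_or_ge d 2 with h | h
  · obtain rfl : d = 1 := by omega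
    exact gn_one
  · exact gn_big d h

end
end

section
open MeasureTheory Set Filter Topology SchwartzMap FourierTransform
open scoped ENNReal NNReal

noncomputable section

set_option linter.unusedSectionVars false

/-- partial derivative in space -/
def pd {d : ℕ} {V : Type*} [NormedAddCommGroup V] [NormedSpace ℝ V] (k : Fin d)
    (f : EuclideanSpace ℝ (Fin d) → V) (x : EuclideanSpace ℝ (Fin d)) : V :=
  fderiv ℝ f x (stdVec d k)

/-- directional derivative on space-time -/
def Dv {d : ℕ} {V : Type*} [NormedAddCommGroup V] [NormedSpace ℝ V]
    (v : ℝ × EuclideanSpace ℝ (Fin d)) (F : ℝ × EuclideanSpace ℝ (Fin d) → V)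
    (p : ℝ × EuclideanSpace ℝ (Fin d)) : V :=
  fderiv ℝ F p v

/-- smooth over the time set -/
def SmI {d : ℕ} (I : Set ℝ) (F : ℝ × EuclideanSpace ℝ (Fin d) → ℂ) : Prop :=
  ∀ p, p.1 ∈ I → ContDiffAt ℝ (⊤ : ℕ∞) F p

section
variable {d : ℕ} {V : Type*} [NormedAddCommGroup V] [NormedSpace ℝ V]

lemma pd_contDiff {f : EuclideanSpace ℝ (Fin d) → V} (hf : ContDiff ℝ (⊤ : ℕ∞) f) (k : Fin d) :
    ContDiff ℝ (⊤ : ℕ∞) (pd k f) := by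
  have h := (contDiff_infty_iff_fderiv.1 hf).2
  exact h.clm_apply contDiff_const

lemma pd_hasLine {f : EuclideanSpace ℝ (Fin d) → V} (hf : ContDiff ℝ (⊤ : ℕ∞) f) (k : Fin d) (x) :
    HasLineDerivAt ℝ f (pd k f x) x (stdVec d k) :=
  ((hf.differentiable (by simp)) x).hasFDerivAt.hasLineDerivAt _

lemma pd_compact {f : EuclideanSpace ℝ (Fin d) → V} (hf : HasCompactSupport f) (k : Fin d) :
    HasCompactSupport (pd k f) := by
  refine (hf.fderiv ℝ).mono ?_
  intro x hx; contrapose hx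
  simp only [Function.mem_support, not_not, pd] at hx ⊢
  rw [hx]; rfl

lemma div_zero' {W W' : EuclideanSpace ℝ (Fin d) → V} {v : EuclideanSpace ℝ (Fin d)}
    (hW : Continuous W) (hWc : HasCompactSupport W)
    (hW' : Continuous W') (hWc' : HasCompactSupport W')
    (h : ∀ x, HasLineDerivAt ℝ W (W' x) x v) : ∫ x, W' x = 0 := by
  have := integral_bilinear_hasLineDerivAt_right_eq_neg_left_of_integrable
    (μ := (volume : Measure (EuclideanSpace ℝ (Fin d))))
    (f := fun _ => (1:ℝ)) (f' := fun _ => (0:ℝ)) (g := W) (g' := W') (v := v)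
    (B := ContinuousLinearMap.lsmul ℝ ℝ) (by simp)
    (by simpa using hW'.integrable_of_hasCompactSupport hWc')
    (by simpa using hW.integrable_of_hasCompactSupport hWc)
    (fun x _ => by
      have := hasDerivAt_const (0:ℝ) (1:ℝ)
      exact this) (fun x _ => h x)
  simpa using this

lemma Dv_smI {I : Set ℝ} {F : ℝ × EuclideanSpace ℝ (Fin d) → ℂ} (hF : SmI I F) (v) :
    SmI I (Dv v F) := by
  intro p hp
  have := (hF p hp).fderiv_right (m := (⊤ : ℕ∞)) (by simp)
  exact this.clm_apply contDiffAt_const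

lemma Dv_comm {I : Set ℝ} {F : ℝ × EuclideanSpace ℝ (Fin d) → ℂ} (hF : SmI I F) (v w)
    (p) (hp : p.1 ∈ I) : Dv v (Dv w F) p = Dv w (Dv v F) p := by
  have h := (hF p hp).isSymmSndFDerivAt (by simp only [minSmoothness_of_isRCLikeNormedField]; exact WithTop.coe_le_coe.2 le_top)
  have hd : DifferentiableAt ℝ (fderiv ℝ F) p :=
    ((hF p hp).fderiv_right (m := (⊤ : ℕ∞)) (by simp)).differentiableAt (by simp)
  have e : ∀ a b, Dv a (Dv b F) p = fderiv ℝ (fderiv ℝ F) p a b := by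
    intro a b
    have := (hd.hasFDerivAt.clm_apply (hasFDerivAt_const b p)).fderiv
    unfold Dv
    rw [this]; simp
  rw [e, e, h.eq]

lemma SmI.cont {I : Set ℝ} {F : ℝ × EuclideanSpace ℝ (Fin d) → ℂ} (hF : SmI I F) :
    ContinuousOn F (I ×ˢ univ) := fun p hp => (hF p hp.1).continuousAt.continuousWithinAt

lemma SmI.slice {I : Set ℝ} {F : ℝ × EuclideanSpace ℝ (Fin d) → ℂ} (hF : SmI I F) {t} (ht : t ∈ I) :
    ContDiff ℝ (⊤ : ℕ∞) (fun x => F (t, x)) := by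
  rw [contDiff_iff_contDiffAt]
  intro x
  exact (hF (t, x) ht).comp x (contDiffAt_const.prodMk contDiffAt_id)

lemma SmI.pd_slice {I : Set ℝ} {F : ℝ × EuclideanSpace ℝ (Fin d) → ℂ} (hF : SmI I F) {t} (ht : t ∈ I)
    (k : Fin d) : pd k (fun x => F (t, x)) = fun x => Dv (0, stdVec d k) F (t, x) := by
  funext x
  have h1 := ((hF (t, x) ht).differentiableAt (by simp)).hasFDerivAt
  have h2 : HasFDerivAt (fun y : EuclideanSpace ℝ (Fin d) => (t, y))
    (ContinuousLinearMap.inr ℝ ℝ (EuclideanSpace ℝ (Fin d))) x := hasFDerivAt_prodMk_right t x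
  have := (h1.comp x h2).fderiv
  unfold pd Dv
  change fderiv ℝ (F ∘ fun y => (t, y)) x _ = _
  rw [this]; simp

lemma SmI.time {I : Set ℝ} {F : ℝ × EuclideanSpace ℝ (Fin d) → ℂ} (hF : SmI I F) {t} (ht : t ∈ I)
    (x) : HasDerivAt (fun s => F (s, x)) (Dv (1, 0) F (t, x)) t := by
  have h1 := ((hF (t, x) ht).differentiableAt (by simp)).hasFDerivAt
  have h2 : HasDerivAt (fun s : ℝ => (s, x)) ((1:ℝ), (0 : EuclideanSpace ℝ (Fin d))) t :=
    (hasDerivAt_id t).prodMk (hasDerivAt_const t x)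
  exact h1.comp_hasDerivAt t h2

/-- differentiation under the integral with compactly supported weight -/
lemma TI {I : Set ℝ} (hI : IsOpen I) {φ : EuclideanSpace ℝ (Fin d) → ℝ} (hφ : Continuous φ)
    (hφc : HasCompactSupport φ) {ρ ρ' : ℝ × EuclideanSpace ℝ (Fin d) → V}
    (hρ : ContinuousOn ρ (I ×ˢ univ)) (hρ' : ContinuousOn ρ' (I ×ˢ univ))
    (h : ∀ t ∈ I, ∀ x, HasDerivAt (fun s => ρ (s, x)) (ρ' (t, x)) t) {t : ℝ} (ht : t ∈ I) :
    HasDerivAt (fun s => ∫ x, φ x • ρ (s, x)) (∫ x, φ x • ρ' (t, x)) t := by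
  obtain ⟨ε, hε, hεI⟩ := Metric.isOpen_iff.1 hI t ht
  have hsub : Icc (t - ε/2) (t + ε/2) ⊆ I := by
    intro s hs
    apply hεI
    rw [Metric.mem_ball, Real.dist_eq, abs_lt]
    constructor <;> linarith [hs.1, hs.2]
  have hK : IsCompact (Icc (t - ε/2) (t + ε/2) ×ˢ tsupport φ) := isCompact_Icc.prod hφc
  have hc : ContinuousOn (fun p : ℝ × EuclideanSpace ℝ (Fin d) => ρ' p)
      (Icc (t - ε/2) (t + ε/2) ×ˢ tsupport φ) :=
    hρ'.mono (prod_mono hsub (subset_univ _))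
  obtain ⟨C, hC⟩ := hK.exists_bound_of_continuousOn hc
  have slice : ∀ (σ : ℝ × EuclideanSpace ℝ (Fin d) → V), ContinuousOn σ (I ×ˢ univ) → ∀ s ∈ I,
      Continuous (fun x => σ (s, x)) := by
    intro σ hσ s hs
    rw [← continuousOn_univ]
    exact hσ.comp (by fun_prop) (fun x _ => ⟨hs, mem_univ _⟩)
  have cs : ∀ (σ : EuclideanSpace ℝ (Fin d) → V), HasCompactSupport (fun x => φ x • σ x) := by
    intro σ
    refine hφc.mono fun x hx => ?_
    contrapose hx
    simp only [Function.mem_support, not_not] at hx ⊢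
    rw [hx, zero_smul]
  refine (hasDerivAt_integral_of_dominated_loc_of_deriv_le (s := Icc (t - ε/2) (t + ε/2))
    (F := fun s x => φ x • ρ (s, x)) (F' := fun s x => φ x • ρ' (s, x))
    (bound := fun x => |φ x| * C) (Icc_mem_nhds (by linarith) (by linarith)) ?_ ?_ ?_ ?_ ?_ ?_).2
  · filter_upwards [hI.mem_nhds ht] with s hs
    exact (hφ.smul (slice ρ hρ s hs)).aestronglyMeasurable
  · exact (hφ.smul (slice ρ hρ t ht)).integrable_of_hasCompactSupport (cs _)
  · exact (hφ.smul (slice ρ' hρ' t ht)).aestronglyMeasurable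
  · refine ae_of_all _ fun x s hs => ?_
    by_cases hx : φ x = 0
    · simp [hx]
    · rw [norm_smul, Real.norm_eq_abs]
      gcongr
      exact hC (s, x) ⟨hs, subset_tsupport _ hx⟩
  · refine (Continuous.integrable_of_hasCompactSupport hφ.abs ?_).mul_const C
    refine hφc.mono fun x hx => ?_
    contrapose hx
    simp only [Function.mem_support, not_not] at hx ⊢
    rw [hx, abs_zero]
  · exact ae_of_all _ fun x s hs => (h s (hsub hs) x).const_smul (φ x)

end

end
end

section
open MeasureTheory Set Filter Topology SchwartzMap FourierTransform
open scoped ENNReal NNReal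

noncomputable section

set_option linter.unusedSectionVars false

section HL
variable {E : Type*} [NormedAddCommGroup E] [NormedSpace ℝ E] {x v : E}

lemma HL_mul {A : Type*} [NormedRing A] [NormedAlgebra ℝ A] {f g : E → A} {f' g' : A}
    (hf : HasLineDerivAt ℝ f f' x v) (hg : HasLineDerivAt ℝ g g' x v) :
    HasLineDerivAt ℝ (fun y => f y * g y) (f' * g x + f x * g') x v := by
  have := HasDerivAt.mul hf hg
  simp only [zero_smul, add_zero] at this
  exact this

lemma HL_conj {f : E → ℂ} {f' : ℂ} (hf : HasLineDerivAt ℝ f f' x v) :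
    HasLineDerivAt ℝ (fun y => (starRingEnd ℂ) (f y)) ((starRingEnd ℂ) f') x v :=
  (Complex.conjCLE.toContinuousLinearMap.hasFDerivAt).comp_hasDerivAt (0:ℝ) hf

lemma HL_re {f : E → ℂ} {f' : ℂ} (hf : HasLineDerivAt ℝ f f' x v) :
    HasLineDerivAt ℝ (fun y => (f y).re) f'.re x v :=
  (Complex.reCLM.hasFDerivAt).comp_hasDerivAt (0:ℝ) hf

lemma HL_im {f : E → ℂ} {f' : ℂ} (hf : HasLineDerivAt ℝ f f' x v) :
    HasLineDerivAt ℝ (fun y => (f y).im) f'.im x v :=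
  (Complex.imCLM.hasFDerivAt).comp_hasDerivAt (0:ℝ) hf

lemma HL_ofReal {f : E → ℝ} {f' : ℝ} (hf : HasLineDerivAt ℝ f f' x v) :
    HasLineDerivAt ℝ (fun y => ((f y : ℝ) : ℂ)) (f' : ℂ) x v :=
  (Complex.ofRealCLM.hasFDerivAt).comp_hasDerivAt (0:ℝ) hf

lemma HL_sum {ι : Type*} [Fintype ι] {f : ι → E → ℝ} {f' : ι → ℝ}
    (hf : ∀ i, HasLineDerivAt ℝ (f i) (f' i) x v) :
    HasLineDerivAt ℝ (fun y => ∑ i, f i y) (∑ i, f' i) x v :=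
  HasDerivAt.fun_sum (fun i _ => hf i)

lemma HL_add {f g : E → ℝ} {f' g' : ℝ}
    (hf : HasLineDerivAt ℝ f f' x v) (hg : HasLineDerivAt ℝ g g' x v) :
    HasLineDerivAt ℝ (fun y => f y + g y) (f' + g') x v :=
  HasDerivAt.add hf hg

lemma HL_sub {f g : E → ℝ} {f' g' : ℝ}
    (hf : HasLineDerivAt ℝ f f' x v) (hg : HasLineDerivAt ℝ g g' x v) :
    HasLineDerivAt ℝ (fun y => f y - g y) (f' - g') x v :=
  HasDerivAt.sub hf hg

lemma HL_cmul {f : E → ℝ} {f' : ℝ} (c : ℝ) (hf : HasLineDerivAt ℝ f f' x v) :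
    HasLineDerivAt ℝ (fun y => c * f y) (c * f') x v :=
  HasDerivAt.const_mul c hf

lemma hasDerivAt_norm_rpow_complex {f : ℝ → ℂ} {f' : ℂ} {s : ℝ} (hf : HasDerivAt f f' s)
    {r : ℝ} (hr : 1 < r) :
    HasDerivAt (fun y => ‖f y‖ ^ r) (r * ‖f s‖ ^ (r - 2) * ((starRingEnd ℂ) (f s) * f').re) s := by
  have := (hasFDerivAt_norm_rpow (f s) hr).comp_hasDerivAt s hf
  simp only [ContinuousLinearMap.smul_apply, smul_eq_mul] at this
  have e : (innerSL ℝ (f s)) f' = ((starRingEnd ℂ) (f s) * f').re := by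
    rw [innerSL_apply_apply, Complex.inner, mul_comm]
  rw [e] at this
  exact this

lemma HL_rpow {f : E → ℂ} {f' : ℂ} (hf : HasLineDerivAt ℝ f f' x v) {r : ℝ} (hr : 1 < r) :
    HasLineDerivAt ℝ (fun y => ‖f y‖ ^ r)
      (r * ‖f x‖ ^ (r - 2) * ((starRingEnd ℂ) (f x) * f').re) x v := by
  have := hasDerivAt_norm_rpow_complex hf hr
  simp only [zero_smul, add_zero] at this
  exact this

end HL

section
variable {d : ℕ}

local notation "cj" => starRingEnd ℂ

lemma pd_comm {V : Type*} [NormedAddCommGroup V] [NormedSpace ℝ V]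
    {f : EuclideanSpace ℝ (Fin d) → V} (hf : ContDiff ℝ (⊤ : ℕ∞) f) (j k : Fin d) (x) :
    pd j (pd k f) x = pd k (pd j f) x := by
  have h := (hf.contDiffAt (x := x)).isSymmSndFDerivAt
    (by simp only [minSmoothness_of_isRCLikeNormedField]; exact WithTop.coe_le_coe.2 le_top)
  have hd : DifferentiableAt ℝ (fderiv ℝ f) x :=
    ((hf.contDiffAt (x := x)).fderiv_right (m := (⊤ : ℕ∞)) (by simp)).differentiableAt (by simp)
  have e : ∀ a b, pd a (pd b f) x = fderiv ℝ (fderiv ℝ f) x (stdVec d a) (stdVec d b) := by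
    intro a b
    have := (hd.hasFDerivAt.clm_apply (hasFDerivAt_const (stdVec d b) x)).fderiv
    unfold pd
    rw [this]; simp
  rw [e, e, h.eq]

lemma pd_zero_off {V : Type*} [NormedAddCommGroup V] [NormedSpace ℝ V]
    {f : EuclideanSpace ℝ (Fin d) → V} {K : Set (EuclideanSpace ℝ (Fin d))} (hK : IsClosed K)
    (h : ∀ x ∉ K, f x = 0) (k : Fin d) : ∀ x ∉ K, pd k f x = 0 := by
  intro x hx
  have : f =ᶠ[𝓝 x] fun _ => 0 := by
    filter_upwards [hK.isOpen_compl.mem_nhds hx] with y hy using h y hy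
  unfold pd
  rw [this.fderiv_eq]; simp

/-- integrals agree when the integrands differ by a divergence -/
lemma int_eq_of_div {V : Type*} [NormedAddCommGroup V] [NormedSpace ℝ V] {ι : Type*} [Fintype ι]
    {K : Set (EuclideanSpace ℝ (Fin d))} (hK : IsCompact K)
    {L R : EuclideanSpace ℝ (Fin d) → V} {W W' : ι → EuclideanSpace ℝ (Fin d) → V}
    {v : ι → EuclideanSpace ℝ (Fin d)}
    (hL : Continuous L) (hR : Continuous R) (hW : ∀ i, Continuous (W i))
    (hW' : ∀ i, Continuous (W' i))
    (hL0 : ∀ x ∉ K, L x = 0) (hR0 : ∀ x ∉ K, R x = 0) (hW0 : ∀ i, ∀ x ∉ K, W i x = 0)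
    (hW0' : ∀ i, ∀ x ∉ K, W' i x = 0)
    (hd : ∀ i x, HasLineDerivAt ℝ (W i) (W' i x) x (v i))
    (h : ∀ x, L x - R x = ∑ i, W' i x) : ∫ x, L x = ∫ x, R x := by
  have hc : ∀ {G : EuclideanSpace ℝ (Fin d) → V}, (∀ x ∉ K, G x = 0) → HasCompactSupport G :=
    fun hG => HasCompactSupport.intro hK hG
  have i1 := hL.integrable_of_hasCompactSupport (μ := volume) (hc hL0)
  have i2 := hR.integrable_of_hasCompactSupport (μ := volume) (hc hR0)
  rw [← sub_eq_zero, ← integral_sub i1 i2]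
  simp only [h]
  rw [integral_finset_sum _ fun i _ => (hW' i).integrable_of_hasCompactSupport (hc (hW0' i))]
  exact Finset.sum_eq_zero fun i _ => div_zero' (hW i) (hc (hW0 i)) (hW' i) (hc (hW0' i)) (hd i)

variable {f g : EuclideanSpace ℝ (Fin d) → ℂ} {φ : EuclideanSpace ℝ (Fin d) → ℝ}

lemma mass_flux (hf : ContDiff ℝ (⊤ : ℕ∞) f) (hφ : ContDiff ℝ (⊤ : ℕ∞) φ) (hφc : HasCompactSupport φ) :
    ∫ x, φ x * (cj (f x) * ∑ k, pd k (pd k f) x).im =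
      ∫ x, -∑ k, pd k φ x * (cj (f x) * pd k f x).im := by
  have c0 := hf.continuous
  have c1 := fun k => (pd_contDiff hf k).continuous
  have c2 := fun k => (pd_contDiff (pd_contDiff hf k) k).continuous
  have b0 := hφ.continuous
  have b1 := fun k => (pd_contDiff hφ k).continuous
  have z0 : ∀ x ∉ tsupport φ, φ x = 0 := fun x hx => image_eq_zero_of_notMem_tsupport hx
  have z1 := fun k => pd_zero_off (isClosed_tsupport φ) z0 k
  refine int_eq_of_div (K := tsupport φ) hφc
    (W := fun k x => φ x * (cj (f x) * pd k f x).im)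
    (W' := fun k x => pd k φ x * (cj (f x) * pd k f x).im +
      φ x * (cj (pd k f x) * pd k f x + cj (f x) * pd k (pd k f) x).im)
    (v := fun k => stdVec d k) ?_ ?_ ?_ ?_ ?_ ?_ ?_ ?_ ?_ ?_
  · fun_prop
  · fun_prop
  · intro k; fun_prop
  · intro k; fun_prop
  · intro x hx; simp [z0 x hx]
  · intro x hx; simp [z1 _ x hx]
  · intro k x hx; simp [z0 x hx]
  · intro k x hx; simp [z0 x hx, z1 _ x hx]
  · intro k x
    exact HL_mul (pd_hasLine hφ k x) (HL_im (HL_mul (HL_conj (pd_hasLine hf k x))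
      (pd_hasLine (pd_contDiff hf k) k x)))
  · intro x
    rw [sub_neg_eq_add, Finset.mul_sum, Complex.im_sum, Finset.mul_sum, ← Finset.sum_add_distrib]
    refine Finset.sum_congr rfl fun k _ => ?_
    simp only [Complex.add_im, Complex.mul_im, Complex.conj_re, Complex.conj_im]
    ring

lemma energy_flux (hf : ContDiff ℝ (⊤ : ℕ∞) f) (hg : ContDiff ℝ (⊤ : ℕ∞) g)
    (hφ : ContDiff ℝ (⊤ : ℕ∞) φ) (hφc : HasCompactSupport φ) :
    ∫ x, φ x * (∑ k, (cj (pd k f x) * pd k g x).re + (cj (∑ k, pd k (pd k f) x) * g x).re) =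
      ∫ x, -∑ k, pd k φ x * (cj (pd k f x) * g x).re := by
  have c0 := hf.continuous
  have c1 := fun k => (pd_contDiff hf k).continuous
  have c2 := fun k => (pd_contDiff (pd_contDiff hf k) k).continuous
  have d0 := hg.continuous
  have d1 := fun k => (pd_contDiff hg k).continuous
  have b0 := hφ.continuous
  have b1 := fun k => (pd_contDiff hφ k).continuous
  have z0 : ∀ x ∉ tsupport φ, φ x = 0 := fun x hx => image_eq_zero_of_notMem_tsupport hx
  have z1 := fun k => pd_zero_off (isClosed_tsupport φ) z0 k
  refine int_eq_of_div (K := tsupport φ) hφc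
    (W := fun k x => φ x * (cj (pd k f x) * g x).re)
    (W' := fun k x => pd k φ x * (cj (pd k f x) * g x).re +
      φ x * (cj (pd k (pd k f) x) * g x + cj (pd k f x) * pd k g x).re)
    (v := fun k => stdVec d k) ?_ ?_ ?_ ?_ ?_ ?_ ?_ ?_ ?_ ?_
  · fun_prop
  · fun_prop
  · intro k; fun_prop
  · intro k; fun_prop
  · intro x hx; simp [z0 x hx]
  · intro x hx; simp [z1 _ x hx]
  · intro k x hx; simp [z0 x hx]
  · intro k x hx; simp [z0 x hx, z1 _ x hx]
  · intro k x
    exact HL_mul (pd_hasLine hφ k x) (HL_re (HL_mul (HL_conj (pd_hasLine (pd_contDiff hf k) k x))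
      (pd_hasLine hg k x)))
  · intro x
    rw [sub_neg_eq_add, map_sum, Finset.sum_mul, Complex.re_sum, ← Finset.sum_add_distrib,
      Finset.mul_sum, ← Finset.sum_add_distrib]
    refine Finset.sum_congr rfl fun k _ => ?_
    simp only [Complex.add_re]
    ring

lemma dual_flux (hf : ContDiff ℝ (⊤ : ℕ∞) f) (hg : ContDiff ℝ (⊤ : ℕ∞) g)
    (hφ : ContDiff ℝ (⊤ : ℕ∞) φ) (hφc : HasCompactSupport φ) :
    ∫ x, (φ x : ℂ) * ((∑ k, pd k (pd k f) x) * cj (g x) - f x * cj (∑ k, pd k (pd k g) x)) =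
      ∫ x, -∑ k, (2 * ((pd k φ x : ℝ) : ℂ) * (pd k f x * cj (g x)) +
        ((pd k (pd k φ) x : ℝ) : ℂ) * (f x * cj (g x))) := by
  have c0 := hf.continuous
  have c1 := fun k => (pd_contDiff hf k).continuous
  have c2 := fun k => (pd_contDiff (pd_contDiff hf k) k).continuous
  have d0 := hg.continuous
  have d1 := fun k => (pd_contDiff hg k).continuous
  have d2 := fun k => (pd_contDiff (pd_contDiff hg k) k).continuous
  have b0 := hφ.continuous
  have b1 := fun k => (pd_contDiff hφ k).continuous
  have b2 := fun k => (pd_contDiff (pd_contDiff hφ k) k).continuous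
  have z0 : ∀ x ∉ tsupport φ, φ x = 0 := fun x hx => image_eq_zero_of_notMem_tsupport hx
  have z1 := fun k => pd_zero_off (isClosed_tsupport φ) z0 k
  have z2 := fun k => pd_zero_off (isClosed_tsupport φ) (z1 k) k
  refine int_eq_of_div (K := tsupport φ) hφc
    (W := fun k x => (φ x : ℂ) * (pd k f x * cj (g x)) - (φ x : ℂ) * (f x * cj (pd k g x))
      + ((pd k φ x : ℝ) : ℂ) * (f x * cj (g x)))
    (W' := fun k x => (((pd k φ x : ℝ) : ℂ) * (pd k f x * cj (g x)) +
        (φ x : ℂ) * (pd k (pd k f) x * cj (g x) + pd k f x * cj (pd k g x)))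
      - (((pd k φ x : ℝ) : ℂ) * (f x * cj (pd k g x)) +
        (φ x : ℂ) * (pd k f x * cj (pd k g x) + f x * cj (pd k (pd k g) x)))
      + (((pd k (pd k φ) x : ℝ) : ℂ) * (f x * cj (g x)) +
        ((pd k φ x : ℝ) : ℂ) * (pd k f x * cj (g x) + f x * cj (pd k g x))))
    (v := fun k => stdVec d k) ?_ ?_ ?_ ?_ ?_ ?_ ?_ ?_ ?_ ?_
  · fun_prop
  · fun_prop
  · intro k; fun_prop
  · intro k; fun_prop
  · intro x hx; simp [z0 x hx]
  · intro x hx; simp [z1 _ x hx, z2 _ x hx]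
  · intro k x hx; simp [z0 x hx, z1 _ x hx]
  · intro k x hx; simp [z0 x hx, z1 _ x hx, z2 _ x hx]
  · intro k x
    have hφ' := HL_ofReal (pd_hasLine hφ k x)
    have hφ1' := HL_ofReal (pd_hasLine (pd_contDiff hφ k) k x)
    have hf' := pd_hasLine hf k x
    have hf1' := pd_hasLine (pd_contDiff hf k) k x
    have hg' := HL_conj (pd_hasLine hg k x)
    have hg1' := HL_conj (pd_hasLine (pd_contDiff hg k) k x)
    have A1 := HL_mul hφ' (HL_mul hf1' hg')
    have A2 := HL_mul hφ' (HL_mul hf' hg1')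
    have A3 := HL_mul hφ1' (HL_mul hf' hg')
    exact HasDerivAt.add (HasDerivAt.sub A1 A2) A3
  · intro x
    rw [sub_neg_eq_add, map_sum, Finset.sum_mul, Finset.mul_sum, ← Finset.sum_sub_distrib,
      Finset.mul_sum, ← Finset.sum_add_distrib]
    refine Finset.sum_congr rfl fun k _ => ?_
    ring

lemma momentum_swap (hf : ContDiff ℝ (⊤ : ℕ∞) f) (hg : ContDiff ℝ (⊤ : ℕ∞) g)
    (hφ : ContDiff ℝ (⊤ : ℕ∞) φ) (hφc : HasCompactSupport φ) (k : Fin d) :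
    ∫ x, φ x * (cj (g x) * pd k f x + cj (f x) * pd k g x).im =
      ∫ x, (2 * φ x * (cj (g x) * pd k f x).im - pd k φ x * (cj (f x) * g x).im) := by
  have c0 := hf.continuous
  have c1 := fun k => (pd_contDiff hf k).continuous
  have d0 := hg.continuous
  have d1 := fun k => (pd_contDiff hg k).continuous
  have b0 := hφ.continuous
  have b1 := fun k => (pd_contDiff hφ k).continuous
  have z0 : ∀ x ∉ tsupport φ, φ x = 0 := fun x hx => image_eq_zero_of_notMem_tsupport hx
  have z1 := fun k => pd_zero_off (isClosed_tsupport φ) z0 k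
  refine int_eq_of_div (ι := Unit) (K := tsupport φ) hφc
    (W := fun _ x => φ x * (cj (f x) * g x).im)
    (W' := fun _ x => pd k φ x * (cj (f x) * g x).im +
      φ x * (cj (pd k f x) * g x + cj (f x) * pd k g x).im)
    (v := fun _ => stdVec d k) ?_ ?_ ?_ ?_ ?_ ?_ ?_ ?_ ?_ ?_
  · fun_prop
  · fun_prop
  · intro _; fun_prop
  · intro _; fun_prop
  · intro x hx; simp [z0 x hx]
  · intro x hx; simp [z0 x hx, z1 _ x hx]
  · intro _ x hx; simp [z0 x hx]
  · intro _ x hx; simp [z0 x hx, z1 _ x hx]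
  · intro _ x
    exact HL_mul (pd_hasLine hφ k x) (HL_im (HL_mul (HL_conj (pd_hasLine hf k x))
      (pd_hasLine hg k x)))
  · intro x
    simp only [Finset.univ_unique, Finset.sum_singleton]
    simp only [Complex.add_im, Complex.mul_im, Complex.conj_re, Complex.conj_im]
    ring

lemma virial_flux (hf : ContDiff ℝ (⊤ : ℕ∞) f) {a : Fin d → EuclideanSpace ℝ (Fin d) → ℝ}
    (ha : ∀ k, ContDiff ℝ (⊤ : ℕ∞) (a k)) {K : Set (EuclideanSpace ℝ (Fin d))} (hK : IsCompact K)
    (ha0 : ∀ k, ∀ x ∉ K, a k x = 0) {p : ℝ} (hp : 0 < p) :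
    ∫ x, ∑ k, (-2 * a k x * (cj (∑ j, pd j (pd j f) x + (‖f x‖ ^ p : ℝ) * f x) * pd k f x).re
        - pd k (a k) x * (cj (f x) * (∑ j, pd j (pd j f) x + (‖f x‖ ^ p : ℝ) * f x)).re) =
      ∫ x, ∑ k, (∑ j, (2 * pd j (a k) x * (cj (pd j f x) * pd k f x).re
        + pd j (pd k (a k)) x * (cj (f x) * pd j f x).re)
        - p / (p + 2) * pd k (a k) x * ‖f x‖ ^ (p + 2)) := by
  have c0 := hf.continuous
  have c1 := fun k => (pd_contDiff hf k).continuous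
  have c2 := fun j k => (pd_contDiff (pd_contDiff hf k) j).continuous
  have n0 : Continuous (fun x => ‖f x‖ ^ p) := c0.norm.rpow_const fun x => Or.inr hp.le
  have n1 : Continuous (fun x => ‖f x‖ ^ (p+2)) := c0.norm.rpow_const fun x => Or.inr (by linarith)
  have b0 := fun k => (ha k).continuous
  have b1 := fun j k => (pd_contDiff (ha k) j).continuous
  have b2 := fun i j k => (pd_contDiff (pd_contDiff (ha k) j) i).continuous
  have z0 := ha0
  have z1 := fun j k => pd_zero_off hK.isClosed (z0 k) j
  have z2 := fun i j k => pd_zero_off hK.isClosed (z1 j k) i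
  refine int_eq_of_div (K := K) hK
    (W := fun j x => (∑ k, (a k x * (-2 * (cj (pd j f x) * pd k f x).re)
        + a j x * (cj (pd k f x) * pd k f x).re - pd k (a k) x * (cj (f x) * pd j f x).re))
      + a j x * ((-2 / (p + 2)) * ‖f x‖ ^ (p + 2)))
    (W' := fun j x => (∑ k,
        ((pd j (a k) x * (-2 * (cj (pd j f x) * pd k f x).re) +
            a k x * (-2 * (cj (pd j (pd j f) x) * pd k f x + cj (pd j f x) * pd j (pd k f) x).re))
        + (pd j (a j) x * (cj (pd k f x) * pd k f x).re +
            a j x * (cj (pd j (pd k f) x) * pd k f x + cj (pd k f x) * pd j (pd k f) x).re)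
        - (pd j (pd k (a k)) x * (cj (f x) * pd j f x).re +
            pd k (a k) x * (cj (pd j f x) * pd j f x + cj (f x) * pd j (pd j f) x).re)))
      + (pd j (a j) x * ((-2 / (p + 2)) * ‖f x‖ ^ (p + 2)) +
          a j x * ((-2 / (p + 2)) * ((p + 2) * ‖f x‖ ^ (p + 2 - 2) * (cj (f x) * pd j f x).re))))
    (v := fun j => stdVec d j) ?_ ?_ ?_ ?_ ?_ ?_ ?_ ?_ ?_ ?_
  · fun_prop
  · fun_prop
  · intro k; fun_prop
  · intro k
    have : p + 2 - 2 = p := by ring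
    rw [this]
    fun_prop
  · intro x hx; simp [z0 _ x hx, z1 _ _ x hx]
  · intro x hx; simp [z1 _ _ x hx, z2 _ _ _ x hx]
  · intro k x hx; simp [z0 _ x hx, z1 _ _ x hx]
  · intro k x hx; simp [z0 _ x hx, z1 _ _ x hx, z2 _ _ _ x hx]
  · intro j x
    have hf' := pd_hasLine hf j x
    have hf1 := fun k => pd_hasLine (pd_contDiff hf k) j x
    have ha' := fun k => pd_hasLine (ha k) j x
    have ha1 := fun k => pd_hasLine (pd_contDiff (ha k) k) j x
    refine HL_add (HL_sum fun k => HL_sub (HL_add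
      (HL_mul (ha' k) (HL_cmul _ (HL_re (HL_mul (HL_conj (hf1 j)) (hf1 k)))))
      (HL_mul (ha' j) (HL_re (HL_mul (HL_conj (hf1 k)) (hf1 k)))))
      (HL_mul (ha1 k) (HL_re (HL_mul (HL_conj hf') (hf1 j)))))
      (HL_mul (ha' j) (HL_cmul _ (HL_rpow hf' (r := p + 2) (by linarith))))
  · intro x
    have hp2 : p + 2 ≠ 0 := by linarith
    have e1 : p + 2 - 2 = p := by ring
    have e2 : ‖f x‖ ^ (p + 2) = ‖f x‖ ^ p * ((f x).re ^ 2 + (f x).im ^ 2) := by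
      rw [Real.rpow_add_of_nonneg (norm_nonneg _) hp.le (by norm_num)]
      congr 1
      rw [Real.rpow_two, Complex.sq_norm, Complex.normSq_apply]; ring
    have e3 : ∀ j k, pd j (pd k f) x = pd k (pd j f) x := fun j k => pd_comm hf j k x
    rw [e1, e2]
    generalize ‖f x‖ ^ p = n
    have hL : ∀ k, (-2 * a k x * (cj (∑ j, pd j (pd j f) x + (n : ℂ) * f x) * pd k f x).re
        - pd k (a k) x * (cj (f x) * (∑ j, pd j (pd j f) x + (n : ℂ) * f x)).re) =
        ∑ j, (-2 * a k x * (cj (pd j (pd j f) x) * pd k f x).re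
          - pd k (a k) x * (cj (f x) * pd j (pd j f) x).re) +
        (-2 * a k x * (n * (cj (f x) * pd k f x).re)
          - pd k (a k) x * (n * ((f x).re ^ 2 + (f x).im ^ 2))) := by
      intro k
      rw [Finset.sum_sub_distrib, ← Finset.mul_sum, ← Finset.mul_sum, ← Complex.re_sum,
        ← Complex.re_sum, ← Finset.sum_mul, ← Finset.mul_sum, ← map_sum]
      generalize ∑ j, pd j (pd j f) x = S
      simp only [map_add, map_mul, Complex.conj_ofReal, Complex.add_re, Complex.mul_re,
        Complex.add_im, Complex.mul_im, Complex.conj_re, Complex.conj_im, Complex.ofReal_re,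
        Complex.ofReal_im]
      ring
    simp only [hL]
    have swap : ∀ F : Fin d → Fin d → ℝ, ∑ j, ∑ k, F j k = ∑ j, ∑ k, F k j :=
      fun F => Finset.sum_comm
    have hW : ∀ P Q R : Fin d → Fin d → ℝ, ∑ j, ∑ k, (P j k + Q j k - R j k) =
        ∑ k, ∑ j, (P j k + Q k j - R j k) := by
      intro P Q R
      simp only [Finset.sum_add_distrib, Finset.sum_sub_distrib]
      rw [swap P, swap R]
    conv_rhs => rw [Finset.sum_add_distrib, hW]
    have comb : ∀ A B C' D F G : ℝ, A = F + C' → B = G - D → (A + B - (C' - D) = F + G) := by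
      intros; linarith
    rw [← Finset.sum_sub_distrib, ← Finset.sum_add_distrib]
    refine Finset.sum_congr rfl fun k _ => ?_
    refine comb _ _ _ _ _ _ ?_ ?_
    · rw [← Finset.sum_add_distrib]
      refine Finset.sum_congr rfl fun j _ => ?_
      rw [e3 k j]
      simp only [Complex.add_re, Complex.mul_re, Complex.conj_re, Complex.conj_im]
      ring
    · field_simp
      ring

end
end
end

section
open MeasureTheory Set Filter Topology SchwartzMap FourierTransform
open scoped ENNReal NNReal

noncomputable section

set_option linter.unusedSectionVars false

section
variable (d : ℕ)

/-- base bump -/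
def baseBump : ContDiffBump (0 : EuclideanSpace ℝ (Fin d)) := ⟨1, 2, by norm_num, by norm_num⟩

/-- rescaled cutoffs -/
def cut (n : ℕ) (x : EuclideanSpace ℝ (Fin d)) : ℝ := baseBump d (((n:ℝ) + 1)⁻¹ • x)

lemma cut_contDiff (n : ℕ) : ContDiff ℝ (⊤ : ℕ∞) (cut d n) :=
  (baseBump d).contDiff.comp (contDiff_const_smul _)

lemma cut_nonneg (n : ℕ) (x) : 0 ≤ cut d n x := (baseBump d).nonneg
lemma cut_le_one (n : ℕ) (x) : cut d n x ≤ 1 := (baseBump d).le_one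

lemma cut_eq_one (n : ℕ) {x} (hx : ‖x‖ ≤ n + 1) : cut d n x = 1 := by
  apply (baseBump d).one_of_mem_closedBall
  rw [mem_closedBall_zero_iff, norm_smul, norm_inv, Real.norm_of_nonneg (by positivity)]
  change _ ≤ (1:ℝ)
  rw [inv_mul_le_iff₀ (by positivity)]; linarith

lemma cut_eq_zero (n : ℕ) {x} (hx : 2 * (n + 1) ≤ ‖x‖) : cut d n x = 0 := by
  apply (baseBump d).zero_of_le_dist
  rw [dist_zero_right, norm_smul, norm_inv, Real.norm_of_nonneg (by positivity)]
  change (2:ℝ) ≤ _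
  rw [le_inv_mul_iff₀ (by positivity)]; linarith

lemma cut_compact (n : ℕ) : HasCompactSupport (cut d n) := by
  refine HasCompactSupport.intro (isCompact_closedBall (0 : EuclideanSpace ℝ (Fin d)) (2*(n+1))) ?_
  intro x hx
  rw [mem_closedBall_zero_iff, not_le] at hx
  exact cut_eq_zero d n hx.le

lemma cut_eventually (x : EuclideanSpace ℝ (Fin d)) :
    ∀ᶠ n : ℕ in atTop, cut d n =ᶠ[𝓝 x] fun _ => 1 := by
  obtain ⟨N, hN⟩ := exists_nat_gt ‖x‖
  filter_upwards [eventually_ge_atTop N] with n hn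
  have : ∀ᶠ y in 𝓝 x, ‖y‖ < N := continuous_norm.continuousAt.eventually (gt_mem_nhds hN)
  filter_upwards [this] with y hy
  apply cut_eq_one
  have : (N:ℝ) ≤ n := by exact_mod_cast hn
  linarith

lemma pd_of_eventually {V : Type*} [NormedAddCommGroup V] [NormedSpace ℝ V] {d : ℕ}
    {f : EuclideanSpace ℝ (Fin d) → V} {x} {c : V}
    (h : f =ᶠ[𝓝 x] fun _ => c) (k : Fin d) : pd k f =ᶠ[𝓝 x] fun _ => 0 := by
  have := h.fderiv (𝕜 := ℝ)
  filter_upwards [this] with y hy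
  unfold pd; rw [hy]; simp

lemma cut_tendsto (x) : Tendsto (fun n => cut d n x) atTop (𝓝 1) :=
  tendsto_const_nhds.congr' ((cut_eventually d x).mono fun _ h => h.self_of_nhds.symm)

lemma cut_pd_tendsto (k : Fin d) (x) : Tendsto (fun n => pd k (cut d n) x) atTop (𝓝 0) :=
  tendsto_const_nhds.congr' ((cut_eventually d x).mono fun _ h =>
    (pd_of_eventually h k).self_of_nhds.symm)

lemma cut_pd2_tendsto (j k : Fin d) (x) :
    Tendsto (fun n => pd j (pd k (cut d n)) x) atTop (𝓝 0) :=
  tendsto_const_nhds.congr' ((cut_eventually d x).mono fun _ h =>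
    (pd_of_eventually (pd_of_eventually h k) j).self_of_nhds.symm)

lemma pd_comp_smul {d : ℕ} {f : EuclideanSpace ℝ (Fin d) → ℝ} (hf : ContDiff ℝ (⊤ : ℕ∞) f) (c : ℝ)
    (k : Fin d) : pd k (fun x => f (c • x)) = fun x => c * pd k f (c • x) := by
  funext x
  have h1 := ((hf.differentiable (by simp)) (c • x)).hasFDerivAt
  have h2 : HasFDerivAt (fun y : EuclideanSpace ℝ (Fin d) => c • y)
    (c • ContinuousLinearMap.id ℝ _) x := (hasFDerivAt_id x).const_smul c
  have := (h1.comp x h2).fderiv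
  unfold pd
  change fderiv ℝ (f ∘ fun y => c • y) x _ = _
  rw [this]; simp

lemma pd_const_mul {d : ℕ} {f : EuclideanSpace ℝ (Fin d) → ℝ} (hf : ContDiff ℝ (⊤ : ℕ∞) f) (c : ℝ)
    (k : Fin d) : pd k (fun x => c * f x) = fun x => c * pd k f x := by
  funext x
  have h1 := (((hf.differentiable (by simp)) x).hasFDerivAt.const_mul c).fderiv
  unfold pd
  rw [h1]; simp

lemma cut_pd (n : ℕ) (k : Fin d) : pd k (cut d n) =
    fun x => ((n:ℝ)+1)⁻¹ * pd k (baseBump d) (((n:ℝ)+1)⁻¹ • x) :=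
  pd_comp_smul (baseBump d).contDiff _ k

lemma cut_pd2 (n : ℕ) (j k : Fin d) : pd j (pd k (cut d n)) =
    fun x => ((n:ℝ)+1)⁻¹ * (((n:ℝ)+1)⁻¹ * pd j (pd k (baseBump d)) (((n:ℝ)+1)⁻¹ • x)) := by
  have h := pd_contDiff (baseBump d).contDiff k
  rw [cut_pd, pd_const_mul (f := fun x => pd k (baseBump d) (((n:ℝ)+1)⁻¹ • x)) (h.comp (contDiff_const_smul _)), pd_comp_smul h]

lemma cut_pd_bounds : ∃ C : ℝ, 0 < C ∧ ∀ n : ℕ, ∀ k : Fin d, ∀ x,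
    |pd k (cut d n) x| ≤ C / (n+1) ∧ (1 + ‖x‖) * |pd k (cut d n) x| ≤ C ∧
    ∀ j, |pd j (pd k (cut d n)) x| ≤ C / (n+1) ∧ (1 + ‖x‖) * |pd j (pd k (cut d n)) x| ≤ C := by
  have hb := (baseBump d).contDiff (n := (⊤ : ℕ∞))
  have hc : HasCompactSupport (baseBump d) := (baseBump d).hasCompactSupport
  have key : ∀ G : EuclideanSpace ℝ (Fin d) → ℝ, Continuous G → HasCompactSupport G →
      ∃ C, ∀ x, (1 + ‖x‖) * |G x| ≤ C := by
    intro G hG hGc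
    have h1 : Continuous (fun x => (1 + ‖x‖) * |G x|) := by fun_prop
    have h2 : HasCompactSupport (fun x => (1 + ‖x‖) * |G x|) := by
      refine hGc.mono fun x hx => ?_
      contrapose hx
      simp only [Function.mem_support, not_not] at hx ⊢
      simp [hx]
    obtain ⟨C, hC⟩ := h1.bounded_above_of_compact_support h2
    exact ⟨C, fun x => (le_abs_self _).trans (hC x)⟩
  choose C1 h1 using fun k : Fin d => key _ (pd_contDiff hb k).continuous (pd_compact hc k)
  choose C2 h2 using fun j k : Fin d => key _ (pd_contDiff (pd_contDiff hb k) j).continuous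
    (pd_compact (pd_compact hc k) j)
  set C := 1 + ∑ k, |C1 k| + ∑ j, ∑ k, |C2 j k| with hC
  have hC1 : ∀ k, C1 k ≤ C := by
    intro k
    have a1 : |C1 k| ≤ ∑ k, |C1 k| :=
      Finset.single_le_sum (f := fun k => |C1 k|) (fun _ _ => abs_nonneg _) (Finset.mem_univ k)
    have a2 : 0 ≤ ∑ j, ∑ k, |C2 j k| := by positivity
    have := le_abs_self (C1 k)
    linarith
  have hC2 : ∀ j k, C2 j k ≤ C := by
    intro j k
    have a1 : |C2 j k| ≤ ∑ k, |C2 j k| :=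
      Finset.single_le_sum (f := fun k => |C2 j k|) (fun _ _ => abs_nonneg _) (Finset.mem_univ k)
    have a3 : ∑ k, |C2 j k| ≤ ∑ j, ∑ k, |C2 j k| :=
      Finset.single_le_sum (f := fun j => ∑ k, |C2 j k|) (fun _ _ => by positivity) (Finset.mem_univ j)
    have a2 : 0 ≤ ∑ k, |C1 k| := by positivity
    have := le_abs_self (C2 j k)
    linarith
  have hCpos : 0 < C := by positivity
  have gen : ∀ (n : ℕ) (G : EuclideanSpace ℝ (Fin d) → ℝ), (∀ x, (1 + ‖x‖) * |G x| ≤ C) → ∀ x,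
      |((n:ℝ)+1)⁻¹ * G (((n:ℝ)+1)⁻¹ • x)| ≤ C / (n+1) ∧
      (1 + ‖x‖) * |((n:ℝ)+1)⁻¹ * G (((n:ℝ)+1)⁻¹ • x)| ≤ C := by
    intro n G hG x
    have h := hG (((n:ℝ)+1)⁻¹ • x)
    have hn : (0:ℝ) < (n:ℝ)+1 := by positivity
    rw [norm_smul, norm_inv, Real.norm_of_nonneg hn.le] at h
    rw [abs_mul, abs_inv, abs_of_pos hn]
    set y := |G (((n:ℝ)+1)⁻¹ • x)|
    have hy : 0 ≤ y := abs_nonneg _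
    have hi : ((n:ℝ)+1)⁻¹ ≤ 1 := inv_le_one_of_one_le₀ (by linarith [(Nat.cast_nonneg n : (0:ℝ) ≤ n)])
    have hi0 : 0 < ((n:ℝ)+1)⁻¹ := by positivity
    constructor
    · rw [div_eq_inv_mul]
      gcongr
      refine le_trans ?_ h
      nlinarith [mul_nonneg (mul_nonneg hi0.le (norm_nonneg x)) hy]
    · refine le_trans ?_ h
      nlinarith [mul_nonneg (mul_nonneg hi0.le (norm_nonneg x)) hy]
  refine ⟨C, hCpos, fun n k x => ?_⟩
  have g1 := gen n (pd k (baseBump d)) (fun x => (h1 k x).trans (hC1 k)) x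
  rw [cut_pd]
  refine ⟨g1.1, g1.2, fun j => ?_⟩
  rw [← cut_pd, cut_pd2]
  refine gen n (fun x => ((n:ℝ)+1)⁻¹ * pd j (pd k (baseBump d)) x) (fun y => ?_) x
  have hn : (0:ℝ) < (n:ℝ)+1 := by positivity
  refine le_trans ?_ ((h2 j k y).trans (hC2 j k))
  refine mul_le_mul_of_nonneg_left ?_ (by positivity)
  rw [abs_mul, abs_inv, abs_of_pos hn]
  have hi : ((n:ℝ)+1)⁻¹ ≤ 1 := inv_le_one_of_one_le₀ (by linarith [(Nat.cast_nonneg n : (0:ℝ) ≤ n)])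
  exact mul_le_of_le_one_left (abs_nonneg _) hi

end
end
end

section
open MeasureTheory Set Filter Topology SchwartzMap FourierTransform
open scoped ENNReal NNReal

noncomputable section

set_option linter.unusedSectionVars false

/-- spatial direction in space-time -/
def dx {d : ℕ} (k : Fin d) : ℝ × EuclideanSpace ℝ (Fin d) := (0, stdVec d k)

/-- time direction in space-time -/
def dt (d : ℕ) : ℝ × EuclideanSpace ℝ (Fin d) := (1, 0)

/-- inhomogeneous Schroedinger equation -/
structure SchEq {d : ℕ} (I : Set ℝ) (v g : ℝ × EuclideanSpace ℝ (Fin d) → ℂ) : Prop where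
  op : IsOpen I
  sm : SmI I v
  gc : ContinuousOn g (I ×ˢ univ)
  eq : ∀ p : ℝ × EuclideanSpace ℝ (Fin d), p.1 ∈ I →
    Dv (dt d) v p = Complex.I * (∑ k, Dv (dx k) (Dv (dx k) v) p + g p)

section
variable {d : ℕ} {I : Set ℝ}

local notation "cj" => starRingEnd ℂ

lemma slice_cont {V : Type*} [TopologicalSpace V] {g : ℝ × EuclideanSpace ℝ (Fin d) → V}
    (hg : ContinuousOn g (I ×ˢ univ)) {t : ℝ} (ht : t ∈ I) : Continuous (fun x => g (t, x)) := by
  rw [← continuousOn_univ]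
  exact hg.comp (by fun_prop) (fun x _ => ⟨ht, mem_univ _⟩)

lemma cs_mul {φ : EuclideanSpace ℝ (Fin d) → ℝ} (hφc : HasCompactSupport φ)
    (σ : EuclideanSpace ℝ (Fin d) → ℝ) : HasCompactSupport (fun x => φ x * σ x) := by
  refine hφc.mono fun x hx => ?_
  contrapose hx
  simp only [Function.mem_support, not_not] at hx ⊢
  rw [hx, zero_mul]

lemma cs_cmul {φ : EuclideanSpace ℝ (Fin d) → ℝ} (hφc : HasCompactSupport φ)
    (σ : EuclideanSpace ℝ (Fin d) → ℂ) : HasCompactSupport (fun x => (φ x : ℂ) * σ x) := by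
  refine hφc.mono fun x hx => ?_
  contrapose hx
  simp only [Function.mem_support, not_not] at hx ⊢
  rw [hx, Complex.ofReal_zero, zero_mul]

lemma cont_im {f g : EuclideanSpace ℝ (Fin d) → ℂ} (hf : Continuous f) (hg : Continuous g) :
    Continuous (fun x => (cj (f x) * g x).im) := by fun_prop

lemma cont_re {f g : EuclideanSpace ℝ (Fin d) → ℂ} (hf : Continuous f) (hg : Continuous g) :
    Continuous (fun x => (cj (f x) * g x).re) := by fun_prop

lemma cont_cj {f g : EuclideanSpace ℝ (Fin d) → ℂ} (hf : Continuous f) (hg : Continuous g) :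
    Continuous (fun x => f x * cj (g x)) := by fun_prop

lemma pd_slice2 {v : ℝ × EuclideanSpace ℝ (Fin d) → ℂ} (hv : SmI I v) {t} (ht : t ∈ I)
    (j k : Fin d) (x) : pd j (pd k (fun x => v (t, x))) x = Dv (dx j) (Dv (dx k) v) (t, x) := by
  rw [hv.pd_slice ht k, (Dv_smI hv _).pd_slice ht j]; rfl

lemma pd_slice1 {v : ℝ × EuclideanSpace ℝ (Fin d) → ℂ} (hv : SmI I v) {t} (ht : t ∈ I)
    (k : Fin d) (x) : pd k (fun x => v (t, x)) x = Dv (dx k) v (t, x) := by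
  rw [hv.pd_slice ht k]; rfl

lemma mass_deriv {v g : ℝ × EuclideanSpace ℝ (Fin d) → ℂ} (h : SchEq I v g)
    {φ : EuclideanSpace ℝ (Fin d) → ℝ} (hφ : ContDiff ℝ (⊤ : ℕ∞) φ) (hφc : HasCompactSupport φ)
    {t : ℝ} (ht : t ∈ I) :
    HasDerivAt (fun s => ∫ x, φ x * ‖v (s, x)‖ ^ 2)
      (2 * (∫ x, ∑ k, pd k φ x * (cj (v (t, x)) * Dv (dx k) v (t, x)).im)
        - 2 * ∫ x, φ x * (cj (v (t, x)) * g (t, x)).im) t := by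
  have c0 := h.sm.cont
  have c1 := (Dv_smI h.sm (dt d)).cont
  have H := TI (V := ℝ) h.op hφ.continuous hφc (ρ := fun p => ‖v p‖ ^ 2)
    (ρ' := fun p => 2 * (cj (v p) * Dv (dt d) v p).re) (c0.norm.pow 2)
    (by
      refine continuousOn_const.mul ?_
      exact Complex.continuous_re.comp_continuousOn
        ((Complex.continuous_conj.comp_continuousOn c0).mul c1))
    (by
      intro t ht x
      have := (h.sm.time ht x).norm_sq
      rw [Complex.inner, mul_comm (Dv _ _ _)] at this
      exact this) ht
  simp only [smul_eq_mul] at H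
  refine H.congr_deriv (Eq.symm ?_)
  have hs := h.sm.slice ht
  have hm := mass_flux hs hφ hφc
  simp only [pd_slice2 h.sm ht, pd_slice1 h.sm ht] at hm
  have s0 := hs.continuous
  have sg := slice_cont h.gc ht
  have s2 : ∀ k, Continuous fun x => Dv (dx k) (Dv (dx k) v) (t, x) := fun k =>
    ((Dv_smI (Dv_smI h.sm _) _).slice ht).continuous
  have b0 := hφ.continuous
  have i1 : Integrable (fun x => φ x * (cj (v (t, x)) * ∑ k, Dv (dx k) (Dv (dx k) v) (t, x)).im) :=
    Continuous.integrable_of_hasCompactSupport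
      (b0.mul (cont_im s0 (continuous_finset_sum _ fun k _ => s2 k))) (cs_mul hφc _)
  have i2 : Integrable (fun x => φ x * (cj (v (t, x)) * g (t, x)).im) :=
    Continuous.integrable_of_hasCompactSupport (b0.mul (cont_im s0 sg)) (cs_mul hφc _)
  rw [integral_neg] at hm
  have e : ∀ x, φ x * (2 * (cj (v (t, x)) * Dv (dt d) v (t, x)).re) =
      -2 * (φ x * (cj (v (t, x)) * ∑ k, Dv (dx k) (Dv (dx k) v) (t, x)).im)
      - 2 * (φ x * (cj (v (t, x)) * g (t, x)).im) := by
    intro x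
    rw [h.eq (t, x) ht]
    generalize ∑ k, Dv (dx k) (Dv (dx k) v) (t, x) = S
    simp only [Complex.mul_re, Complex.mul_im, Complex.add_re, Complex.add_im, Complex.conj_re,
      Complex.conj_im, Complex.I_re, Complex.I_im]
    ring
  simp only [e]
  rw [integral_sub (i1.const_mul _) (i2.const_mul _), integral_const_mul, integral_const_mul, hm]
  ring

lemma dual_deriv {v g ψ : ℝ × EuclideanSpace ℝ (Fin d) → ℂ} (h : SchEq I v g)
    (hψ : SchEq I ψ (fun _ => 0))
    {φ : EuclideanSpace ℝ (Fin d) → ℝ} (hφ : ContDiff ℝ (⊤ : ℕ∞) φ) (hφc : HasCompactSupport φ)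
    {t : ℝ} (ht : t ∈ I) :
    HasDerivAt (fun s => ∫ x, (φ x : ℂ) * (v (s, x) * cj (ψ (s, x))))
      (Complex.I * (-∫ x, ∑ k, (2 * ((pd k φ x : ℝ) : ℂ) * (Dv (dx k) v (t, x) * cj (ψ (t, x))) +
        ((pd k (pd k φ) x : ℝ) : ℂ) * (v (t, x) * cj (ψ (t, x)))))
        + Complex.I * ∫ x, (φ x : ℂ) * (g (t, x) * cj (ψ (t, x)))) t := by
  have c0 := h.sm.cont
  have c1 := (Dv_smI h.sm (dt d)).cont
  have q0 := hψ.sm.cont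
  have q1 := (Dv_smI hψ.sm (dt d)).cont
  have H := TI (V := ℂ) h.op hφ.continuous hφc (ρ := fun p => v p * cj (ψ p))
    (ρ' := fun p => Dv (dt d) v p * cj (ψ p) + v p * cj (Dv (dt d) ψ p))
    (c0.mul (Complex.continuous_conj.comp_continuousOn q0))
    ((c1.mul (Complex.continuous_conj.comp_continuousOn q0)).add
      (c0.mul (Complex.continuous_conj.comp_continuousOn q1)))
    (by
      intro t ht x
      have h2 : HasDerivAt (fun s => cj (ψ (s, x))) (cj (Dv (dt d) ψ (t, x))) t :=
        (Complex.conjCLE.toContinuousLinearMap.hasFDerivAt).comp_hasDerivAt t (hψ.sm.time ht x)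
      exact (h.sm.time ht x).mul h2) ht
  simp only [Complex.real_smul] at H
  refine H.congr_deriv (Eq.symm ?_)
  have hs := h.sm.slice ht
  have hs' := hψ.sm.slice ht
  have hm := dual_flux hs hs' hφ hφc
  simp only [pd_slice2 h.sm ht, pd_slice1 h.sm ht, pd_slice2 hψ.sm ht] at hm
  have s0 := hs.continuous
  have s0' := hs'.continuous
  have sg := slice_cont h.gc ht
  have s2 : ∀ k, Continuous fun x => Dv (dx k) (Dv (dx k) v) (t, x) := fun k =>
    ((Dv_smI (Dv_smI h.sm _) _).slice ht).continuous
  have s2' : ∀ k, Continuous fun x => Dv (dx k) (Dv (dx k) ψ) (t, x) := fun k =>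
    ((Dv_smI (Dv_smI hψ.sm _) _).slice ht).continuous
  have b0 := hφ.continuous
  have i1 : Integrable (fun x => (φ x : ℂ) * ((∑ k, Dv (dx k) (Dv (dx k) v) (t, x)) * cj (ψ (t, x))
      - v (t, x) * cj (∑ k, Dv (dx k) (Dv (dx k) ψ) (t, x)))) :=
    Continuous.integrable_of_hasCompactSupport
      ((Complex.continuous_ofReal.comp b0).mul
        ((cont_cj (continuous_finset_sum _ fun k _ => s2 k) s0').sub
          (cont_cj s0 (continuous_finset_sum _ fun k _ => s2' k)))) (cs_cmul hφc _)
  have i2 : Integrable (fun x => (φ x : ℂ) * (g (t, x) * cj (ψ (t, x)))) :=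
    Continuous.integrable_of_hasCompactSupport ((Complex.continuous_ofReal.comp b0).mul (cont_cj sg s0')) (cs_cmul hφc _)
  rw [integral_neg] at hm
  have e : ∀ x, (φ x : ℂ) * (Dv (dt d) v (t, x) * cj (ψ (t, x)) + v (t, x) * cj (Dv (dt d) ψ (t, x))) =
      Complex.I * ((φ x : ℂ) * ((∑ k, Dv (dx k) (Dv (dx k) v) (t, x)) * cj (ψ (t, x))
      - v (t, x) * cj (∑ k, Dv (dx k) (Dv (dx k) ψ) (t, x))))
      + Complex.I * ((φ x : ℂ) * (g (t, x) * cj (ψ (t, x)))) := by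
    intro x
    rw [h.eq (t, x) ht, hψ.eq (t, x) ht]
    generalize ∑ k, Dv (dx k) (Dv (dx k) v) (t, x) = S
    simp only [add_zero, map_mul, Complex.conj_I]
    ring
  simp only [e]
  rw [integral_add (i1.const_mul _) (i2.const_mul _), integral_const_mul, integral_const_mul, hm]

/-- the solution bundle -/
structure Sol {d : ℕ} (I : Set ℝ) (U : ℝ × EuclideanSpace ℝ (Fin d) → ℂ) : Prop where
  hd : 0 < d
  se : SchEq I U (fun p => ((‖U p‖ ^ ((4:ℝ)/d) : ℝ) : ℂ) * U p)
  dec : ∀ t ∈ I, SchwartzDecay (fun x => U (t, x))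

variable {U : ℝ × EuclideanSpace ℝ (Fin d) → ℂ}

lemma momentum_deriv (h : Sol I U) {a : Fin d → EuclideanSpace ℝ (Fin d) → ℝ}
    (ha : ∀ k, ContDiff ℝ (⊤ : ℕ∞) (a k)) (hac : ∀ k, HasCompactSupport (a k))
    {t : ℝ} (ht : t ∈ I) :
    HasDerivAt (fun s => ∑ k, ∫ x, a k x * (cj (U (s, x)) * Dv (dx k) U (s, x)).im)
      (∫ x, ∑ k, (∑ j, (2 * pd j (a k) x * (cj (Dv (dx j) U (t, x)) * Dv (dx k) U (t, x)).re
        + pd j (pd k (a k)) x * (cj (U (t, x)) * Dv (dx j) U (t, x)).re)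
        - (4/d) / (4/d + 2) * pd k (a k) x * ‖U (t, x)‖ ^ ((4:ℝ)/d + 2))) t := by
  have hp : 0 < (4:ℝ)/d := by have := h.hd; positivity
  have sm := h.se.sm
  have c0 := sm.cont
  have c1 := (Dv_smI sm (dt d)).cont
  have H : ∀ k, HasDerivAt (fun s => ∫ x, a k x * (cj (U (s, x)) * Dv (dx k) U (s, x)).im)
      (∫ x, (2 * a k x * (cj (Dv (dt d) U (t, x)) * Dv (dx k) U (t, x)).im -
        pd k (a k) x * (cj (U (t, x)) * Dv (dt d) U (t, x)).im)) t := by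
    intro k
    have c2 := (Dv_smI sm (dx k)).cont
    have c3 := (Dv_smI (Dv_smI sm (dt d)) (dx k)).cont
    have H := TI (V := ℝ) h.se.op (ha k).continuous (hac k)
      (ρ := fun p => (cj (U p) * Dv (dx k) U p).im)
      (ρ' := fun p => (cj (Dv (dt d) U p) * Dv (dx k) U p + cj (U p) * Dv (dx k) (Dv (dt d) U) p).im)
      (Complex.continuous_im.comp_continuousOn ((Complex.continuous_conj.comp_continuousOn c0).mul c2))
      (Complex.continuous_im.comp_continuousOn
        (((Complex.continuous_conj.comp_continuousOn c1).mul c2).add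
          ((Complex.continuous_conj.comp_continuousOn c0).mul c3)))
      (by
        intro t ht x
        have h2 : HasDerivAt (fun s => cj (U (s, x))) (cj (Dv (dt d) U (t, x))) t :=
          (Complex.conjCLE.toContinuousLinearMap.hasFDerivAt).comp_hasDerivAt t (sm.time ht x)
        have h3 := (Dv_smI sm (dx k)).time ht x
        change HasDerivAt _ (Dv (dt d) (Dv (dx k) U) (t, x)) _ at h3
        rw [Dv_comm sm (dt d) (dx k) _ ht] at h3
        exact (Complex.imCLM.hasFDerivAt).comp_hasDerivAt t (h2.mul h3)) ht
    simp only [smul_eq_mul] at H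
    have sw := momentum_swap (sm.slice ht) ((Dv_smI sm (dt d)).slice ht) (ha k) (hac k) k
    simp only [pd_slice1 sm ht, pd_slice1 (Dv_smI sm (dt d)) ht] at sw
    rw [← sw]
    exact H
  have H2 := HasDerivAt.fun_sum (u := Finset.univ) (fun k _ => H k)
  refine H2.congr_deriv (Eq.symm ?_)
  have z : ∀ k, ∀ x ∉ ⋃ k, tsupport (a k), a k x = 0 := by
    intro k x hx
    apply image_eq_zero_of_notMem_tsupport
    intro hx'; exact hx (mem_iUnion.2 ⟨k, hx'⟩)
  have vf := virial_flux (sm.slice ht) ha (isCompact_iUnion fun k => hac k) z hp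
  simp only [pd_slice2 sm ht, pd_slice1 sm ht] at vf
  rw [← vf, ← integral_finset_sum]
  · refine integral_congr_ae (ae_of_all _ fun x => ?_)
    refine Finset.sum_congr rfl fun k _ => ?_
    rw [h.se.eq (t, x) ht]
    generalize ∑ k, Dv (dx k) (Dv (dx k) U) (t, x) + ((‖U (t, x)‖ ^ ((4:ℝ)/d) : ℝ) : ℂ) * U (t, x) = S
    simp only [map_mul, Complex.conj_I, Complex.mul_re, Complex.mul_im, Complex.conj_re,
      Complex.conj_im, Complex.I_re, Complex.I_im, Complex.neg_re, Complex.neg_im]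
    ring
  · intro k _
    have s0 := (sm.slice ht).continuous
    have s1 := ((Dv_smI sm (dt d)).slice ht).continuous
    have s2 := ((Dv_smI sm (dx k)).slice ht).continuous
    have b0 := (ha k).continuous
    have b1 := (pd_contDiff (ha k) k).continuous
    refine Integrable.sub ?_ ?_
    · simp only [mul_assoc]
      exact (Continuous.integrable_of_hasCompactSupport (b0.mul (cont_im s1 s2)) (cs_mul (hac k) _)).const_mul 2
    · exact Continuous.integrable_of_hasCompactSupport (b1.mul (cont_im s0 s1)) (cs_mul (pd_compact (hac k) k) _)

lemma energy_deriv (h : Sol I U)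
    {φ : EuclideanSpace ℝ (Fin d) → ℝ} (hφ : ContDiff ℝ (⊤ : ℕ∞) φ) (hφc : HasCompactSupport φ)
    {t : ℝ} (ht : t ∈ I) :
    HasDerivAt (fun s => ∫ x, φ x * ((1/2) * ∑ k, ‖Dv (dx k) U (s, x)‖ ^ 2
        - (1 / (4/d + 2)) * ‖U (s, x)‖ ^ ((4:ℝ)/d + 2)))
      (-∫ x, ∑ k, pd k φ x * (cj (Dv (dx k) U (t, x)) * Dv (dt d) U (t, x)).re) t := by
  have hp : 0 < (4:ℝ)/d := by have := h.hd; positivity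
  have sm := h.se.sm
  have c0 := sm.cont
  have c1 := (Dv_smI sm (dt d)).cont
  have c2 := fun k => (Dv_smI sm (dx k)).cont
  have c3 := fun k => (Dv_smI (Dv_smI sm (dt d)) (dx k)).cont
  have r1 : ContinuousOn (fun p => ‖U p‖ ^ ((4:ℝ)/d + 2)) (I ×ˢ univ) :=
    c0.norm.rpow_const fun x _ => Or.inr (by linarith)
  have r2 : ContinuousOn (fun p => ‖U p‖ ^ ((4:ℝ)/d)) (I ×ˢ univ) :=
    c0.norm.rpow_const fun x _ => Or.inr (by linarith)
  have H := TI (V := ℝ) h.se.op hφ.continuous hφc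
    (ρ := fun p => (1/2) * ∑ k, ‖Dv (dx k) U p‖ ^ 2 - (1 / (4/d + 2)) * ‖U p‖ ^ ((4:ℝ)/d + 2))
    (ρ' := fun p => ∑ k, (cj (Dv (dx k) U p) * Dv (dx k) (Dv (dt d) U) p).re
      - ‖U p‖ ^ ((4:ℝ)/d) * (cj (U p) * Dv (dt d) U p).re)
    (by fun_prop)
    (by
      refine (continuousOn_finset_sum _ fun k _ => ?_).sub (r2.mul ?_)
      · exact Complex.continuous_re.comp_continuousOn
          ((Complex.continuous_conj.comp_continuousOn (c2 k)).mul (c3 k))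
      · exact Complex.continuous_re.comp_continuousOn
          ((Complex.continuous_conj.comp_continuousOn c0).mul c1))
    (by
      intro t ht x
      have h3 : ∀ k, HasDerivAt (fun s => ‖Dv (dx k) U (s, x)‖ ^ 2)
          (2 * (cj (Dv (dx k) U (t, x)) * Dv (dx k) (Dv (dt d) U) (t, x)).re) t := by
        intro k
        have h3 := (Dv_smI sm (dx k)).time ht x
        change HasDerivAt _ (Dv (dt d) (Dv (dx k) U) (t, x)) _ at h3
        rw [Dv_comm sm (dt d) (dx k) _ ht] at h3
        have := h3.norm_sq
        rw [Complex.inner, mul_comm (Dv _ (Dv _ _) _)] at this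
        exact this
      have h4 := (HasDerivAt.fun_sum (u := Finset.univ) (fun k _ => h3 k)).const_mul (1/2)
      have h5 := (hasDerivAt_norm_rpow_complex (sm.time ht x) (r := 4/d + 2) (by linarith)).const_mul
        (1 / ((4:ℝ)/d + 2))
      refine (h4.sub h5).congr_deriv (Eq.symm ?_)
      rw [← Finset.mul_sum]
      have e1 : (4:ℝ)/d + 2 - 2 = 4/d := by ring
      rw [e1]
      have e2 : (4:ℝ)/d + 2 ≠ 0 := by linarith
      change _ - _ * (_ * (Dv (dt d) U (t, x))).re = _ - _ * (_ * _ * (_ * (Dv (dt d) U (t, x))).re)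
      generalize (4:ℝ)/d + 2 = r at *
      generalize (cj (U (t, x)) * Dv (dt d) U (t, x)).re = y
      field_simp) ht
  simp only [smul_eq_mul] at H
  refine H.congr_deriv (Eq.symm ?_)
  have ef := energy_flux (sm.slice ht) ((Dv_smI sm (dt d)).slice ht) hφ hφc
  simp only [pd_slice2 sm ht, pd_slice1 sm ht, pd_slice1 (Dv_smI sm (dt d)) ht] at ef
  rw [integral_neg] at ef
  rw [← ef]
  refine integral_congr_ae (ae_of_all _ fun x => ?_)
  simp only
  congr 1
  rw [sub_eq_add_neg]
  congr 1
  rw [h.se.eq (t, x) ht]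
  generalize ∑ k, Dv (dx k) (Dv (dx k) U) (t, x) = S
  simp only [Complex.mul_re, Complex.mul_im, Complex.conj_re, Complex.add_re, Complex.add_im,
      Complex.conj_im, Complex.I_re, Complex.I_im, Complex.ofReal_re, Complex.ofReal_im]
  ring

end
end
end

section
open MeasureTheory Set Filter Topology SchwartzMap FourierTransform
open scoped ENNReal NNReal

noncomputable section

set_option linter.unusedSectionVars false

/-- continuous with rapid decay -/
def RD {d : ℕ} {V : Type*} [NormedAddCommGroup V] (f : EuclideanSpace ℝ (Fin d) → V) : Prop :=
  Continuous f ∧ ∀ m : ℕ, ∃ C : ℝ, ∀ x, (1 + ‖x‖) ^ m * ‖f x‖ ≤ C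

section
variable {d : ℕ} {V : Type*} [NormedAddCommGroup V]

local notation "cj" => starRingEnd ℂ

lemma one_add_norm_pow_pos (x : EuclideanSpace ℝ (Fin d)) (m : ℕ) : 0 < (1 + ‖x‖) ^ m := by positivity

lemma RD.bdd {f : EuclideanSpace ℝ (Fin d) → V} (hf : RD f) : ∃ C, 0 ≤ C ∧ ∀ x, ‖f x‖ ≤ C := by
  obtain ⟨C, hC⟩ := hf.2 0
  refine ⟨C, ?_, fun x => by simpa using hC x⟩
  have := hC 0
  simp only [pow_zero, one_mul] at this
  exact (norm_nonneg _).trans this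

/-- domination by a polynomially weighted function -/
lemma RD.dom {W : Type*} [NormedAddCommGroup W] {f : EuclideanSpace ℝ (Fin d) → V}
    {g : EuclideanSpace ℝ (Fin d) → W} (hf : RD f) (hg : Continuous g) (k : ℕ) (c : ℝ)
    (h : ∀ x, ‖g x‖ ≤ c * (1 + ‖x‖) ^ k * ‖f x‖) : RD g := by
  refine ⟨hg, fun m => ?_⟩
  obtain ⟨C, hC⟩ := hf.2 (m + k)
  refine ⟨|c| * C, fun x => ?_⟩
  have hp := one_add_norm_pow_pos x m
  have hk := one_add_norm_pow_pos x k
  calc (1 + ‖x‖) ^ m * ‖g x‖ ≤ (1 + ‖x‖) ^ m * (|c| * (1 + ‖x‖) ^ k * ‖f x‖) := by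
        gcongr; refine (h x).trans ?_; gcongr; exact le_abs_self c
    _ = |c| * ((1 + ‖x‖) ^ (m + k) * ‖f x‖) := by rw [pow_add]; ring
    _ ≤ |c| * C := by gcongr; exact hC x

lemma RD.le {W : Type*} [NormedAddCommGroup W] {f : EuclideanSpace ℝ (Fin d) → V}
    {g : EuclideanSpace ℝ (Fin d) → W} (hf : RD f) (hg : Continuous g)
    (h : ∀ x, ‖g x‖ ≤ ‖f x‖) : RD g :=
  hf.dom hg 0 1 (fun x => by simpa using h x)

lemma integrable_jap (m : ℕ) (hm : d < m) :
    Integrable (fun x : EuclideanSpace ℝ (Fin d) => ((1 + ‖x‖) ^ m)⁻¹) := by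
  have := integrable_one_add_norm (E := EuclideanSpace ℝ (Fin d)) (μ := volume) (r := (m:ℝ))
    (by simpa using hm)
  refine this.congr (ae_of_all _ fun x => ?_)
  simp only
  rw [Real.rpow_neg (by positivity), Real.rpow_natCast]

lemma RD.integrable {f : EuclideanSpace ℝ (Fin d) → V} (hf : RD f) : Integrable f := by
  obtain ⟨C, hC⟩ := hf.2 (d+1)
  refine ((integrable_jap (d+1) (by omega)).const_mul C).mono' hf.1.aestronglyMeasurable
    (ae_of_all _ fun x => ?_)
  have hp := one_add_norm_pow_pos x (d+1)
  rw [← div_eq_mul_inv, le_div_iff₀ hp, mul_comm]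
  exact hC x

lemma RD.norm {f : EuclideanSpace ℝ (Fin d) → V} (hf : RD f) : RD (fun x => ‖f x‖) :=
  hf.le hf.1.norm (fun x => by simp)

lemma RD.add {f g : EuclideanSpace ℝ (Fin d) → V} (hf : RD f) (hg : RD g) :
    RD (fun x => f x + g x) := by
  refine ⟨hf.1.add hg.1, fun m => ?_⟩
  obtain ⟨C, hC⟩ := hf.2 m
  obtain ⟨D, hD⟩ := hg.2 m
  refine ⟨C + D, fun x => ?_⟩
  have hp := one_add_norm_pow_pos x m
  have h1 := norm_add_le (f x) (g x)
  nlinarith [hC x, hD x]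

lemma RD.neg {f : EuclideanSpace ℝ (Fin d) → V} (hf : RD f) :
    RD (fun x => - f x) := hf.le hf.1.neg (fun x => by simp)

lemma RD.sub {f g : EuclideanSpace ℝ (Fin d) → V} (hf : RD f) (hg : RD g) :
    RD (fun x => f x - g x) := by simpa only [sub_eq_add_neg] using hf.add hg.neg

lemma RD.zero : RD (fun _ : EuclideanSpace ℝ (Fin d) => (0:V)) :=
  ⟨continuous_const, fun _ => ⟨0, fun x => by simp⟩⟩

lemma RD.sum {ι : Type*} {s : Finset ι} {f : ι → EuclideanSpace ℝ (Fin d) → V} (hf : ∀ i, RD (f i)) :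
    RD (fun x => ∑ i ∈ s, f i x) := by
  classical
  induction s using Finset.induction_on with
  | empty => simpa using RD.zero
  | insert a s ha ih =>
    simp only [Finset.sum_insert ha]
    exact (hf a).add ih

/-- product with something bounded -/
lemma RD.mul_bdd {A : Type*} [NormedRing A] {f g : EuclideanSpace ℝ (Fin d) → A} (hf : RD f)
    (hg : Continuous g) (k : ℕ) (c : ℝ) (h : ∀ x, ‖g x‖ ≤ c * (1 + ‖x‖) ^ k) :
    RD (fun x => g x * f x) := by
  refine hf.dom (hg.mul hf.1) k c fun x => (norm_mul_le _ _).trans ?_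
  gcongr; exact h x

lemma RD.mul {A : Type*} [NormedRing A] {f g : EuclideanSpace ℝ (Fin d) → A} (hf : RD f)
    (hg : RD g) : RD (fun x => f x * g x) := by
  obtain ⟨C, _, hC⟩ := hf.bdd
  exact hg.mul_bdd hf.1 0 C (fun x => by simpa using hC x)

lemma RD.const_mul {A : Type*} [NormedRing A] {f : EuclideanSpace ℝ (Fin d) → A} (hf : RD f) (a : A) :
    RD (fun x => a * f x) := hf.mul_bdd continuous_const 0 ‖a‖ (by simp)

lemma RD.rpow {f : EuclideanSpace ℝ (Fin d) → V} (hf : RD f) {r : ℝ} (hr : 1 ≤ r) :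
    RD (fun x => ‖f x‖ ^ r) := by
  obtain ⟨C, hC0, hC⟩ := hf.bdd
  refine hf.dom (hf.1.norm.rpow_const fun x => Or.inr (by linarith)) 0 (C ^ (r-1)) fun x => ?_
  have e : ‖f x‖ ^ r = ‖f x‖ ^ (r - 1) * ‖f x‖ := by
    rcases eq_or_lt_of_le (norm_nonneg (f x)) with h | h
    · rw [← h, mul_zero, Real.zero_rpow (by linarith)]
    · nth_rewrite 3 [← Real.rpow_one ‖f x‖]
      rw [← Real.rpow_add h]; ring_nf
  rw [Real.norm_of_nonneg (by positivity), e]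
  have : ‖f x‖ ^ (r-1) ≤ C ^ (r-1) := Real.rpow_le_rpow (norm_nonneg _) (hC x) (by linarith)
  simp only [pow_zero, mul_one]
  gcongr

lemma RD.sq {f : EuclideanSpace ℝ (Fin d) → V} (hf : RD f) : RD (fun x => ‖f x‖ ^ 2) := by
  have := hf.rpow (r := 2) (by norm_num)
  simpa using this

lemma RD.npow {f : EuclideanSpace ℝ (Fin d) → ℂ} (hf : RD f) {p : ℝ} (hp : 0 ≤ p) :
    RD (fun x => ((‖f x‖ ^ p : ℝ) : ℂ) * f x) := by
  have h := hf.rpow (r := p + 1) (by linarith)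
  refine h.le ((Complex.continuous_ofReal.comp
    (hf.1.norm.rpow_const fun x => Or.inr hp)).mul hf.1) fun x => ?_
  rw [norm_mul, Complex.norm_real, Real.rpow_add_one' (norm_nonneg _) (by linarith), norm_mul, norm_norm]

lemma RD.cj {f : EuclideanSpace ℝ (Fin d) → ℂ} (hf : RD f) : RD (fun x => starRingEnd ℂ (f x)) :=
  hf.le (Complex.continuous_conj.comp hf.1) (fun x => by simp)

lemma RD.im {f : EuclideanSpace ℝ (Fin d) → ℂ} (hf : RD f) : RD (fun x => (f x).im) :=
  hf.le (Complex.continuous_im.comp hf.1) (fun x => Complex.abs_im_le_norm _)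

lemma RD.re {f : EuclideanSpace ℝ (Fin d) → ℂ} (hf : RD f) : RD (fun x => (f x).re) :=
  hf.le (Complex.continuous_re.comp hf.1) (fun x => Complex.abs_re_le_norm _)

/-- compactly supported continuous functions -/
lemma RD.of_compact {f : EuclideanSpace ℝ (Fin d) → V} (hf : Continuous f) (hc : HasCompactSupport f) :
    RD f := by
  refine ⟨hf, fun m => ?_⟩
  have h1 : Continuous (fun x => (1 + ‖x‖) ^ m * ‖f x‖) := by fun_prop
  have h2 : HasCompactSupport (fun x => (1 + ‖x‖) ^ m * ‖f x‖) := by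
    refine hc.mono fun x hx => ?_
    contrapose hx
    simp only [Function.mem_support, not_not] at hx ⊢
    rw [hx]; simp
  obtain ⟨C, hC⟩ := h2.exists_bound_of_continuous h1
  exact ⟨C, fun x => (le_abs_self _).trans (hC x)⟩

/-- Schwartz functions -/
lemma RD.schwartz (f : 𝓢(EuclideanSpace ℝ (Fin d), ℂ)) : RD f := by
  refine ⟨f.continuous, fun m => ?_⟩
  have h := fun x => SchwartzMap.one_add_le_sup_seminorm_apply (𝕜 := ℝ) (m := (m, 0)) (k := m) (n := 0)
    le_rfl le_rfl f x
  simp only [norm_iteratedFDeriv_zero] at h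
  exact ⟨_, h⟩

lemma schwartz_pd (f : 𝓢(EuclideanSpace ℝ (Fin d), ℂ)) (k : Fin d) :
    ∃ g : 𝓢(EuclideanSpace ℝ (Fin d), ℂ), ∀ x, g x = pd k f x :=
  ⟨(SchwartzMap.evalCLM ℝ _ _ (stdVec d k) ∘L SchwartzMap.fderivCLM ℝ _ _) f, fun _ => rfl⟩

/-- dominated convergence with a weight -/
lemma RD.tendsto {f : EuclideanSpace ℝ (Fin d) → ℝ} (hf : RD f)
    {a : ℕ → EuclideanSpace ℝ (Fin d) → ℝ} {b : EuclideanSpace ℝ (Fin d) → ℝ}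
    (ha : ∀ n, Continuous (a n)) (k : ℕ) (c : ℝ) (h : ∀ n x, |a n x| ≤ c * (1 + ‖x‖) ^ k)
    (hl : ∀ x, Tendsto (fun n => a n x) atTop (𝓝 (b x))) :
    Tendsto (fun n => ∫ x, a n x * f x) atTop (𝓝 (∫ x, b x * f x)) := by
  have hi : Integrable (fun x => (c * (1 + ‖x‖) ^ k) * ‖f x‖) := by
    refine RD.integrable (hf.norm.mul_bdd (by fun_prop) k |c| fun x => ?_)
    rw [norm_mul, Real.norm_eq_abs, Real.norm_of_nonneg (by positivity)]
  refine tendsto_integral_of_dominated_convergence _ (fun n => ((ha n).mul hf.1).aestronglyMeasurable)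
    hi (fun n => ae_of_all _ fun x => ?_) (ae_of_all _ fun x => (hl x).mul_const _)
  rw [norm_mul]
  gcongr
  exact h n x

end

section
variable {d : ℕ} {I : Set ℝ} {U : ℝ × EuclideanSpace ℝ (Fin d) → ℂ}

lemma Sol.schwartz (h : Sol I U) {t : ℝ} (ht : t ∈ I) :
    ∃ f : 𝓢(EuclideanSpace ℝ (Fin d), ℂ), (f : EuclideanSpace ℝ (Fin d) → ℂ) = fun x => U (t, x) :=
  ⟨⟨fun x => U (t, x), h.se.sm.slice ht, h.dec t ht⟩, rfl⟩

lemma Sol.rd0 (h : Sol I U) {t : ℝ} (ht : t ∈ I) : RD (fun x => U (t, x)) := by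
  obtain ⟨f, hf⟩ := h.schwartz ht
  rw [← hf]; exact RD.schwartz f

lemma Sol.rd1 (h : Sol I U) {t : ℝ} (ht : t ∈ I) (k : Fin d) : RD (fun x => Dv (dx k) U (t, x)) := by
  obtain ⟨f, hf⟩ := h.schwartz ht
  obtain ⟨g, hg⟩ := schwartz_pd f k
  have : (fun x => Dv (dx k) U (t, x)) = g := by
    funext x; rw [hg, hf, pd_slice1 h.se.sm ht]
  rw [this]; exact RD.schwartz g

lemma Sol.rd2 (h : Sol I U) {t : ℝ} (ht : t ∈ I) (j k : Fin d) :
    RD (fun x => Dv (dx j) (Dv (dx k) U) (t, x)) := by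
  obtain ⟨f, hf⟩ := h.schwartz ht
  obtain ⟨g, hg⟩ := schwartz_pd f k
  obtain ⟨g2, hg2⟩ := schwartz_pd g j
  have : (fun x => Dv (dx j) (Dv (dx k) U) (t, x)) = g2 := by
    funext x
    have : (g : EuclideanSpace ℝ (Fin d) → ℂ) = pd k f := funext hg
    rw [hg2, this, hf, pd_slice2 h.se.sm ht]
  rw [this]; exact RD.schwartz g2

lemma Sol.rdt (h : Sol I U) {t : ℝ} (ht : t ∈ I) : RD (fun x => Dv (dt d) U (t, x)) := by
  have e : (fun x => Dv (dt d) U (t, x)) = fun x => Complex.I * (∑ k, Dv (dx k) (Dv (dx k) U) (t, x)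
      + ((‖U (t, x)‖ ^ ((4:ℝ)/d) : ℝ) : ℂ) * U (t, x)) := by
    funext x; exact h.se.eq (t, x) ht
  rw [e]
  exact RD.const_mul ((RD.sum fun k => h.rd2 ht k k).add ((h.rd0 ht).npow (by positivity))) _

end
end
end

section
open MeasureTheory Set Filter Topology SchwartzMap FourierTransform
open scoped ENNReal NNReal

noncomputable section

set_option linter.unusedSectionVars false

section
variable {d : ℕ}

lemma lint_rpow {V : Type*} [NormedAddCommGroup V] {f : EuclideanSpace ℝ (Fin d) → V} (hf : RD f) {r : ℝ} (hr : 1 ≤ r) :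
    ∫⁻ x, ‖f x‖ₑ ^ r = ENNReal.ofReal (∫ x, ‖f x‖ ^ r) := by
  rw [ofReal_integral_eq_lintegral_ofReal (hf.rpow hr).integrable
    (ae_of_all _ fun x => by positivity)]
  refine lintegral_congr fun x => ?_
  rw [← ofReal_norm_eq_enorm, ENNReal.ofReal_rpow_of_nonneg (norm_nonneg _) (by linarith)]

lemma opnorm_sq_le (L : EuclideanSpace ℝ (Fin d) →L[ℝ] ℂ) :
    ‖L‖ ^ 2 ≤ ∑ k, ‖L (stdVec d k)‖ ^ 2 := by
  have h : ‖L‖ ≤ Real.sqrt (∑ k, ‖L (stdVec d k)‖ ^ 2) := by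
    refine L.opNorm_le_bound (Real.sqrt_nonneg _) fun y => ?_
    have e : L y = ∑ k, y k • L (stdVec d k) := by
      have : y = ∑ k, y k • stdVec d k := by
        ext i
        simp [stdVec, Finset.sum_apply, Pi.single_apply]
      conv_lhs => rw [this]
      rw [map_sum]
      simp
    rw [e]
    calc ‖∑ k, y k • L (stdVec d k)‖ ≤ ∑ k, ‖y k‖ * ‖L (stdVec d k)‖ := by
          refine (norm_sum_le _ _).trans (le_of_eq ?_)
          simp only [norm_smul]
      _ ≤ Real.sqrt (∑ k, ‖y k‖ ^ 2) * Real.sqrt (∑ k, ‖L (stdVec d k)‖ ^ 2) :=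
          Real.sum_mul_le_sqrt_mul_sqrt _ _ _
      _ = _ := by rw [← EuclideanSpace.norm_eq, mul_comm]
  calc ‖L‖ ^ 2 ≤ (Real.sqrt (∑ k, ‖L (stdVec d k)‖ ^ 2)) ^ 2 := by gcongr
    _ = _ := Real.sq_sqrt (Finset.sum_nonneg fun _ _ => by positivity)

lemma gn_real (d : ℕ) (hd : 0 < d) : ∃ C : ℝ, 0 ≤ C ∧ ∀ g : EuclideanSpace ℝ (Fin d) → ℂ,
    ContDiff ℝ (⊤ : ℕ∞) g → HasCompactSupport g →
    ∫ x, ‖g x‖ ^ ((4:ℝ)/d + 2) ≤ C * (∫ x, ‖g x‖ ^ 2) ^ ((2:ℝ)/d) * ∫ x, ∑ k, ‖pd k g x‖ ^ 2 := by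
  obtain ⟨C, hC⟩ := gn d hd
  refine ⟨C, C.coe_nonneg, fun g hg hgc => ?_⟩
  have h := hC g (hg.of_le (by exact_mod_cast le_top)) hgc
  have hp : 0 < (4:ℝ)/d := by positivity
  have r0 := RD.of_compact hg.continuous hgc
  have r1 := fun k => RD.of_compact (pd_contDiff hg k).continuous (pd_compact hgc k)
  have r2 : RD (fun x => ∑ k, ‖pd k g x‖ ^ 2) := RD.sum fun k => (r1 k).sq
  have h2 : ∫⁻ x, ‖fderiv ℝ g x‖ₑ ^ (2:ℝ) ≤ ENNReal.ofReal (∫ x, ∑ k, ‖pd k g x‖ ^ 2) := by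
    rw [ofReal_integral_eq_lintegral_ofReal r2.integrable
      (ae_of_all _ fun x => Finset.sum_nonneg fun _ _ => by positivity)]
    refine lintegral_mono fun x => ?_
    rw [← ofReal_norm_eq_enorm, ENNReal.ofReal_rpow_of_nonneg (norm_nonneg _) (by norm_num)]
    apply ENNReal.ofReal_le_ofReal
    rw [Real.rpow_two]
    exact opnorm_sq_le _
  rw [add_comm (2:ℝ), lint_rpow r0 (by linarith), lint_rpow r0 (by norm_num)] at h
  have n1 : 0 ≤ ∫ x, ‖g x‖ ^ 2 := integral_nonneg fun x => by positivity
  have n2 : 0 ≤ ∫ x, ∑ k, ‖pd k g x‖ ^ 2 := integral_nonneg fun x => Finset.sum_nonneg fun _ _ => by positivity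
  have h3 := h.trans (mul_le_mul_right h2 _)
  simp only [Real.rpow_two] at h3
  rw [ENNReal.ofReal_rpow_of_nonneg n1 (by positivity), ← ENNReal.ofReal_coe_nnreal,
    ← ENNReal.ofReal_mul (by positivity), ← ENNReal.ofReal_mul (by positivity)] at h3
  exact (ENNReal.ofReal_le_ofReal_iff (by positivity)).1 h3

lemma pd_mul_real {φ : EuclideanSpace ℝ (Fin d) → ℝ} {v : EuclideanSpace ℝ (Fin d) → ℂ}
    (hφ : ContDiff ℝ (⊤ : ℕ∞) φ) (hv : ContDiff ℝ (⊤ : ℕ∞) v) (k : Fin d) (x) :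
    pd k (fun x => (φ x : ℂ) * v x) x = (φ x : ℂ) * pd k v x + ((pd k φ x : ℝ) : ℂ) * v x := by
  have h1 := (Complex.ofRealCLM.hasFDerivAt (x := φ x)).comp x ((hφ.differentiable (by simp)) x).hasFDerivAt
  have h2 := ((hv.differentiable (by simp)) x).hasFDerivAt
  have := (h1.mul h2).fderiv
  have e : fderiv ℝ (fun x => (φ x : ℂ) * v x) x = _ := this
  unfold pd
  rw [e]
  simp
  ring

lemma contDiff_ofReal_mul {φ : EuclideanSpace ℝ (Fin d) → ℝ} {v : EuclideanSpace ℝ (Fin d) → ℂ}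
    (hφ : ContDiff ℝ (⊤ : ℕ∞) φ) (hv : ContDiff ℝ (⊤ : ℕ∞) v) :
    ContDiff ℝ (⊤ : ℕ∞) (fun x => (φ x : ℂ) * v x) :=
  (Complex.ofRealCLM.contDiff.comp hφ).mul hv

/-- product bound for gradients -/
lemma pd_mul_bound {φ : EuclideanSpace ℝ (Fin d) → ℝ} {v : EuclideanSpace ℝ (Fin d) → ℂ}
    (hφ : ContDiff ℝ (⊤ : ℕ∞) φ) (hv : ContDiff ℝ (⊤ : ℕ∞) v) {c : ℝ}
    (h1 : ∀ x, |φ x| ≤ 1) (h2 : ∀ k x, |pd k φ x| ≤ c) (k : Fin d) (x) :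
    ‖pd k (fun x => (φ x : ℂ) * v x) x‖ ^ 2 ≤ 2 * ‖pd k v x‖ ^ 2 + 2 * c ^ 2 * ‖v x‖ ^ 2 := by
  rw [pd_mul_real hφ hv]
  have hc : 0 ≤ c := (abs_nonneg _).trans (h2 k x)
  have : ‖(φ x : ℂ) * pd k v x + ((pd k φ x : ℝ) : ℂ) * v x‖ ≤ ‖pd k v x‖ + c * ‖v x‖ := by
    refine (norm_add_le _ _).trans ?_
    rw [norm_mul, norm_mul, Complex.norm_real, Complex.norm_real, Real.norm_eq_abs, Real.norm_eq_abs]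
    have := h1 x
    have := h2 k x
    have a := norm_nonneg (pd k v x)
    have b := norm_nonneg (v x)
    nlinarith
  calc _ ≤ (‖pd k v x‖ + c * ‖v x‖) ^ 2 := by gcongr
    _ ≤ _ := by nlinarith [sq_nonneg (‖pd k v x‖ - c * ‖v x‖)]

lemma gns (d : ℕ) (hd : 0 < d) : ∃ C : ℝ, 0 ≤ C ∧ ∀ v : EuclideanSpace ℝ (Fin d) → ℂ,
    ContDiff ℝ (⊤ : ℕ∞) v → RD v → (∀ k, RD (pd k v)) →
    ∫ x, ‖v x‖ ^ ((4:ℝ)/d + 2) ≤ C * (∫ x, ‖v x‖ ^ 2) ^ ((2:ℝ)/d) *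
      ((∫ x, ∑ k, ‖pd k v x‖ ^ 2) + ∫ x, ‖v x‖ ^ 2) := by
  obtain ⟨C, hC0, hC⟩ := gn_real d hd
  obtain ⟨c, hc0, hc⟩ := cut_pd_bounds d
  have hp : 0 < (4:ℝ)/d := by positivity
  refine ⟨C * (2 + 2 * d * c ^ 2), by positivity, fun v hv r0 r1 => ?_⟩
  have iM := r0.sq.integrable
  have rK : RD (fun x => ∑ k, ‖pd k v x‖ ^ 2) := RD.sum fun k => (r1 k).sq
  have iK := rK.integrable
  have nM : 0 ≤ ∫ x, ‖v x‖ ^ 2 := integral_nonneg fun x => by positivity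
  have nK : 0 ≤ ∫ x, ∑ k, ‖pd k v x‖ ^ 2 := integral_nonneg fun x => Finset.sum_nonneg fun _ _ => by positivity
  have lim := (r0.rpow (r := (4:ℝ)/d+2) (by linarith)).tendsto (a := fun n x => cut d n x ^ ((4:ℝ)/d+2))
    (b := fun _ => 1) (fun n => (cut_contDiff d n).continuous.rpow_const fun x => Or.inr (by linarith)) 0 1
    (fun n x => by
      have := cut_nonneg d n x
      rw [abs_of_nonneg (by positivity), pow_zero, mul_one]
      exact Real.rpow_le_one this (cut_le_one d n x) (by linarith))
    (fun x => by
      have := (cut_tendsto d x).rpow_const (p := (4:ℝ)/d+2) (Or.inr (by linarith))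
      simpa using this)
  simp only [one_mul] at lim
  refine le_of_tendsto' lim fun n => ?_
  have hg := contDiff_ofReal_mul (cut_contDiff d n) hv
  have hgc := cs_cmul (cut_compact d n) v
  have h := hC _ hg hgc
  have c1 : ∀ x, |cut d n x| ≤ 1 := fun x => by
    rw [abs_of_nonneg (cut_nonneg d n x)]; exact cut_le_one d n x
  have c2 : ∀ k x, |pd k (cut d n) x| ≤ c := fun k x => (hc n k x).1.trans (by
    rw [div_le_iff₀ (by positivity)]; nlinarith [(Nat.cast_nonneg n : (0:ℝ) ≤ n)])
  have e1 : ∫ x, ‖(cut d n x : ℂ) * v x‖ ^ ((4:ℝ)/d + 2) = ∫ x, cut d n x ^ ((4:ℝ)/d+2) * ‖v x‖ ^ ((4:ℝ)/d + 2) := by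
    refine integral_congr_ae (ae_of_all _ fun x => ?_)
    simp only
    rw [norm_mul, Complex.norm_real, Real.norm_of_nonneg (cut_nonneg d n x),
      Real.mul_rpow (cut_nonneg d n x) (norm_nonneg _)]
  rw [← e1]
  have g0 := RD.of_compact hg.continuous hgc
  have g1 := fun k => RD.of_compact (pd_contDiff hg k).continuous (pd_compact hgc k)
  have b1 : ∫ x, ‖(cut d n x : ℂ) * v x‖ ^ 2 ≤ ∫ x, ‖v x‖ ^ 2 := by
    refine integral_mono g0.sq.integrable iM fun x => ?_
    have : ‖(cut d n x : ℂ) * v x‖ ≤ ‖v x‖ := by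
      rw [norm_mul, Complex.norm_real, Real.norm_of_nonneg (cut_nonneg d n x)]
      exact mul_le_of_le_one_left (norm_nonneg _) (cut_le_one d n x)
    simp only
    gcongr
  have b2 : ∫ x, ∑ k, ‖pd k (fun x => (cut d n x : ℂ) * v x) x‖ ^ 2 ≤
      (2 + 2 * d * c ^ 2) * ((∫ x, ∑ k, ‖pd k v x‖ ^ 2) + ∫ x, ‖v x‖ ^ 2) := by
    have : ∫ x, ∑ k, ‖pd k (fun x => (cut d n x : ℂ) * v x) x‖ ^ 2 ≤
      ∫ x, (2 * (∑ k, ‖pd k v x‖ ^ 2) + (2 * d * c ^ 2) * ‖v x‖ ^ 2) := by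
      refine integral_mono (RD.integrable (RD.sum fun k => (g1 k).sq))
        ((iK.const_mul 2).add (iM.const_mul _)) fun x => ?_
      refine (Finset.sum_le_sum fun k _ => pd_mul_bound (cut_contDiff d n) hv c1 c2 k x).trans ?_
      rw [Finset.sum_add_distrib, ← Finset.mul_sum, Finset.sum_const, Finset.card_univ, Fintype.card_fin,
        nsmul_eq_mul]
      apply le_of_eq; ring
    rw [integral_add (iK.const_mul 2) (iM.const_mul _), integral_const_mul, integral_const_mul] at this
    refine this.trans ?_
    have h0 : 0 ≤ 2 * (d:ℝ) * c ^ 2 := by positivity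
    nlinarith [mul_nonneg h0 nK, mul_nonneg h0 nM]
  have n0 : 0 ≤ ∫ x, ‖(cut d n x : ℂ) * v x‖ ^ 2 := integral_nonneg fun x => by positivity
  calc _ ≤ C * (∫ x, ‖(cut d n x : ℂ) * v x‖ ^ 2) ^ ((2:ℝ)/d) *
      ∫ x, ∑ k, ‖pd k (fun x => (cut d n x : ℂ) * v x) x‖ ^ 2 := h
    _ ≤ C * (∫ x, ‖v x‖ ^ 2) ^ ((2:ℝ)/d) * ((2 + 2 * d * c ^ 2) * ((∫ x, ∑ k, ‖pd k v x‖ ^ 2) + ∫ x, ‖v x‖ ^ 2)) := by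
        gcongr
    _ = _ := by ring

end

section
variable {d : ℕ} {I : Set ℝ} {U : ℝ × EuclideanSpace ℝ (Fin d) → ℂ}

/-- mass -/
def QM (U : ℝ × EuclideanSpace ℝ (Fin d) → ℂ) (t : ℝ) : ℝ := ∫ x, ‖U (t, x)‖ ^ 2
/-- variance -/
def QV (U : ℝ × EuclideanSpace ℝ (Fin d) → ℂ) (t : ℝ) : ℝ := ∫ x, ‖x‖ ^ 2 * ‖U (t, x)‖ ^ 2
/-- kinetic part -/
def QK (U : ℝ × EuclideanSpace ℝ (Fin d) → ℂ) (t : ℝ) : ℝ := ∫ x, ∑ k, ‖Dv (dx k) U (t, x)‖ ^ 2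
/-- potential part -/
def QX (U : ℝ × EuclideanSpace ℝ (Fin d) → ℂ) (t : ℝ) : ℝ := ∫ x, ‖U (t, x)‖ ^ ((4:ℝ)/d + 2)
/-- energy -/
def QE (U : ℝ × EuclideanSpace ℝ (Fin d) → ℂ) (t : ℝ) : ℝ :=
  (1/2) * QK U t - (1 / (4/d + 2)) * QX U t
/-- total size -/
def QA (U : ℝ × EuclideanSpace ℝ (Fin d) → ℂ) (t : ℝ) : ℝ := QM U t + QV U t + QK U t + QX U t

lemma QM_nonneg (t) : 0 ≤ QM U t := integral_nonneg fun x => by positivity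
lemma QV_nonneg (t) : 0 ≤ QV U t := integral_nonneg fun x => by positivity
lemma QK_nonneg (t) : 0 ≤ QK U t := integral_nonneg fun x => Finset.sum_nonneg fun _ _ => by positivity
lemma QX_nonneg (t) : 0 ≤ QX U t := integral_nonneg fun x => by positivity
lemma QA_nonneg (t) : 0 ≤ QA U t := by
  have := QM_nonneg (U := U) t; have := QV_nonneg (U := U) t
  have := QK_nonneg (U := U) t; have := QX_nonneg (U := U) t
  unfold QA; linarith

lemma Sol.rp (h : Sol I U) : 0 < (4:ℝ)/d := by have := h.hd; positivity

lemma Sol.rM (h : Sol I U) {t} (ht : t ∈ I) : RD (fun x => ‖U (t, x)‖ ^ 2) := (h.rd0 ht).sq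
lemma Sol.rV (h : Sol I U) {t} (ht : t ∈ I) : RD (fun x => ‖x‖ ^ 2 * ‖U (t, x)‖ ^ 2) :=
  (h.rd0 ht).sq.mul_bdd (by fun_prop) 2 1 (fun x => by
    rw [Real.norm_of_nonneg (by positivity), one_mul]; gcongr; linarith)
lemma Sol.rK (h : Sol I U) {t} (ht : t ∈ I) : RD (fun x => ∑ k, ‖Dv (dx k) U (t, x)‖ ^ 2) :=
  RD.sum fun k => (h.rd1 ht k).sq
lemma Sol.rX (h : Sol I U) {t} (ht : t ∈ I) : RD (fun x => ‖U (t, x)‖ ^ ((4:ℝ)/d+2)) :=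
  (h.rd0 ht).rpow (by have := h.rp; linarith)

/-- the tail estimate -/
lemma tail_bound (h : Sol I U) : ∃ C : ℝ, 0 ≤ C ∧ ∀ n : ℕ, ∀ t ∈ I,
    ∫ x, ‖(((1 - cut d n x : ℝ)) : ℂ) * U (t, x)‖ ^ ((4:ℝ)/d + 2) ≤
      C * (QV U t / (n+1) ^ 2) ^ ((2:ℝ)/d) * (QK U t + QM U t) := by
  obtain ⟨C, hC0, hC⟩ := gns d h.hd
  obtain ⟨c, hc0, hc⟩ := cut_pd_bounds d
  have hd := h.hd
  refine ⟨C * (3 + 2 * d * c ^ 2), by positivity, fun n t ht => ?_⟩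
  have hφ : ContDiff ℝ (⊤ : ℕ∞) (fun x => 1 - cut d n x) := contDiff_const.sub (cut_contDiff d n)
  have hpd : ∀ k x, pd k (fun x => 1 - cut d n x) x = - pd k (cut d n) x := by
    intro k x
    unfold pd; rw [fderiv_const_sub]; simp
  have hU := h.se.sm.slice ht
  have hv := contDiff_ofReal_mul hφ hU
  have c1 : ∀ x, |1 - cut d n x| ≤ 1 := fun x => by
    have := cut_nonneg d n x; have := cut_le_one d n x
    rw [abs_le]; constructor <;> linarith
  have c2 : ∀ k x, |pd k (fun x => 1 - cut d n x) x| ≤ c := fun k x => by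
    rw [hpd, abs_neg]
    exact (hc n k x).1.trans (by
      rw [div_le_iff₀ (by positivity)]; nlinarith [(Nat.cast_nonneg n : (0:ℝ) ≤ n)])
  have r0 : RD (fun x => (((1 - cut d n x : ℝ)) : ℂ) * U (t, x)) :=
    (h.rd0 ht).mul_bdd (Complex.continuous_ofReal.comp hφ.continuous) 0 1 (fun x => by
      rw [Complex.norm_real, Real.norm_eq_abs]; simpa using c1 x)
  have r1 : ∀ k, RD (pd k (fun x => (((1 - cut d n x : ℝ)) : ℂ) * U (t, x))) := by
    intro k
    have : pd k (fun x => (((1 - cut d n x : ℝ)) : ℂ) * U (t, x)) = fun x =>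
        ((1 - cut d n x : ℝ) : ℂ) * Dv (dx k) U (t, x) + ((pd k (fun x => 1 - cut d n x) x : ℝ) : ℂ) * U (t, x) := by
      funext x
      rw [pd_mul_real hφ hU, pd_slice1 h.se.sm ht]
    rw [this]
    refine RD.add ((h.rd1 ht k).mul_bdd (Complex.continuous_ofReal.comp hφ.continuous) 0 1 (fun x => ?_))
      ((h.rd0 ht).mul_bdd (Complex.continuous_ofReal.comp (pd_contDiff hφ k).continuous) 0 c (fun x => ?_))
    · rw [Complex.norm_real, Real.norm_eq_abs]; simpa using c1 x
    · rw [Complex.norm_real, Real.norm_eq_abs]; simpa using c2 k x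
  have key := hC _ hv r0 r1
  have iM := (h.rM ht).integrable
  have iK := (h.rK ht).integrable
  have bM : ∫ x, ‖(((1 - cut d n x : ℝ)) : ℂ) * U (t, x)‖ ^ 2 ≤ QM U t := by
    refine integral_mono r0.sq.integrable iM fun x => ?_
    simp only [norm_mul, Complex.norm_real, Real.norm_eq_abs]
    have := c1 x
    gcongr
    exact mul_le_of_le_one_left (norm_nonneg _) this
  have bV : ∫ x, ‖(((1 - cut d n x : ℝ)) : ℂ) * U (t, x)‖ ^ 2 ≤ QV U t / (n+1) ^ 2 := by
    rw [le_div_iff₀ (by positivity), mul_comm, ← integral_const_mul]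
    refine integral_mono (r0.sq.integrable.const_mul _) (h.rV ht).integrable fun x => ?_
    simp only [norm_mul, Complex.norm_real, Real.norm_eq_abs]
    rcases le_or_gt ‖x‖ (n+1) with hx | hx
    · rw [cut_eq_one d n hx]; simp; positivity
    · have := c1 x
      have : |1 - cut d n x| * ‖U (t, x)‖ ≤ ‖U (t, x)‖ := mul_le_of_le_one_left (norm_nonneg _) this
      gcongr
  have bK : ∫ x, ∑ k, ‖pd k (fun x => (((1 - cut d n x : ℝ)) : ℂ) * U (t, x)) x‖ ^ 2 ≤
      2 * QK U t + (2 * d * c ^ 2) * QM U t := by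
    unfold QK QM
    rw [← integral_const_mul, ← integral_const_mul, ← integral_add (iK.const_mul 2) (iM.const_mul _)]
    refine integral_mono (RD.integrable (RD.sum fun k => (r1 k).sq))
      ((iK.const_mul 2).add (iM.const_mul _)) fun x => ?_
    refine (Finset.sum_le_sum fun k _ => pd_mul_bound hφ hU c1 c2 k x).trans ?_
    simp only [pd_slice1 h.se.sm ht]
    rw [Finset.sum_add_distrib, ← Finset.mul_sum, Finset.sum_const, Finset.card_univ, Fintype.card_fin,
      nsmul_eq_mul]
    apply le_of_eq; ring
  have n0 : 0 ≤ ∫ x, ‖(((1 - cut d n x : ℝ)) : ℂ) * U (t, x)‖ ^ 2 := integral_nonneg fun x => by positivity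
  have nK := QK_nonneg (U := U) t
  have nM := QM_nonneg (U := U) t
  have nV := QV_nonneg (U := U) t
  have h0 : 0 ≤ 2 * (d:ℝ) * c ^ 2 := by positivity
  have bT : (∫ x, ∑ k, ‖pd k (fun x => (((1 - cut d n x : ℝ)) : ℂ) * U (t, x)) x‖ ^ 2) +
    ∫ x, ‖(((1 - cut d n x : ℝ)) : ℂ) * U (t, x)‖ ^ 2 ≤ (3 + 2 * d * c ^ 2) * (QK U t + QM U t) := by
    nlinarith [mul_nonneg h0 nK, mul_nonneg h0 nM]
  have nn : 0 ≤ ∫ x, ∑ k, ‖pd k (fun x => (((1 - cut d n x : ℝ)) : ℂ) * U (t, x)) x‖ ^ 2 :=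
    integral_nonneg fun x => Finset.sum_nonneg fun _ _ => by positivity
  calc _ ≤ _ := key
    _ ≤ C * (QV U t / (n+1) ^ 2) ^ ((2:ℝ)/d) * ((3 + 2 * d * c ^ 2) * (QK U t + QM U t)) := by
        gcongr
    _ = _ := by ring

lemma gna (h : Sol I U) {Jc : Set ℝ} (hJ : IsCompact Jc) (hJI : Jc ⊆ I) (B : ℝ) :
    ∃ C, ∀ t ∈ Jc, QM U t ≤ B → QV U t ≤ B → QE U t ≤ B → QA U t ≤ C := by
  obtain ⟨C, hC0, hC⟩ := tail_bound h
  have hd := h.hd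
  have hp := h.rp
  -- choice of the radius
  have lim : Tendsto (fun n : ℕ => C * (|B| / ((n:ℝ)+1) ^ 2) ^ ((2:ℝ)/d)) atTop (𝓝 0) := by
    have h1 : Tendsto (fun n : ℕ => |B| / ((n:ℝ)+1) ^ 2) atTop (𝓝 0) := by
      refine tendsto_const_nhds.div_atTop ?_
      exact (tendsto_pow_atTop (by norm_num)).comp
        (tendsto_atTop_add_const_right _ _ tendsto_natCast_atTop_atTop)
    have h2 := (h1.rpow_const (p := (2:ℝ)/d) (Or.inr (by positivity))).const_mul C
    rwa [Real.zero_rpow (by positivity), mul_zero] at h2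
  obtain ⟨n, hn⟩ := (lim.eventually (gt_mem_nhds (show (0:ℝ) < 1/4 by norm_num))).exists
  -- the inner bound
  have hK : IsCompact (Jc ×ˢ Metric.closedBall (0 : EuclideanSpace ℝ (Fin d)) (2*(n+1))) :=
    hJ.prod (isCompact_closedBall _ _)
  obtain ⟨S, hS⟩ := hK.exists_bound_of_continuousOn
    (h.se.sm.cont.mono (prod_mono hJI (subset_univ _)))
  refine ⟨3 * (8 * |B| + 4 * (|S| ^ ((4:ℝ)/d)) * |B|) + 4 * |B|, fun t ht hM hV hE => ?_⟩
  have htI := hJI ht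
  have nK := QK_nonneg (U := U) t
  have nM := QM_nonneg (U := U) t
  have nV := QV_nonneg (U := U) t
  have nX := QX_nonneg (U := U) t
  have hB := le_abs_self B
  have hφ : Continuous (fun x => 1 - cut d n x) := continuous_const.sub (cut_contDiff d n).continuous
  have r0 : RD (fun x => (((1 - cut d n x : ℝ)) : ℂ) * U (t, x)) :=
    (h.rd0 htI).mul_bdd (Complex.continuous_ofReal.comp hφ) 0 1 (fun x => by
      have := cut_nonneg d n x; have := cut_le_one d n x
      rw [Complex.norm_real, Real.norm_eq_abs]
      simp only [pow_zero, mul_one]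
      rw [abs_le]; constructor <;> linarith)
  have iv := (r0.rpow (r := (4:ℝ)/d+2) (by linarith)).integrable
  have iM := (h.rM htI).integrable
  have hX : QX U t ≤ (∫ x, ‖(((1 - cut d n x : ℝ)) : ℂ) * U (t, x)‖ ^ ((4:ℝ)/d + 2)) +
      |S| ^ ((4:ℝ)/d) * QM U t := by
    unfold QX QM
    rw [← integral_const_mul, ← integral_add iv (iM.const_mul _)]
    refine integral_mono (h.rX htI).integrable (iv.add (iM.const_mul _)) fun x => ?_
    simp only
    rcases le_or_gt (2 * ((n:ℝ)+1)) ‖x‖ with hx | hx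
    · rw [cut_eq_zero d n hx]
      simp only [sub_zero, Complex.ofReal_one, one_mul]
      have : 0 ≤ |S| ^ ((4:ℝ)/d) * ‖U (t, x)‖ ^ 2 := by positivity
      linarith
    · have hSx := (hS (t, x) ⟨ht, by simpa using hx.le⟩).trans (le_abs_self S)
      have : ‖U (t, x)‖ ^ ((4:ℝ)/d + 2) ≤ |S| ^ ((4:ℝ)/d) * ‖U (t, x)‖ ^ 2 := by
        rw [← Real.rpow_two, Real.rpow_add' (norm_nonneg _) (by linarith)]
        gcongr
      have : 0 ≤ ‖(((1 - cut d n x : ℝ)) : ℂ) * U (t, x)‖ ^ ((4:ℝ)/d + 2) := by positivity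
      linarith
  have hT : ∫ x, ‖(((1 - cut d n x : ℝ)) : ℂ) * U (t, x)‖ ^ ((4:ℝ)/d + 2) ≤ 1/4 * (QK U t + QM U t) := by
    refine (hC n t htI).trans ?_
    have : C * (QV U t / ((n:ℝ)+1) ^ 2) ^ ((2:ℝ)/d) ≤ 1/4 := by
      refine le_trans ?_ hn.le
      gcongr
      linarith
    gcongr
  have hE2 : QK U t ≤ 2 * |B| + QX U t := by
    have : (1 / ((4:ℝ)/d + 2)) * QX U t ≤ 1/2 * QX U t := by
      gcongr; linarith
    unfold QE at hE
    linarith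
  have hS0 : 0 ≤ |S| ^ ((4:ℝ)/d) := by positivity
  have hSM : |S| ^ ((4:ℝ)/d) * QM U t ≤ |S| ^ ((4:ℝ)/d) * |B| := by gcongr; linarith
  have hSB : 0 ≤ |S| ^ ((4:ℝ)/d) * |B| := by positivity
  unfold QA
  linarith

end
end
end

section
open MeasureTheory Set Filter Topology SchwartzMap FourierTransform
open scoped ENNReal NNReal

noncomputable section

set_option linter.unusedSectionVars false

lemma mean_bound {a b c : ℝ} {V : Type*} [NormedAddCommGroup V] [NormedSpace ℝ V] {h h' : ℝ → V}
    (hd : ∀ s ∈ Icc a b, HasDerivAt h (h' s) s)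
    (hb : ∀ s ∈ Icc a b, ‖h' s‖ ≤ c) {s t : ℝ} (hs : s ∈ Icc a b) (ht : t ∈ Icc a b) :
    ‖h t - h s‖ ≤ c * |t - s| :=
  (convex_Icc a b).norm_image_sub_le_of_norm_hasDerivWithin_le
    (fun x hx => (hd x hx).hasDerivWithinAt) hb hs ht

lemma lim0 {a b C : ℝ} (hab : a ≤ b) {h h' : ℕ → ℝ → ℝ} {H L : ℝ → ℝ}
    (hd : ∀ n, ∀ s ∈ Icc a b, HasDerivAt (h n) (h' n s) s)
    (hb : ∀ n, ∀ s ∈ Icc a b, |h' n s| ≤ C)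
    (hL : ∀ s ∈ Icc a b, Tendsto (fun n => h' n s) atTop (𝓝 (L s)))
    (hH : ∀ s ∈ Icc a b, Tendsto (fun n => h n s) atTop (𝓝 (H s))) :
    H b - H a = ∫ s in a..b, L s := by
  have sub : uIoc a b ⊆ Icc a b := by rw [uIoc_of_le hab]; exact Ioc_subset_Icc_self
  have meas : ∀ n, AEStronglyMeasurable (h' n) (volume.restrict (uIoc a b)) := by
    intro n
    refine (measurable_deriv (h n)).aestronglyMeasurable.congr ?_
    filter_upwards [ae_restrict_mem measurableSet_uIoc] with s hs
    exact (hd n s (sub hs)).deriv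
  have int : ∀ n, IntervalIntegrable (h' n) volume a b := by
    intro n
    refine (intervalIntegrable_const (c := C)).mono_fun (meas n) ?_
    filter_upwards [ae_restrict_mem measurableSet_uIoc] with s hs
    rw [Real.norm_eq_abs, Real.norm_eq_abs]
    exact (hb n s (sub hs)).trans (le_abs_self C)
  have ftc : ∀ n, ∫ s in a..b, h' n s = h n b - h n a := fun n =>
    intervalIntegral.integral_eq_sub_of_hasDerivAt
      (fun s hs => hd n s (by rwa [uIcc_of_le hab] at hs)) (int n)
  have l1 : Tendsto (fun n => ∫ s in a..b, h' n s) atTop (𝓝 (∫ s in a..b, L s)) := by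
    refine intervalIntegral.tendsto_integral_filter_of_dominated_convergence (fun _ => C)
      (Eventually.of_forall meas) (Eventually.of_forall fun n => ae_of_all _ fun s hs => hb n s (sub hs))
      intervalIntegrable_const (ae_of_all _ fun s hs => hL s (sub hs))
  simp only [ftc] at l1
  exact tendsto_nhds_unique ((hH b ⟨hab, le_rfl⟩).sub (hH a ⟨le_rfl, hab⟩)) l1

section
variable {d : ℕ}

local notation "cj" => starRingEnd ℂ

lemma cut_lim {f : EuclideanSpace ℝ (Fin d) → ℝ} (hf : RD f) :
    Tendsto (fun n => ∫ x, cut d n x * f x) atTop (𝓝 (∫ x, f x)) := by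
  have := hf.tendsto (a := fun n => cut d n) (b := fun _ => 1) (fun n => (cut_contDiff d n).continuous) 0 1
    (fun n x => by rw [abs_of_nonneg (cut_nonneg d n x)]; simpa using cut_le_one d n x)
    (fun x => cut_tendsto d x)
  simpa using this

lemma sum_bound {V : Type*} [NormedAddCommGroup V] [NormedSpace ℝ V]
    {T : Fin d → EuclideanSpace ℝ (Fin d) → V} {f : EuclideanSpace ℝ (Fin d) → ℂ}
    {F : Fin d → EuclideanSpace ℝ (Fin d) → ℂ} {c : ℝ} (hc : 0 ≤ c) (hf : RD f) (hF : ∀ k, RD (F k))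
    (hT : ∀ k x, ‖T k x‖ ≤ c * (‖f x‖ * ‖F k x‖)) :
    ‖∫ x, ∑ k, T k x‖ ≤ c * (d + 1) * ((∫ x, ‖f x‖ ^ 2) + ∫ x, ∑ k, ‖F k x‖ ^ 2) := by
  have i1 := hf.sq.integrable
  have i2 : Integrable (fun x => ∑ k, ‖F k x‖ ^ 2) := RD.integrable (RD.sum fun k => (hF k).sq)
  rw [← integral_add i1 i2, ← integral_const_mul]
  refine norm_integral_le_of_norm_le ((i1.add i2).const_mul _) (ae_of_all _ fun x => ?_)
  refine (norm_sum_le _ _).trans ?_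
  calc ∑ k, ‖T k x‖ ≤ ∑ k, c * (‖f x‖ ^ 2 + ‖F k x‖ ^ 2) := by
        refine Finset.sum_le_sum fun k _ => (hT k x).trans ?_
        gcongr
        nlinarith [sq_nonneg (‖f x‖ - ‖F k x‖), sq_nonneg (‖f x‖ + ‖F k x‖)]
    _ = c * (d * ‖f x‖ ^ 2 + ∑ k, ‖F k x‖ ^ 2) := by
        rw [← Finset.mul_sum, Finset.sum_add_distrib, Finset.sum_const, Finset.card_univ,
          Fintype.card_fin, nsmul_eq_mul]
    _ ≤ _ := by
        have : 0 ≤ ∑ k, ‖F k x‖ ^ 2 := Finset.sum_nonneg fun _ _ => by positivity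
        have h2 : 0 ≤ c * ‖f x‖ ^ 2 := by positivity
        have h3 : 0 ≤ c * (d:ℝ) * ∑ k, ‖F k x‖ ^ 2 := by positivity
        nlinarith

lemma pd_coord_mul {f : EuclideanSpace ℝ (Fin d) → ℝ} (hf : ContDiff ℝ (⊤ : ℕ∞) f) (j k : Fin d) (x) :
    pd j (fun x => x k * f x) x = (if j = k then f x else 0) + x k * pd j f x := by
  have h1 : HasFDerivAt (fun x : EuclideanSpace ℝ (Fin d) => x k) (EuclideanSpace.proj k : EuclideanSpace ℝ (Fin d) →L[ℝ] ℝ) x :=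
    (EuclideanSpace.proj k : EuclideanSpace ℝ (Fin d) →L[ℝ] ℝ).hasFDerivAt
  have := (h1.mul ((hf.differentiable (by simp)) x).hasFDerivAt).fderiv
  have e : fderiv ℝ (fun x : EuclideanSpace ℝ (Fin d) => x k * f x) x = _ := this
  unfold pd
  rw [e]
  simp [stdVec, Pi.single_apply, eq_comm (a := j)]
  ring

lemma pd_normsq_mul {f : EuclideanSpace ℝ (Fin d) → ℝ} (hf : ContDiff ℝ (⊤ : ℕ∞) f) (k : Fin d) (x) :
    pd k (fun x => ‖x‖ ^ 2 * f x) x = 2 * x k * f x + ‖x‖ ^ 2 * pd k f x := by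
  have h1 : HasFDerivAt (fun x : EuclideanSpace ℝ (Fin d) => ‖x‖ ^ 2) (2 • (innerSL ℝ x)) x :=
    (hasStrictFDerivAt_norm_sq x).hasFDerivAt
  have := (h1.mul ((hf.differentiable (by simp)) x).hasFDerivAt).fderiv
  have e : fderiv ℝ (fun x : EuclideanSpace ℝ (Fin d) => ‖x‖ ^ 2 * f x) x = _ := this
  unfold pd
  rw [e]
  have i : inner ℝ x (stdVec d k) = x k := by
    simp [stdVec, EuclideanSpace.inner_single_right]
  simp [i]
  ring

lemma coord_contDiff {f : EuclideanSpace ℝ (Fin d) → ℝ} (hf : ContDiff ℝ (⊤ : ℕ∞) f) (k : Fin d) :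
    ContDiff ℝ (⊤ : ℕ∞) (fun x => x k * f x) :=
  ((EuclideanSpace.proj (𝕜 := ℝ) k).contDiff).mul hf

lemma coord_le (x : EuclideanSpace ℝ (Fin d)) (k : Fin d) : |x k| ≤ ‖x‖ := PiLp.norm_apply_le x k

variable {I : Set ℝ} {U : ℝ × EuclideanSpace ℝ (Fin d) → ℂ}

lemma mass_const (h : Sol I U) {a b B : ℝ} (hI : Icc a b ⊆ I) (hB : ∀ t ∈ Icc a b, QA U t ≤ B)
    {s t : ℝ} (hs : s ∈ Icc a b) (ht : t ∈ Icc a b) : QM U t = QM U s := by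
  obtain ⟨c, hc0, hc⟩ := cut_pd_bounds d
  have bd : ∀ n : ℕ, ∀ s ∈ Icc a b, ‖(2 * (∫ x, ∑ k, pd k (cut d n) x * (cj (U (s, x)) * Dv (dx k) U (s, x)).im)
        - 2 * ∫ x, cut d n x * (cj (U (s, x)) * (((‖U (s, x)‖ ^ ((4:ℝ)/d) : ℝ) : ℂ) * U (s, x))).im)‖
        ≤ 2 * (c / (n+1) * (d+1) * B) := by
    intro n s hs
    have z : ∀ x, (cj (U (s, x)) * (((‖U (s, x)‖ ^ ((4:ℝ)/d) : ℝ) : ℂ) * U (s, x))).im = 0 := by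
      intro x
      simp only [Complex.mul_im, Complex.mul_re, Complex.conj_re, Complex.conj_im, Complex.ofReal_re,
        Complex.ofReal_im]
      ring
    simp only [z, mul_zero, integral_zero, sub_zero]
    rw [norm_mul, Real.norm_ofNat]
    gcongr
    have := sum_bound (T := fun k x => pd k (cut d n) x * (cj (U (s, x)) * Dv (dx k) U (s, x)).im)
      (f := fun x => U (s, x)) (F := fun k x => Dv (dx k) U (s, x)) (c := c / (n+1)) (by positivity)
      (h.rd0 (hI hs)) (h.rd1 (hI hs)) (by
        intro k x
        rw [norm_mul]
        gcongr
        · exact (hc n k x).1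
        · refine (Complex.abs_im_le_norm _).trans (le_of_eq ?_)
          rw [norm_mul, RCLike.norm_conj])
    refine this.trans ?_
    gcongr
    refine le_trans ?_ (hB s hs)
    have := QV_nonneg (U := U) s; have := QX_nonneg (U := U) s
    change QM U s + QK U s ≤ _
    unfold QA; linarith
  have key : ∀ n : ℕ, ‖(∫ x, cut d n x * ‖U (t, x)‖ ^ 2) - ∫ x, cut d n x * ‖U (s, x)‖ ^ 2‖
      ≤ 2 * (c / (n+1) * (d+1) * B) * |t - s| := fun n =>
    mean_bound (fun s hs => mass_deriv h.se (cut_contDiff d n) (cut_compact d n) (hI hs)) (bd n) hs ht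
  have l1 := ((cut_lim (h.rM (hI ht))).sub (cut_lim (h.rM (hI hs)))).norm
  have l2 : Tendsto (fun n : ℕ => 2 * (c / (n+1) * (d+1) * B) * |t - s|) atTop (𝓝 0) := by
    have := tendsto_one_div_add_atTop_nhds_zero_nat (𝕜 := ℝ)
    have := this.mul_const (2 * c * (d+1) * B * |t - s|)
    rw [zero_mul] at this
    refine this.congr fun n => ?_
    ring
  have := le_of_tendsto_of_tendsto' l1 l2 key
  have := norm_le_zero_iff.1 this
  exact sub_eq_zero.1 this

/-- virial momentum -/
def QP (U : ℝ × EuclideanSpace ℝ (Fin d) → ℂ) (t : ℝ) : ℝ :=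
  ∑ k, ∫ x, (4 * x k) * (cj (U (t, x)) * Dv (dx k) U (t, x)).im

lemma Sol.rI (h : Sol I U) {t} (ht : t ∈ I) (k : Fin d) :
    RD (fun x => (cj (U (t, x)) * Dv (dx k) U (t, x)).im) :=
  ((h.rd0 ht).cj.mul (h.rd1 ht k)).im

/-- cut-off virial weight -/
def aw (d n : ℕ) (k : Fin d) (x : EuclideanSpace ℝ (Fin d)) : ℝ := x k * (4 * cut d n x)

lemma aw_contDiff (n : ℕ) (k : Fin d) : ContDiff ℝ (⊤ : ℕ∞) (aw d n k) :=
  coord_contDiff (contDiff_const.mul (cut_contDiff d n)) k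

lemma aw_compact (n : ℕ) (k : Fin d) : HasCompactSupport (aw d n k) := by
  refine (cut_compact d n).mono fun x hx => ?_
  contrapose hx
  simp only [Function.mem_support, not_not] at hx ⊢
  simp [aw, hx]

lemma aw_pd (n : ℕ) (j k : Fin d) : pd j (aw d n k) = fun x =>
    (if j = k then 4 * cut d n x else 0) + x k * (4 * pd j (cut d n) x) := by
  funext x
  have := pd_coord_mul (contDiff_const.mul (cut_contDiff d n) : ContDiff ℝ (⊤ : ℕ∞) fun x => 4 * cut d n x) j k x
  rw [pd_const_mul (cut_contDiff d n)] at this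
  exact this

lemma aw_pd2 (n : ℕ) (j k : Fin d) (x) : pd j (pd k (aw d n k)) x =
    4 * pd j (cut d n) x + ((if j = k then 4 * pd k (cut d n) x else 0) + x k * (4 * pd j (pd k (cut d n)) x)) := by
  have h1 : ContDiff ℝ (⊤ : ℕ∞) fun x => 4 * cut d n x := contDiff_const.mul (cut_contDiff d n)
  have h2 : ContDiff ℝ (⊤ : ℕ∞) fun x => 4 * pd k (cut d n) x := contDiff_const.mul (pd_contDiff (cut_contDiff d n) k)
  rw [aw_pd]
  simp only [if_true]
  have e : pd j (fun x => 4 * cut d n x + x k * (4 * pd k (cut d n) x)) x =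
      pd j (fun x => 4 * cut d n x) x + pd j (fun x => x k * (4 * pd k (cut d n) x)) x := by
    unfold pd
    have : fderiv ℝ (fun x => 4 * cut d n x + x k * (4 * fderiv ℝ (cut d n) x (stdVec d k))) x = _ :=
      fderiv_add ((h1.differentiable (by simp)) x) (((coord_contDiff h2 k).differentiable (by simp)) x)
    rw [this]; rfl
  rw [e, pd_const_mul (cut_contDiff d n), pd_coord_mul h2, pd_const_mul (pd_contDiff (cut_contDiff d n) k)]

lemma aw_bounds (d : ℕ) : ∃ C : ℝ, 0 < C ∧ ∀ n : ℕ, ∀ j k : Fin d, ∀ x,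
    |pd j (aw d n k) x| ≤ C ∧ |pd j (pd k (aw d n k)) x| ≤ C := by
  obtain ⟨c, hc0, hc⟩ := cut_pd_bounds d
  refine ⟨4 + 12 * c, by positivity, fun n j k x => ?_⟩
  have hx := norm_nonneg x
  have hk := coord_le x k
  have small : ∀ y : ℝ, (1 + ‖x‖) * |y| ≤ c → |y| ≤ c ∧ |x k| * |y| ≤ c := by
    intro y hy
    have := abs_nonneg y
    constructor <;> nlinarith
  have b0 : |cut d n x| ≤ 1 := by rw [abs_of_nonneg (cut_nonneg d n x)]; exact cut_le_one d n x
  have b1 := small _ (hc n j x).2.1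
  have b1' := small _ (hc n k x).2.1
  have b2 := small _ ((hc n k x).2.2 j).2
  have if1 : |if j = k then 4 * cut d n x else 0| ≤ 4 := by
    split_ifs
    · rw [abs_mul, abs_of_pos (by norm_num : (0:ℝ) < 4)]; linarith
    · simp
  have if2 : |if j = k then 4 * pd k (cut d n) x else 0| ≤ 4 * c := by
    split_ifs
    · rw [abs_mul, abs_of_pos (by norm_num : (0:ℝ) < 4)]; linarith
    · simpa using hc0.le
  have four : |(4:ℝ)| = 4 := abs_of_pos (by norm_num)
  rw [aw_pd2, aw_pd]
  constructor
  · refine (abs_add_le _ _).trans ?_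
    rw [abs_mul (x k), abs_mul 4, four]
    nlinarith
  · refine (abs_add_le _ _).trans ((add_le_add_right (abs_add_le _ _) _).trans ?_)
    rw [abs_mul (x k), abs_mul 4, abs_mul 4, four]
    nlinarith

lemma aw_lim1 (j k : Fin d) (x) : Tendsto (fun n => pd j (aw d n k) x) atTop (𝓝 (if j = k then 4 else 0)) := by
  simp only [aw_pd]
  have h1 := ((cut_pd_tendsto d j x).const_mul 4).const_mul (x k)
  have h2 := (cut_tendsto d x).const_mul 4
  split_ifs
  · have := h2.add h1; simpa using this
  · have := h1.const_add 0; simpa using this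

lemma aw_lim2 (j k : Fin d) (x) : Tendsto (fun n => pd j (pd k (aw d n k)) x) atTop (𝓝 0) := by
  simp only [aw_pd2]
  have h1 := ((cut_pd2_tendsto d j k x).const_mul 4).const_mul (x k)
  have h2 := (cut_pd_tendsto d j x).const_mul 4
  have h3 := (cut_pd_tendsto d k x).const_mul 4
  split_ifs
  · have := h2.add (h3.add h1); simpa using this
  · have := h2.add (h1.const_add 0); simpa using this

/-- the momentum integrand -/
def mint (U : ℝ × EuclideanSpace ℝ (Fin d) → ℂ) (n : ℕ) (t : ℝ) (x : EuclideanSpace ℝ (Fin d)) : ℝ :=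
  ∑ k, (∑ j, (2 * pd j (aw d n k) x * (cj (Dv (dx j) U (t, x)) * Dv (dx k) U (t, x)).re
        + pd j (pd k (aw d n k)) x * (cj (U (t, x)) * Dv (dx j) U (t, x)).re)
        - (4/d) / (4/d + 2) * pd k (aw d n k) x * ‖U (t, x)‖ ^ ((4:ℝ)/d + 2))

lemma mint_bound (h : Sol I U) : ∃ C : ℝ, 0 < C ∧ ∀ n t x, |mint U n t x| ≤
    C * (‖U (t, x)‖ ^ 2 + ∑ k, ‖Dv (dx k) U (t, x)‖ ^ 2 + ‖U (t, x)‖ ^ ((4:ℝ)/d + 2)) := by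
  obtain ⟨C, hC0, hC⟩ := aw_bounds d
  have hp := h.rp
  have hd : (0:ℝ) < d := by exact_mod_cast h.hd
  refine ⟨d * (d * (3 * C) + C), by positivity, fun n t x => ?_⟩
  set S := ‖U (t, x)‖ ^ 2 + ∑ k, ‖Dv (dx k) U (t, x)‖ ^ 2 + ‖U (t, x)‖ ^ ((4:ℝ)/d + 2) with hS
  have n1 : 0 ≤ ‖U (t, x)‖ ^ 2 := by positivity
  have n3 : 0 ≤ ‖U (t, x)‖ ^ ((4:ℝ)/d + 2) := by positivity
  have n2 : 0 ≤ ∑ k, ‖Dv (dx k) U (t, x)‖ ^ 2 := Finset.sum_nonneg fun _ _ => by positivity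
  have s1 : ∀ k, ‖Dv (dx k) U (t, x)‖ ^ 2 ≤ ∑ k, ‖Dv (dx k) U (t, x)‖ ^ 2 := fun k =>
    Finset.single_le_sum (f := fun k => ‖Dv (dx k) U (t, x)‖ ^ 2) (fun _ _ => by positivity) (Finset.mem_univ k)
  have re_le : ∀ z w : ℂ, ‖z‖ ^ 2 ≤ S → ‖w‖ ^ 2 ≤ S → |(cj z * w).re| ≤ S := by
    intro z w hz hw
    refine (Complex.abs_re_le_norm _).trans ?_
    rw [norm_mul, RCLike.norm_conj]
    nlinarith [sq_nonneg (‖z‖ - ‖w‖)]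
  have f0 : ‖U (t, x)‖ ^ 2 ≤ S := by rw [hS]; linarith
  have fk : ∀ k, ‖Dv (dx k) U (t, x)‖ ^ 2 ≤ S := fun k => by rw [hS]; linarith [s1 k]
  have S0 : 0 ≤ S := n1.trans f0
  unfold mint
  refine (Finset.abs_sum_le_sum_abs _ _).trans ?_
  have : ∀ k ∈ (Finset.univ : Finset (Fin d)), |∑ j, (2 * pd j (aw d n k) x * (cj (Dv (dx j) U (t, x)) * Dv (dx k) U (t, x)).re
        + pd j (pd k (aw d n k)) x * (cj (U (t, x)) * Dv (dx j) U (t, x)).re)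
        - (4/d) / (4/d + 2) * pd k (aw d n k) x * ‖U (t, x)‖ ^ ((4:ℝ)/d + 2)| ≤ (d * (3 * C) + C) * S := by
    intro k _
    refine (abs_sub _ _).trans ?_
    have t1 : |∑ j, (2 * pd j (aw d n k) x * (cj (Dv (dx j) U (t, x)) * Dv (dx k) U (t, x)).re
        + pd j (pd k (aw d n k)) x * (cj (U (t, x)) * Dv (dx j) U (t, x)).re)| ≤ d * (3 * C * S) := by
      refine (Finset.abs_sum_le_sum_abs _ _).trans ?_
      refine (Finset.sum_le_card_nsmul _ _ (3 * C * S) fun j _ => ?_).trans (le_of_eq (by simp))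
      refine (abs_add_le _ _).trans ?_
      rw [abs_mul, abs_mul, abs_mul, abs_of_pos (by norm_num : (0:ℝ) < 2)]
      have h1 := mul_le_mul (hC n j k x).1 (re_le _ _ (fk j) (fk k)) (abs_nonneg _) hC0.le
      have h2 := mul_le_mul (hC n j k x).2 (re_le _ _ f0 (fk j)) (abs_nonneg _) hC0.le
      nlinarith
    have t2 : |(4/d) / (4/d + 2) * pd k (aw d n k) x * ‖U (t, x)‖ ^ ((4:ℝ)/d + 2)| ≤ C * S := by
      rw [abs_mul, abs_mul, abs_of_nonneg n3]
      have q1 : |(4:ℝ)/d / (4/d + 2)| ≤ 1 := by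
        rw [abs_of_nonneg (by positivity), div_le_one (by positivity)]; linarith
      have q2 : |(4:ℝ)/d / (4/d + 2)| * |pd k (aw d n k) x| ≤ 1 * C :=
        mul_le_mul q1 (hC n k k x).1 (abs_nonneg _) (by norm_num)
      rw [one_mul] at q2
      have q3 : ‖U (t, x)‖ ^ ((4:ℝ)/d + 2) ≤ S := by rw [hS]; linarith
      exact mul_le_mul q2 q3 n3 hC0.le
    linarith
  refine (Finset.sum_le_card_nsmul _ _ _ this).trans (le_of_eq ?_)
  simp
  ring

lemma mint_lim (h : Sol I U) (t x) : Tendsto (fun n => mint U n t x) atTop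
    (𝓝 (8 * (∑ k, ‖Dv (dx k) U (t, x)‖ ^ 2) - 16 * (1 / (4/d+2)) * ‖U (t, x)‖ ^ ((4:ℝ)/d + 2))) := by
  have e : 8 * (∑ k, ‖Dv (dx k) U (t, x)‖ ^ 2) - 16 * (1 / (4/d+2)) * ‖U (t, x)‖ ^ ((4:ℝ)/d + 2) =
    ∑ k : Fin d, (∑ j : Fin d, (2 * (if j = k then 4 else 0) * (cj (Dv (dx j) U (t, x)) * Dv (dx k) U (t, x)).re
        + 0 * (cj (U (t, x)) * Dv (dx j) U (t, x)).re)
        - (4/d) / (4/d + 2) * (if k = k then 4 else 0) * ‖U (t, x)‖ ^ ((4:ℝ)/d + 2)) := by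
    have hd : (d:ℝ) ≠ 0 := by exact_mod_cast h.hd.ne'
    rw [Finset.sum_sub_distrib]
    congr 1
    · rw [Finset.mul_sum]
      refine Finset.sum_congr rfl fun k _ => ?_
      have : ∀ j : Fin d, (2 * (if j = k then (4:ℝ) else 0) * (cj (Dv (dx j) U (t, x)) * Dv (dx k) U (t, x)).re
        + 0 * (cj (U (t, x)) * Dv (dx j) U (t, x)).re) =
          if j = k then 8 * ‖Dv (dx k) U (t, x)‖ ^ 2 else 0 := by
        intro j
        split_ifs with hj
        · subst hj
          rw [← Complex.normSq_eq_norm_sq, Complex.normSq_apply]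
          simp only [Complex.mul_re, Complex.conj_re, Complex.conj_im]
          ring
        · ring
      simp only [this]
      simp
    · simp only [if_true, Finset.sum_const, Finset.card_univ, Fintype.card_fin, nsmul_eq_mul]
      generalize ‖U (t, x)‖ ^ ((4:ℝ)/d + 2) = y
      field_simp
      ring
  rw [e]
  unfold mint
  refine tendsto_finset_sum _ fun k _ => Tendsto.sub (tendsto_finset_sum _ fun j _ => ?_) ?_
  · exact (((aw_lim1 j k x).const_mul 2).mul_const _).add ((aw_lim2 j k x).mul_const _)
  · exact (((aw_lim1 k k x).const_mul _).mul_const _)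

lemma mom_affine (h : Sol I U) {a b B e : ℝ} (hI : Icc a b ⊆ I) (hB : ∀ t ∈ Icc a b, QA U t ≤ B)
    (hab : a ≤ b) (hE : ∀ t ∈ Icc a b, QE U t = e) : QP U b - QP U a = 16 * e * (b - a) := by
  obtain ⟨C, hC0, hC⟩ := mint_bound h
  have rS : ∀ s ∈ I, Integrable (fun x => C * (‖U (s, x)‖ ^ 2 + ∑ k, ‖Dv (dx k) U (s, x)‖ ^ 2
      + ‖U (s, x)‖ ^ ((4:ℝ)/d + 2))) := fun s hs =>
    RD.integrable ((((h.rM hs).add (h.rK hs)).add (h.rX hs)).const_mul C)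
  have := lim0 (C := C * B) hab (h := fun n s => ∑ k, ∫ x, aw d n k x * (cj (U (s, x)) * Dv (dx k) U (s, x)).im)
    (h' := fun n s => ∫ x, mint U n s x) (H := QP U) (L := fun _ => 16 * e)
    (fun n s hs => momentum_deriv h (aw_contDiff n) (aw_compact n) (hI hs))
    (by
      intro n s hs
      change ‖∫ x, mint U n s x‖ ≤ _
      refine (norm_integral_le_of_norm_le (rS s (hI hs)) (ae_of_all _ fun x => hC n s x)).trans ?_
      rw [integral_const_mul]
      gcongr
      refine le_trans (le_of_eq ?_) ((?_ : QM U s + QK U s + QX U s ≤ QA U s).trans (hB s hs))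
      · rw [integral_add ((h.rM (hI hs)).add (h.rK (hI hs))).integrable (h.rX (hI hs)).integrable,
          integral_add (h.rM (hI hs)).integrable (h.rK (hI hs)).integrable]
        rfl
      · have := QV_nonneg (U := U) s
        unfold QA; linarith)
    (by
      intro s hs
      have e1 : 16 * e = ∫ x, (8 * (∑ k, ‖Dv (dx k) U (s, x)‖ ^ 2) - 16 * (1 / (4/d+2)) * ‖U (s, x)‖ ^ ((4:ℝ)/d + 2)) := by
        rw [integral_sub ((h.rK (hI hs)).integrable.const_mul _) ((h.rX (hI hs)).integrable.const_mul _),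
          integral_const_mul, integral_const_mul, ← hE s hs]
        unfold QE QK QX
        ring
      rw [e1]
      refine tendsto_integral_of_dominated_convergence _ (fun n => ?_) (rS s (hI hs))
        (fun n => ae_of_all _ fun x => hC n s x) (ae_of_all _ fun x => mint_lim h s x)
      have r0 := (h.rd0 (hI hs)).1
      have r1 := fun k => (h.rd1 (hI hs) k).1
      have rX := (h.rX (hI hs)).1
      refine Continuous.aestronglyMeasurable ?_
      unfold mint
      refine continuous_finset_sum _ fun k _ => Continuous.sub (continuous_finset_sum _ fun j _ => ?_) ?_
      · exact ((continuous_const.mul (pd_contDiff (aw_contDiff n k) j).continuous).mul (cont_re (r1 j) (r1 k))).add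
          ((pd_contDiff (pd_contDiff (aw_contDiff n k) k) j).continuous.mul (cont_re r0 (r1 j)))
      · exact (continuous_const.mul (pd_contDiff (aw_contDiff n k) k).continuous).mul rX)
    (by
      intro s hs
      refine tendsto_finset_sum _ fun k _ => ?_
      refine (h.rI (hI hs) k).tendsto (fun n => (aw_contDiff n k).continuous) 1 4 (fun n x => ?_) (fun x => ?_)
      · unfold aw
        rw [abs_mul, abs_of_nonneg (show 0 ≤ 4 * cut d n x by have := cut_nonneg d n x; positivity)]
        have := coord_le x k
        have := cut_le_one d n x
        have := cut_nonneg d n x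
        have := norm_nonneg x
        have := abs_nonneg (x k)
        nlinarith
      · unfold aw
        have := ((cut_tendsto d x).const_mul 4).const_mul (x k)
        rw [mul_one, mul_comm] at this
        exact this)
  rw [this]
  simp
  ring

end
end
end

section
open MeasureTheory Set Filter Topology SchwartzMap FourierTransform
open scoped ENNReal NNReal

noncomputable section

set_option linter.unusedSectionVars false

section
variable {d : ℕ}

local notation "cj" => starRingEnd ℂ

variable {I : Set ℝ} {U : ℝ × EuclideanSpace ℝ (Fin d) → ℂ}

lemma im_le_mul (z w : ℂ) : ‖(cj z * w).im‖ ≤ ‖z‖ * ‖w‖ := by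
  refine (Complex.abs_im_le_norm _).trans (le_of_eq ?_)
  rw [norm_mul, RCLike.norm_conj]

lemma im_self_zero (z : ℂ) (p : ℝ) : (cj z * (((‖z‖ ^ p : ℝ) : ℂ) * z)).im = 0 := by
  simp only [Complex.mul_im, Complex.mul_re, Complex.conj_re, Complex.conj_im, Complex.ofReal_re,
    Complex.ofReal_im]
  ring

/-- cut-off variance weight -/
def vw (d n : ℕ) (x : EuclideanSpace ℝ (Fin d)) : ℝ := ‖x‖ ^ 2 * cut d n x

lemma vw_contDiff (n : ℕ) : ContDiff ℝ (⊤ : ℕ∞) (vw d n) :=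
  (contDiff_norm_sq ℝ).mul (cut_contDiff d n)

lemma vw_compact (n : ℕ) : HasCompactSupport (vw d n) := by
  refine (cut_compact d n).mono fun x hx => ?_
  contrapose hx
  simp only [Function.mem_support, not_not] at hx ⊢
  simp [vw, hx]

lemma vw_pd (n : ℕ) (k : Fin d) (x) : pd k (vw d n) x = 2 * x k * cut d n x + ‖x‖ ^ 2 * pd k (cut d n) x :=
  pd_normsq_mul (cut_contDiff d n) k x

lemma vw_bounds (d : ℕ) : ∃ C : ℝ, 0 < C ∧ ∀ n : ℕ, ∀ k : Fin d, ∀ x, |pd k (vw d n) x| ≤ C * ‖x‖ := by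
  obtain ⟨c, hc0, hc⟩ := cut_pd_bounds d
  refine ⟨2 + c, by positivity, fun n k x => ?_⟩
  rw [vw_pd]
  have h1 := (hc n k x).2.1
  have h2 := coord_le x k
  have h3 := cut_nonneg d n x
  have h4 := cut_le_one d n x
  have h5 := norm_nonneg x
  calc _ ≤ |2 * x k * cut d n x| + |‖x‖ ^ 2 * pd k (cut d n) x| := abs_add_le _ _
    _ = 2 * (|x k| * cut d n x) + ‖x‖ * (‖x‖ * |pd k (cut d n) x|) := by
        rw [abs_mul, abs_mul, abs_mul, abs_of_nonneg h3, abs_of_nonneg (by positivity : 0 ≤ ‖x‖ ^ 2)]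
        norm_num; ring
    _ ≤ 2 * (‖x‖ * 1) + ‖x‖ * c := by
        gcongr
        refine le_trans ?_ h1
        gcongr
        linarith
    _ = _ := by ring

lemma var_int (h : Sol I U) {a b B : ℝ} (hI : Icc a b ⊆ I) (hB : ∀ t ∈ Icc a b, QA U t ≤ B)
    (hab : a ≤ b) : QV U b - QV U a = ∫ s in a..b, QP U s := by
  obtain ⟨C, hC0, hC⟩ := vw_bounds d
  refine lim0 (C := 2 * (C * (d+1) * B)) hab (h := fun n s => ∫ x, vw d n x * ‖U (s, x)‖ ^ 2)
    (h' := fun n s => 2 * (∫ x, ∑ k, pd k (vw d n) x * (cj (U (s, x)) * Dv (dx k) U (s, x)).im)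
        - 2 * ∫ x, vw d n x * (cj (U (s, x)) * (((‖U (s, x)‖ ^ ((4:ℝ)/d) : ℝ) : ℂ) * U (s, x))).im)
    (fun n s hs => mass_deriv h.se (vw_contDiff n) (vw_compact n) (hI hs)) ?_ ?_ ?_
  · intro n s hs
    simp only [im_self_zero, mul_zero, integral_zero, sub_zero]
    rw [abs_mul, abs_two]
    gcongr
    have := sum_bound (T := fun k x => pd k (vw d n) x * (cj (U (s, x)) * Dv (dx k) U (s, x)).im)
      (f := fun x => (‖x‖ : ℂ) * U (s, x)) (F := fun k x => Dv (dx k) U (s, x)) (c := C) hC0.le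
      ((h.rd0 (hI hs)).mul_bdd (by fun_prop) 1 1 (fun x => by simp)) (h.rd1 (hI hs)) (by
        intro k x
        rw [norm_mul, norm_mul, Complex.norm_real, norm_norm]
        calc _ ≤ (C * ‖x‖) * (‖U (s, x)‖ * ‖Dv (dx k) U (s, x)‖) := by
              gcongr
              · exact hC n k x
              · exact im_le_mul _ _
          _ = _ := by ring)
    refine this.trans ?_
    gcongr
    refine le_trans ?_ (hB s hs)
    have := QM_nonneg (U := U) s; have := QX_nonneg (U := U) s
    have e : (∫ x : EuclideanSpace ℝ (Fin d), ‖(‖x‖ : ℂ) * U (s, x)‖ ^ 2) = QV U s := by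
      unfold QV
      congr 1; funext x
      rw [norm_mul, Complex.norm_real, norm_norm, mul_pow]
    rw [e]
    change QV U s + QK U s ≤ _
    unfold QA; linarith
  · intro s hs
    simp only [im_self_zero, mul_zero, integral_zero, sub_zero]
    have r := fun k => h.rI (hI hs) k
    have e1 : QP U s = 2 * ∑ k, ∫ x, (2 * x k) * (cj (U (s, x)) * Dv (dx k) U (s, x)).im := by
      unfold QP
      rw [Finset.mul_sum]
      refine Finset.sum_congr rfl fun k _ => ?_
      rw [← integral_const_mul]
      congr 1; funext x; ring
    rw [e1]
    refine Tendsto.const_mul 2 ?_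
    have e2 : ∀ n, (∫ x, ∑ k, pd k (vw d n) x * (cj (U (s, x)) * Dv (dx k) U (s, x)).im) =
        ∑ k, ∫ x, pd k (vw d n) x * (cj (U (s, x)) * Dv (dx k) U (s, x)).im := by
      intro n
      refine integral_finset_sum _ fun k _ => ?_
      exact ((r k).mul_bdd (pd_contDiff (vw_contDiff n) k).continuous 1 C
        (fun x => (hC n k x).trans (by rw [pow_one]; gcongr; linarith))).integrable
    simp only [e2]
    refine tendsto_finset_sum _ fun k _ => ?_
    refine (r k).tendsto (fun n => (pd_contDiff (vw_contDiff n) k).continuous) 1 C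
      (fun n x => (hC n k x).trans (by rw [pow_one]; gcongr; linarith)) (fun x => ?_)
    simp only [vw_pd]
    have := ((cut_tendsto d x).const_mul (2 * x k)).add ((cut_pd_tendsto d k x).const_mul (‖x‖ ^ 2))
    simpa using this
  · intro s hs
    have := (h.rM (hI hs)).tendsto (a := fun n => vw d n) (b := fun x => ‖x‖ ^ 2)
      (fun n => (vw_contDiff n).continuous) 2 1
      (fun n x => by
        unfold vw
        have h3 := cut_nonneg d n x
        have h4 := cut_le_one d n x
        rw [abs_of_nonneg (by positivity), one_mul]
        calc _ ≤ ‖x‖ ^ 2 * 1 := by gcongr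
          _ ≤ _ := by rw [mul_one]; gcongr; linarith)
      (fun x => by simpa [vw] using (cut_tendsto d x).const_mul (‖x‖ ^ 2))
    exact this

/-- variance is quadratic under constant energy -/
lemma var_quad (h : Sol I U) {a b B e : ℝ} (hI : Icc a b ⊆ I) (hB : ∀ t ∈ Icc a b, QA U t ≤ B)
    (hE : ∀ t ∈ Icc a b, QE U t = e) {s t : ℝ} (hs : s ∈ Icc a b) (ht : t ∈ Icc a b) :
    QV U t = QV U s + QP U s * (t - s) + 8 * e * (t - s) ^ 2 := by
  have hab : a ≤ b := hs.1.trans hs.2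
  have hP : ∀ r ∈ Icc a b, QP U r = QP U a + 16 * e * (r - a) := by
    intro r hr
    have sub : Icc a r ⊆ Icc a b := Icc_subset_Icc_right hr.2
    have := mom_affine h (sub.trans hI) (fun t ht => hB t (sub ht)) hr.1 (fun t ht => hE t (sub ht))
    linarith
  have hV : ∀ r ∈ Icc a b, QV U r = QV U a + QP U a * (r - a) + 8 * e * (r - a) ^ 2 := by
    intro r hr
    have sub : Icc a r ⊆ Icc a b := Icc_subset_Icc_right hr.2
    have := var_int h (sub.trans hI) (fun t ht => hB t (sub ht)) hr.1
    rw [intervalIntegral.integral_congr (g := fun s => QP U a + 16 * e * (s - a))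
      (fun s hs => hP s (sub (by rwa [uIcc_of_le hr.1] at hs)))] at this
    have d1 : ∀ s ∈ uIcc a r, HasDerivAt (fun s => QP U a * (s - a) + 8 * e * (s - a) ^ 2)
        (QP U a + 16 * e * (s - a)) s := by
      intro s _
      have h0 := (hasDerivAt_id s).sub_const a
      refine ((h0.const_mul (QP U a)).add ((h0.pow 2).const_mul (8 * e))).congr_deriv ?_
      simp; ring
    rw [intervalIntegral.integral_eq_sub_of_hasDerivAt d1 (by
      apply Continuous.intervalIntegrable; fun_prop)] at this
    simp at this
    linarith
  rw [hV t ht, hV s hs, hP s hs]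
  ring

end
end
end

section
open MeasureTheory Set Filter Topology SchwartzMap FourierTransform
open scoped ENNReal NNReal

noncomputable section

set_option linter.unusedSectionVars false

section
variable {d : ℕ}

local notation "cj" => starRingEnd ℂ

/-- real-valued Lebesgue norm -/
def nr {V : Type*} [NormedAddCommGroup V] (r : ℝ) (f : EuclideanSpace ℝ (Fin d) → V) : ℝ :=
  (∫ x, ‖f x‖ ^ r) ^ (1 / r)

variable {V : Type*} [NormedAddCommGroup V]

lemma ir_nonneg (r : ℝ) (f : EuclideanSpace ℝ (Fin d) → V) : 0 ≤ ∫ x, ‖f x‖ ^ r :=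
  integral_nonneg fun x => by positivity

lemma nr_nonneg (r : ℝ) (f : EuclideanSpace ℝ (Fin d) → V) : 0 ≤ nr r f :=
  Real.rpow_nonneg (ir_nonneg r f) _

lemma nr_pow {r : ℝ} (hr : 0 < r) (f : EuclideanSpace ℝ (Fin d) → V) : nr r f ^ r = ∫ x, ‖f x‖ ^ r := by
  unfold nr
  rw [← Real.rpow_mul (ir_nonneg r f), one_div_mul_cancel hr.ne', Real.rpow_one]

lemma nr_le_of_pow {r : ℝ} (hr : 0 < r) (f : EuclideanSpace ℝ (Fin d) → V) {c : ℝ} (hc : 0 ≤ c)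
    (h : ∫ x, ‖f x‖ ^ r ≤ c ^ r) : nr r f ≤ c := by
  unfold nr
  calc _ ≤ (c ^ r) ^ (1/r) := Real.rpow_le_rpow (ir_nonneg r f) h (by positivity)
    _ = c := by rw [← Real.rpow_mul hc, mul_one_div_cancel hr.ne', Real.rpow_one]

lemma lint_rpow' {f : EuclideanSpace ℝ (Fin d) → V} (hf : RD f) {r : ℝ} (hr : 1 ≤ r) :
    ∫⁻ x, ENNReal.ofReal (‖f x‖ ^ r) = ENNReal.ofReal (∫ x, ‖f x‖ ^ r) :=
  (ofReal_integral_eq_lintegral_ofReal (hf.rpow hr).integrable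
    (ae_of_all _ fun x => by positivity)).symm

lemma ofReal_rr {a r s : ℝ} (ha : 0 ≤ a) (hs : 0 ≤ s) :
    ENNReal.ofReal (a ^ r) ^ s = ENNReal.ofReal (a ^ (r * s)) := by
  rw [ENNReal.ofReal_rpow_of_nonneg (by positivity) hs, ← Real.rpow_mul ha]

lemma holder3 {f g h : EuclideanSpace ℝ (Fin d) → ℂ} (hf : RD f) (hg : RD g) (hh : RD h)
    {p r : ℝ} (hp : 0 < p) (hr : r = p + 2) :
    ∫ x, ‖f x‖ ^ p * (‖g x‖ * ‖h x‖) ≤ nr r f ^ p * (nr r g * nr r h) := by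
  have hr0 : 0 < r := by linarith
  have hr1 : 1 ≤ r := by linarith
  have key := ENNReal.lintegral_prod_norm_pow_le (μ := (volume : Measure (EuclideanSpace ℝ (Fin d))))
    (Finset.univ : Finset (Fin 3))
    (f := ![fun x => ENNReal.ofReal (‖f x‖ ^ r), fun x => ENNReal.ofReal (‖g x‖ ^ r), fun x => ENNReal.ofReal (‖h x‖ ^ r)])
    (p := ![p/r, 1/r, 1/r]) (by
      intro i _
      fin_cases i
      · exact (hf.rpow hr1).1.measurable.ennreal_ofReal.aemeasurable
      · exact (hg.rpow hr1).1.measurable.ennreal_ofReal.aemeasurable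
      · exact (hh.rpow hr1).1.measurable.ennreal_ofReal.aemeasurable)
    (by simp [Fin.sum_univ_three]; field_simp; linarith)
    (by intro i _; fin_cases i <;> simp <;> positivity)
  simp only [Fin.prod_univ_three, Matrix.cons_val_zero, Matrix.cons_val_one, Matrix.cons_val] at key
  rw [lint_rpow' hf hr1, lint_rpow' hg hr1, lint_rpow' hh hr1] at key
  have e : ∀ x, ENNReal.ofReal (‖f x‖ ^ r) ^ (p/r) * ENNReal.ofReal (‖g x‖ ^ r) ^ (1/r) *
      ENNReal.ofReal (‖h x‖ ^ r) ^ (1/r) = ENNReal.ofReal (‖f x‖ ^ p * (‖g x‖ * ‖h x‖)) := by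
    intro x
    rw [ofReal_rr (norm_nonneg _) (by positivity), ofReal_rr (norm_nonneg _) (by positivity),
      ofReal_rr (norm_nonneg _) (by positivity), mul_div_cancel₀ p hr0.ne', mul_one_div_cancel hr0.ne',
      Real.rpow_one, Real.rpow_one, ← ENNReal.ofReal_mul (by positivity), ← ENNReal.ofReal_mul (by positivity),
      mul_assoc]
  simp only [e] at key
  rw [ENNReal.ofReal_rpow_of_nonneg (ir_nonneg r f) (by positivity),
    ENNReal.ofReal_rpow_of_nonneg (ir_nonneg r g) (by positivity),
    ENNReal.ofReal_rpow_of_nonneg (ir_nonneg r h) (by positivity),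
    ← ENNReal.ofReal_mul (Real.rpow_nonneg (ir_nonneg r f) _),
    ← ENNReal.ofReal_mul (mul_nonneg (Real.rpow_nonneg (ir_nonneg r f) _) (Real.rpow_nonneg (ir_nonneg r g) _))] at key
  rw [integral_eq_lintegral_of_nonneg_ae (ae_of_all _ fun x => by positivity) (by
    refine Continuous.aestronglyMeasurable ?_
    exact (hf.1.norm.rpow_const fun x => Or.inr hp.le).mul (hg.1.norm.mul hh.1.norm))]
  refine ENNReal.toReal_le_of_le_ofReal ?_ (key.trans (le_of_eq ?_))
  · have := nr_nonneg r f; have := nr_nonneg r g; have := nr_nonneg r h; positivity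
  · congr 1
    unfold nr
    rw [← Real.rpow_mul (ir_nonneg r f), one_div_mul_eq_div, mul_assoc]

lemma holder2 {f g : EuclideanSpace ℝ (Fin d) → ℂ} (hf : RD f) (hg : RD g)
    {r q : ℝ} (hr : 2 < r) (hq : q = r / (r - 1)) :
    ∫ x, ‖f x‖ * ‖g x‖ ≤ nr q f * nr r g := by
  have hr0 : 0 < r := by linarith
  have hr1 : 1 ≤ r := by linarith
  have hq1 : 1 ≤ q := by rw [hq, le_div_iff₀] <;> linarith
  have hq0 : 0 < q := by linarith
  have key := ENNReal.lintegral_prod_norm_pow_le (μ := (volume : Measure (EuclideanSpace ℝ (Fin d))))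
    (Finset.univ : Finset (Fin 2))
    (f := ![fun x => ENNReal.ofReal (‖f x‖ ^ q), fun x => ENNReal.ofReal (‖g x‖ ^ r)])
    (p := ![1/q, 1/r]) (by
      intro i _
      fin_cases i
      · exact (hf.rpow hq1).1.measurable.ennreal_ofReal.aemeasurable
      · exact (hg.rpow hr1).1.measurable.ennreal_ofReal.aemeasurable)
    (by simp [Fin.sum_univ_two]; rw [hq]; have : r - 1 ≠ 0 := by linarith
        field_simp; ring)
    (by intro i _; fin_cases i <;> simp <;> positivity)
  simp only [Fin.prod_univ_two, Matrix.cons_val_zero, Matrix.cons_val_one] at key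
  rw [lint_rpow' hf hq1, lint_rpow' hg hr1] at key
  have e : ∀ x, ENNReal.ofReal (‖f x‖ ^ q) ^ (1/q) * ENNReal.ofReal (‖g x‖ ^ r) ^ (1/r) =
      ENNReal.ofReal (‖f x‖ * ‖g x‖) := by
    intro x
    rw [ofReal_rr (norm_nonneg _) (by positivity), ofReal_rr (norm_nonneg _) (by positivity),
      mul_one_div_cancel hr0.ne', mul_one_div_cancel hq0.ne',
      Real.rpow_one, Real.rpow_one, ← ENNReal.ofReal_mul (by positivity)]
  simp only [e] at key
  rw [ENNReal.ofReal_rpow_of_nonneg (ir_nonneg q f) (by positivity),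
    ENNReal.ofReal_rpow_of_nonneg (ir_nonneg r g) (by positivity),
    ← ENNReal.ofReal_mul (Real.rpow_nonneg (ir_nonneg q f) _)] at key
  rw [integral_eq_lintegral_of_nonneg_ae (ae_of_all _ fun x => by positivity) (by
    refine Continuous.aestronglyMeasurable ?_
    exact (hf.1.norm.mul hg.1.norm))]
  refine ENNReal.toReal_le_of_le_ofReal ?_ key
  have := nr_nonneg r g; have := nr_nonneg q f; positivity

/-- the difference of the nonlinearities -/
lemma nonlin_aux {x y p : ℝ} (hy : 0 ≤ y) (hyx : y ≤ x) (hp : 0 < p) (hp4 : p ≤ 4) :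
    (x ^ p - y ^ p) * y ≤ 4 * x ^ p * (x - y) := by
  rcases eq_or_lt_of_le (hy.trans hyx) with hx | hx
  · have : y = 0 := le_antisymm (by linarith) hy
    subst this; rw [← hx]; simp
  rcases eq_or_lt_of_le hy with hy0 | hy0
  · rw [← hy0]; have : 0 ≤ x ^ p := by positivity
    simp; positivity
  set θ := y / x with hθ
  have ey : y = θ * x := by rw [hθ]; field_simp
  have t0 : 0 < θ := by positivity
  have t1 : θ ≤ 1 := by rw [hθ, div_le_one hx]; exact hyx
  have hpow : θ ^ 4 ≤ θ ^ p := by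
    have := Real.rpow_le_rpow_of_exponent_ge t0 t1 hp4
    simpa using this
  rw [ey, Real.mul_rpow t0.le hx.le]
  have hX : 0 < x ^ p := by positivity
  have h1 : 1 - θ ^ p ≤ 4 * (1 - θ) := by
    nlinarith [sq_nonneg (θ - 1), sq_nonneg (θ^2 - 1), mul_nonneg t0.le (sq_nonneg (θ - 1))]
  have h2 : (1 - θ ^ p) * θ ≤ 4 * (1 - θ) := by
    have : (1 - θ ^ p) * θ ≤ (4 * (1 - θ)) * θ := by gcongr
    nlinarith
  have : x ^ p * x * ((1 - θ ^ p) * θ) ≤ x ^ p * x * (4 * (1 - θ)) := by gcongr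
  nlinarith

lemma nonlin_lip {p : ℝ} (hp : 0 < p) (hp4 : p ≤ 4) (a b : ℂ) :
    ‖((‖a‖ ^ p : ℝ) : ℂ) * a - ((‖b‖ ^ p : ℝ) : ℂ) * b‖ ≤ 5 * ((‖a‖ ^ p + ‖b‖ ^ p) * ‖a - b‖) := by
  wlog hab : ‖b‖ ≤ ‖a‖ generalizing a b
  · have := this b a (le_of_not_ge hab)
    rw [norm_sub_rev, norm_sub_rev a b, add_comm (‖a‖ ^ p)]
    exact this
  have e : ((‖a‖ ^ p : ℝ) : ℂ) * a - ((‖b‖ ^ p : ℝ) : ℂ) * b =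
      ((‖a‖ ^ p : ℝ) : ℂ) * (a - b) + ((‖a‖ ^ p - ‖b‖ ^ p : ℝ) : ℂ) * b := by push_cast; ring
  rw [e]
  have hA : 0 ≤ ‖a‖ ^ p := by positivity
  have hB : 0 ≤ ‖b‖ ^ p := by positivity
  have hle : ‖b‖ ^ p ≤ ‖a‖ ^ p := Real.rpow_le_rpow (norm_nonneg _) hab hp.le
  refine (norm_add_le _ _).trans ?_
  rw [norm_mul, norm_mul, Complex.norm_real, Complex.norm_real, Real.norm_of_nonneg hA,
    Real.norm_of_nonneg (by linarith)]
  have h1 := nonlin_aux (norm_nonneg b) hab hp hp4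
  have h2 : ‖a‖ - ‖b‖ ≤ ‖a - b‖ := norm_sub_norm_le a b
  have h3 : 4 * ‖a‖ ^ p * (‖a‖ - ‖b‖) ≤ 4 * ‖a‖ ^ p * ‖a - b‖ := by gcongr
  have h4 : 0 ≤ ‖b‖ ^ p * ‖a - b‖ := by positivity
  linarith

/-- dispersive estimate -/
lemma disp {r q : ℝ} (hr : 2 < r) (hq : q = r / (r - 1)) (f : 𝓢(EuclideanSpace ℝ (Fin d), ℂ))
    (hf : HasCompactSupport f) :
    ∀ s : ℝ, s ≠ 0 → nr r (schEvol s f) ≤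
      ((4 * r / (r - 2) * 2 ^ (r - q)) ^ (1/r) * (4 * Real.pi) ^ (-(d:ℝ)/2 * (r-2) / r)) *
        |s| ^ (-(d:ℝ)/2 * (r-2) / r) * nr q f := by
  intro s hs
  have hr0 : 0 < r := by linarith
  have hr2 : 0 < r - 2 := by linarith
  have hr1 : 0 < r - 1 := by linarith
  have hq0 : 0 < q := by rw [hq]; positivity
  have key := schEvol_lr s hs r q hr hq f hf
  have hpi := Real.pi_pos
  have hs0 : 0 < |s| := abs_pos.2 hs
  rw [lint_rpow' (RD.schwartz _) (by linarith), ENNReal.ofReal_le_ofReal_iff (by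
    have := ir_nonneg q f; positivity), finrank_euclideanSpace, Fintype.card_fin] at key
  have n1 := nr_nonneg q f
  refine nr_le_of_pow hr0 _ (by positivity) (key.trans (le_of_eq ?_))
  have g : ∀ X : ℝ, 0 ≤ X → ∀ y : ℝ, (X ^ (y / r)) ^ r = X ^ y := fun X hX y => by
    rw [← Real.rpow_mul hX, div_mul_cancel₀ _ hr0.ne']
  have e1 : ((4 * Real.pi * |s|) ^ (-(d:ℝ) / 2)) ^ (r - 2) =
      (4 * Real.pi) ^ (-(d:ℝ) / 2 * (r-2)) * |s| ^ (-(d:ℝ) / 2 * (r-2)) := by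
    rw [← Real.rpow_mul (by positivity), Real.mul_rpow (by positivity) (by positivity)]
  have g3 : ∀ X Y Z W : ℝ, 0 ≤ X → 0 ≤ Y → 0 ≤ Z → 0 ≤ W → (X * Y * Z * W) ^ r = X ^ r * Y ^ r * Z ^ r * W ^ r := by
    intro X Y Z W hX hY hZ hW
    rw [Real.mul_rpow (by positivity) hW, Real.mul_rpow (by positivity) hZ, Real.mul_rpow hX hY]
  rw [e1, g3 _ _ _ _ (by positivity) (by positivity) (by positivity) n1, g _ (by positivity), g _ (by positivity),
    g _ (by positivity), Real.rpow_one, ← mul_assoc (_ * _) (_ ^ _) (_ ^ _)]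
  congr 1
  unfold nr
  rw [← Real.rpow_mul (ir_nonneg q f)]
  congr 1
  rw [hq]; field_simp

/-- functions controlled by the standard weight -/
lemma nr_weight {w : EuclideanSpace ℝ (Fin d) → ℂ} (hw : RD w) {ρ c : ℝ} (hρ : 1 ≤ ρ) (hc : 0 ≤ c)
    (h : ∀ x, (1 + ‖x‖) ^ (d+1) * ‖w x‖ ≤ c) :
    ∫ x, ‖w x‖ ^ ρ ≤ c ^ ρ * ∫ x : EuclideanSpace ℝ (Fin d), ((1 + ‖x‖) ^ (d+1))⁻¹ := by
  rw [← integral_const_mul]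
  refine integral_mono (hw.rpow hρ).integrable ((integrable_jap (d+1) (by omega)).const_mul _) fun x => ?_
  have h1 : 1 ≤ (1 + ‖x‖) ^ (d+1) := one_le_pow₀ (by have := norm_nonneg x; linarith)
  have h0 : 0 < (1 + ‖x‖) ^ (d+1) := by linarith
  have h2 : ‖w x‖ ≤ c * ((1 + ‖x‖) ^ (d+1))⁻¹ := by
    rw [← div_eq_mul_inv, le_div_iff₀ h0, mul_comm]; exact h x
  calc ‖w x‖ ^ ρ ≤ (c * ((1 + ‖x‖) ^ (d+1))⁻¹) ^ ρ := Real.rpow_le_rpow (norm_nonneg _) h2 (by linarith)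
    _ = c ^ ρ * (((1 + ‖x‖) ^ (d+1))⁻¹) ^ ρ := Real.mul_rpow hc (by positivity)
    _ ≤ c ^ ρ * (((1 + ‖x‖) ^ (d+1))⁻¹) ^ (1:ℝ) := by
        gcongr ?_ * ?_
        exact Real.rpow_le_rpow_of_exponent_ge (by positivity) (inv_le_one_of_one_le₀ h1) hρ
    _ = _ := by rw [Real.rpow_one]

lemma ir_sub {f g : EuclideanSpace ℝ (Fin d) → ℂ} (hf : RD f) (hg : RD g) {r : ℝ} (hr : 1 ≤ r) :
    ∫ x, ‖f x - g x‖ ^ r ≤ 2 ^ r * ((∫ x, ‖f x‖ ^ r) + ∫ x, ‖g x‖ ^ r) := by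
  rw [← integral_add (hf.rpow hr).integrable (hg.rpow hr).integrable, ← integral_const_mul]
  refine integral_mono ((hf.sub hg).rpow hr).integrable (((hf.rpow hr).add (hg.rpow hr)).integrable.const_mul _) fun x => ?_
  have h0 : 0 ≤ r := by linarith
  have a1 : 0 ≤ ‖f x‖ ^ r := by positivity
  have a2 : 0 ≤ ‖g x‖ ^ r := by positivity
  calc ‖f x - g x‖ ^ r ≤ (2 * max ‖f x‖ ‖g x‖) ^ r := by
        refine Real.rpow_le_rpow (norm_nonneg _) ((norm_sub_le _ _).trans ?_) h0
        have := le_max_left ‖f x‖ ‖g x‖; have := le_max_right ‖f x‖ ‖g x‖; linarith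
    _ = 2 ^ r * (max ‖f x‖ ‖g x‖) ^ r := Real.mul_rpow (by norm_num) (by positivity)
    _ ≤ _ := by
        gcongr
        rcases max_choice ‖f x‖ ‖g x‖ with h | h <;> rw [h] <;> linarith

end
end
end

section
open MeasureTheory Set Filter Topology SchwartzMap FourierTransform
open scoped ENNReal NNReal

noncomputable section

set_option linter.unusedSectionVars false

section
variable {d : ℕ}

local notation "cj" => starRingEnd ℂ

/-- amplitude of the test function for duality -/
def tamp (p : ℝ) (w : EuclideanSpace ℝ (Fin d) → ℂ) (n : ℕ) (x : EuclideanSpace ℝ (Fin d)) : ℝ :=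
  cut d n x * (‖w x‖ ^ 2 + 1 / ((n:ℝ) + 1)) ^ (p / 2)

lemma tamp_contDiff (p : ℝ) {w : EuclideanSpace ℝ (Fin d) → ℂ} (hw : ContDiff ℝ (⊤ : ℕ∞) w) (n : ℕ) :
    ContDiff ℝ (⊤ : ℕ∞) (tamp p w n) := by
  refine (cut_contDiff d n).mul (ContDiff.rpow_const_of_ne ((hw.norm_sq ℝ).add contDiff_const) fun x => ?_)
  positivity

lemma tamp_nonneg (p : ℝ) (w : EuclideanSpace ℝ (Fin d) → ℂ) (n : ℕ) (x) : 0 ≤ tamp p w n x := by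
  have := cut_nonneg d n x
  unfold tamp; positivity

lemma tamp_le {p : ℝ} (hp : 0 < p) {w : EuclideanSpace ℝ (Fin d) → ℂ} {C : ℝ} (hC : ∀ x, ‖w x‖ ≤ C) (n : ℕ) (x) :
    tamp p w n x ≤ (C ^ 2 + 1) ^ (p/2) := by
  unfold tamp
  have h3 := cut_nonneg d n x
  have h4 := cut_le_one d n x
  have h5 : 1 / ((n:ℝ) + 1) ≤ 1 := by rw [div_le_one (by positivity)]; linarith [n.cast_nonneg (α := ℝ)]
  calc _ ≤ 1 * (C ^ 2 + 1) ^ (p/2) := by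
        gcongr
        exact hC x
    _ = _ := one_mul _

lemma tamp_lim {p : ℝ} (hp : 0 < p) (w : EuclideanSpace ℝ (Fin d) → ℂ) (x) :
    Tendsto (fun n => tamp p w n x) atTop (𝓝 (‖w x‖ ^ p)) := by
  have h1 := (tendsto_one_div_add_atTop_nhds_zero_nat (𝕜 := ℝ)).const_add (‖w x‖ ^ 2)
  have h2 := h1.rpow_const (p := p/2) (Or.inr (by positivity))
  have h3 := (cut_tendsto d x).mul h2
  have e : (1 * (‖w x‖ ^ 2 + 0) ^ (p/2)) = ‖w x‖ ^ p := by
    rw [one_mul, add_zero, ← Real.rpow_natCast, ← Real.rpow_mul (norm_nonneg _)]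
    congr 1; push_cast; ring
  rw [e] at h3
  exact h3

lemma tamp_compact (p : ℝ) (w : EuclideanSpace ℝ (Fin d) → ℂ) (n : ℕ) : HasCompactSupport (tamp p w n) := by
  refine (cut_compact d n).mono fun x hx => ?_
  contrapose hx
  simp only [Function.mem_support, not_not] at hx ⊢
  simp [tamp, hx]

lemma dual_norm {w : EuclideanSpace ℝ (Fin d) → ℂ} (hw : RD w) (hws : ContDiff ℝ (⊤ : ℕ∞) w)
    {p r q : ℝ} (hp : 0 < p) (hr : r = p + 2) (hq : q = r / (r - 1)) {K : ℝ} (hK : 0 ≤ K)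
    (h : ∀ f : 𝓢(EuclideanSpace ℝ (Fin d), ℂ), HasCompactSupport f → ‖∫ x, w x * cj (f x)‖ ≤ K * nr q f) :
    nr r w ≤ K := by
  have hr0 : 0 < r := by linarith
  have hr1 : 0 < r - 1 := by linarith
  have hq1 : 1 ≤ q := by rw [hq, le_div_iff₀] <;> linarith
  have hq0 : 0 < q := by linarith
  obtain ⟨C, hC0, hC⟩ := hw.bdd
  set M := (C ^ 2 + 1) ^ (p/2) with hM
  have hM0 : 0 ≤ M := by positivity
  have tc := fun n => (tamp_contDiff p hws n).continuous
  have key : ∀ n, (∫ x, tamp p w n x * ‖w x‖ ^ 2) ≤ K * (∫ x, (tamp p w n x * ‖w x‖) ^ q) ^ (1/q) := by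
    intro n
    have s1 : ContDiff ℝ (⊤ : ℕ∞) (fun x => (tamp p w n x : ℂ) * w x) :=
      (Complex.ofRealCLM.contDiff.comp (tamp_contDiff p hws n)).mul hws
    have c1 : HasCompactSupport (fun x => (tamp p w n x : ℂ) * w x) := cs_cmul (tamp_compact p w n) w
    have := h (c1.toSchwartzMap s1) c1
    have e1 : ∀ x, w x * cj (c1.toSchwartzMap s1 x) = ((tamp p w n x * ‖w x‖ ^ 2 : ℝ) : ℂ) := by
      intro x
      change w x * cj ((tamp p w n x : ℂ) * w x) = _
      rw [map_mul, Complex.conj_ofReal, mul_left_comm, Complex.mul_conj, Complex.normSq_eq_norm_sq]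
      push_cast; rfl
    have e2 : nr q (c1.toSchwartzMap s1) = (∫ x, (tamp p w n x * ‖w x‖) ^ q) ^ (1/q) := by
      unfold nr
      congr 2
      funext x
      change ‖(tamp p w n x : ℂ) * w x‖ ^ q = _
      rw [norm_mul, Complex.norm_real, Real.norm_of_nonneg (tamp_nonneg p w n x)]
    simp only [e1] at this
    rw [integral_complex_ofReal, Complex.norm_real, e2] at this
    exact (le_abs_self _).trans this
  have l1 : Tendsto (fun n => ∫ x, tamp p w n x * ‖w x‖ ^ 2) atTop (𝓝 (∫ x, ‖w x‖ ^ r)) := by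
    have := hw.sq.tendsto (a := fun n => tamp p w n) tc 0 M
      (fun n x => by rw [abs_of_nonneg (tamp_nonneg p w n x)]; simpa using tamp_le hp hC n x)
      (fun x => tamp_lim hp w x)
    have e : ∀ x, ‖w x‖ ^ p * ‖w x‖ ^ 2 = ‖w x‖ ^ r := by
      intro x
      rw [hr, Real.rpow_add_of_nonneg (norm_nonneg _) hp.le (by norm_num), Real.rpow_two]
    simp only [e] at this
    exact this
  have l2 : Tendsto (fun n => ∫ x, (tamp p w n x * ‖w x‖) ^ q) atTop (𝓝 (∫ x, ‖w x‖ ^ r)) := by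
    refine tendsto_integral_of_dominated_convergence (fun x => M ^ q * ‖w x‖ ^ q) (fun n => ?_)
      ((hw.rpow hq1).integrable.const_mul _) (fun n => ae_of_all _ fun x => ?_) (ae_of_all _ fun x => ?_)
    · exact (((tc n).mul hw.1.norm).rpow_const fun x => Or.inr hq0.le).aestronglyMeasurable
    · have := tamp_nonneg p w n x
      rw [Real.norm_of_nonneg (by positivity), ← Real.mul_rpow hM0 (norm_nonneg _)]
      gcongr
      exact tamp_le hp hC n x
    · have := ((tamp_lim hp w x).mul_const ‖w x‖).rpow_const (p := q) (Or.inr hq0.le)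
      have e : (‖w x‖ ^ p * ‖w x‖) ^ q = ‖w x‖ ^ r := by
        have : ‖w x‖ ^ p * ‖w x‖ = ‖w x‖ ^ (r - 1) := by
          rw [hr, show p + 2 - 1 = p + 1 by ring, Real.rpow_add_of_nonneg (norm_nonneg _) hp.le (by norm_num), Real.rpow_one]
        rw [this, ← Real.rpow_mul (norm_nonneg _)]
        congr 1
        rw [hq]; field_simp
      rw [e] at this
      exact this
  have l3 := (l2.rpow_const (p := 1/q) (Or.inr (by positivity))).const_mul K
  have fin := le_of_tendsto_of_tendsto' l1 l3 key
  rw [← nr_pow hr0] at fin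
  have n0 := nr_nonneg r w
  rcases eq_or_lt_of_le n0 with z | z
  · rw [← z]; exact hK
  have e : (nr r w ^ r) ^ (1/q) = nr r w ^ (r - 1) := by
    rw [← Real.rpow_mul n0]; congr 1; rw [hq]; field_simp
  have e2 : nr r w ^ r = nr r w * nr r w ^ (r - 1) := by
    rw [← Real.rpow_one_add' n0 (by linarith)]; congr 1; ring
  rw [e, e2] at fin
  exact le_of_mul_le_mul_right fin (by positivity)

/-- integration of a derivative bound with an integrable singularity at the endpoint -/
lemma sing_bound {J J' : ℝ → ℂ} {t0 t c1 c2 γ : ℝ} (hγ : 0 < γ) (hγ1 : γ < 1) (hc1 : 0 ≤ c1) (hc2 : 0 ≤ c2)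
    (hd : ∀ s ∈ uIcc t0 t, HasDerivAt J (J' s) s)
    (hb : ∀ s ∈ uIcc t0 t, s ≠ t → ‖J' s‖ ≤ c1 + c2 * |s - t| ^ (-γ)) :
    ‖J t‖ ≤ ‖J t0‖ + c1 * |t - t0| + c2 * |t - t0| ^ (1 - γ) / (1 - γ) := by
  rcases eq_or_ne t t0 with rfl | hne
  · simp only [sub_self, abs_zero, mul_zero, add_zero]
    rw [Real.zero_rpow (by linarith)]; simp
  set L := |t - t0| with hL
  have hL0 : 0 < L := abs_pos.2 (sub_ne_zero.2 hne)
  have hg : 0 < 1 - γ := by linarith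
  set S : ℝ → ℝ := fun σ => t0 + σ * (t - t0) with hS
  have Smem : ∀ σ ∈ Icc (0:ℝ) 1, S σ ∈ uIcc t0 t := by
    intro σ hσ
    have := (convex_uIcc t0 t).add_smul_sub_mem left_mem_uIcc right_mem_uIcc hσ
    simpa [hS, smul_eq_mul] using this
  have Sd : ∀ σ, HasDerivAt S (t - t0) σ := by
    intro σ
    have := ((hasDerivAt_id σ).mul_const (t - t0)).const_add t0
    rw [one_mul] at this
    exact this
  have Kd : ∀ σ ∈ Icc (0:ℝ) 1, HasDerivAt (fun σ => J (S σ)) ((t - t0) • J' (S σ)) σ :=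
    fun σ hσ => (hd (S σ) (Smem σ hσ)).scomp σ (Sd σ)
  have Sst : ∀ σ ∈ Ico (0:ℝ) 1, |S σ - t| = L * (1 - σ) := by
    intro σ hσ
    have : S σ - t = (t - t0) * (-(1 - σ)) := by simp only [hS]; ring
    rw [this, abs_mul, abs_neg, abs_of_nonneg (by linarith [hσ.2] : 0 ≤ 1 - σ)]
  have := image_norm_le_of_norm_deriv_right_le_deriv_boundary' (a := 0) (b := 1)
    (f := fun σ => J (S σ)) (f' := fun σ => (t - t0) • J' (S σ))
    (B := fun σ => ‖J t0‖ + L * c1 * σ + c2 * L ^ (1 - γ) / (1 - γ) * (1 - (1 - σ) ^ (1 - γ)))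
    (B' := fun σ => L * c1 + c2 * L ^ (1 - γ) * (1 - σ) ^ (-γ))
    (fun σ hσ => (Kd σ hσ).continuousAt.continuousWithinAt)
    (fun σ hσ => (Kd σ ⟨hσ.1, hσ.2.le⟩).hasDerivWithinAt)
    (by simp [hS])
    (by
      refine Continuous.continuousOn ?_
      have : Continuous fun σ : ℝ => (1 - σ) ^ (1 - γ) := by
        exact (continuous_const.sub continuous_id).rpow_const fun x => Or.inr hg.le
      fun_prop)
    (by
      intro σ hσ
      have h1 : HasDerivAt (fun σ : ℝ => 1 - σ) (-1) σ := by simpa using (hasDerivAt_id σ).const_sub 1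
      have h2 := h1.rpow_const (p := 1 - γ) (Or.inl (by linarith [hσ.2]))
      have h3 := (((hasDerivAt_id σ).const_mul (L * c1)).const_add ‖J t0‖).add
        ((h2.const_sub 1).const_mul (c2 * L ^ (1 - γ) / (1 - γ)))
      refine (h3.congr_deriv ?_).hasDerivWithinAt
      rw [show 1 - γ - 1 = -γ by ring]
      field_simp)
    (by
      intro σ hσ
      have h0 : 0 < 1 - σ := by linarith [hσ.2]
      have hm := Smem σ ⟨hσ.1, hσ.2.le⟩
      have a := Sst σ hσ
      have ne : S σ ≠ t := by
        intro e; rw [e, sub_self, abs_zero] at a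
        have : 0 < L * (1 - σ) := by positivity
        linarith
      have b := hb _ hm ne
      rw [norm_smul, Real.norm_eq_abs]
      calc |t - t0| * ‖J' (S σ)‖ ≤ L * (c1 + c2 * (L * (1 - σ)) ^ (-γ)) := by
            rw [← a]; gcongr
        _ = _ := by
          rw [Real.mul_rpow hL0.le h0.le, show 1 - γ = 1 + -γ by ring, Real.rpow_add hL0, Real.rpow_one]
          ring)
    (show (1:ℝ) ∈ Icc (0:ℝ) 1 by simp)
  simp only [hS] at this
  rw [sub_self, Real.zero_rpow hg.ne', one_mul, add_sub_cancel] at this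
  refine this.trans (le_of_eq ?_)
  ring

end
end
end

section
open MeasureTheory Set Filter Topology SchwartzMap FourierTransform
open scoped ENNReal NNReal

noncomputable section

set_option linter.unusedSectionVars false

section
variable {d : ℕ}

local notation "cj" => starRingEnd ℂ

lemma Dv_shift (v a p : ℝ × EuclideanSpace ℝ (Fin d)) (F : ℝ × EuclideanSpace ℝ (Fin d) → ℂ) :
    Dv v (fun p => F (p + a)) p = Dv v F (p + a) := by
  unfold Dv
  rw [fderiv_comp_add_right]

lemma SchEq.mono {I I' : Set ℝ} {v g : ℝ × EuclideanSpace ℝ (Fin d) → ℂ} (h : SchEq I v g)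
    (ho : IsOpen I') (hI : I' ⊆ I) : SchEq I' v g where
  op := ho
  sm := fun p hp => h.sm p (hI hp)
  gc := h.gc.mono (prod_mono hI subset_rfl)
  eq := fun p hp => h.eq p (hI hp)

lemma SchEq.shift {I : Set ℝ} {v g : ℝ × EuclideanSpace ℝ (Fin d) → ℂ} (h : SchEq I v g) (τ : ℝ) :
    SchEq {t | t + τ ∈ I} (fun p => v (p + (τ, 0))) (fun p => g (p + (τ, 0))) where
  op := h.op.preimage (by fun_prop : Continuous fun t : ℝ => t + τ)
  sm := fun p hp => (h.sm (p + (τ, 0)) (by simpa using hp)).comp p (contDiffAt_id.add contDiffAt_const)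
  gc := by
    refine h.gc.comp (by fun_prop) ?_
    rintro ⟨t, x⟩ ⟨h1, _⟩
    exact ⟨h1, mem_univ _⟩
  eq := fun p hp => by
    have := h.eq (p + (τ, 0)) (by simpa using hp)
    rw [Dv_shift, this]
    have e : ∀ k : Fin d, Dv (dx k) (fun p => v (p + (τ, 0))) = fun p => Dv (dx k) v (p + (τ, 0)) := fun k => by
      funext p; exact Dv_shift _ _ _ _
    simp only [e, Dv_shift]

lemma Dv_sub {I : Set ℝ} {v v' : ℝ × EuclideanSpace ℝ (Fin d) → ℂ} (h : SmI I v) (h' : SmI I v') (a) (p)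
    (hp : p.1 ∈ I) : Dv a (fun p => v p - v' p) p = Dv a v p - Dv a v' p := by
  unfold Dv
  have := fderiv_sub ((h p hp).differentiableAt (by simp)) ((h' p hp).differentiableAt (by simp))
  have e : fderiv ℝ (fun p => v p - v' p) p = _ := this
  rw [e]; rfl

lemma near_time {I : Set ℝ} (hI : IsOpen I) {p : ℝ × EuclideanSpace ℝ (Fin d)} (hp : p.1 ∈ I) :
    ∀ᶠ p' in 𝓝 p, p'.1 ∈ I := continuous_fst.continuousAt.eventually (hI.mem_nhds hp)

lemma SchEq.sub {I : Set ℝ} {v g v' g' : ℝ × EuclideanSpace ℝ (Fin d) → ℂ} (h : SchEq I v g)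
    (h' : SchEq I v' g') : SchEq I (fun p => v p - v' p) (fun p => g p - g' p) where
  op := h.op
  sm := fun p hp => (h.sm p hp).sub (h'.sm p hp)
  gc := h.gc.sub h'.gc
  eq := fun p hp => by
    have e : ∀ k : Fin d, Dv (dx k) (Dv (dx k) (fun p => v p - v' p)) p =
        Dv (dx k) (Dv (dx k) v) p - Dv (dx k) (Dv (dx k) v') p := by
      intro k
      rw [← Dv_sub (Dv_smI h.sm _) (Dv_smI h'.sm _) _ _ hp]
      have : Dv (dx k) (fun p => v p - v' p) =ᶠ[𝓝 p] fun p => Dv (dx k) v p - Dv (dx k) v' p := by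
        filter_upwards [near_time h.op hp] with p' hp'
        exact Dv_sub h.sm h'.sm _ _ hp'
      unfold Dv at this ⊢
      rw [this.fderiv_eq]
    simp only [e]
    rw [Dv_sub h.sm h'.sm _ _ hp, h.eq p hp, h'.eq p hp, Finset.sum_sub_distrib]
    ring

/-- backward free evolution -/
def psi (f : 𝓢(EuclideanSpace ℝ (Fin d), ℂ)) (t : ℝ) (p : ℝ × EuclideanSpace ℝ (Fin d)) : ℂ :=
  schField (FourierTransform.fourier f) (p + (-t, 0))

lemma psi_apply (f : 𝓢(EuclideanSpace ℝ (Fin d), ℂ)) (t s : ℝ) (x) :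
    psi f t (s, x) = schEvol (s - t) f x := by
  rw [schEvol_eq_field, psi]
  congr 1
  simp [sub_eq_add_neg]

lemma psi_eq {I : Set ℝ} (hI : IsOpen I) (f : 𝓢(EuclideanSpace ℝ (Fin d), ℂ)) (t : ℝ) :
    SchEq I (psi f t) (fun _ => 0) := by
  have h0 : SchEq univ (schField (FourierTransform.fourier f)) (fun _ => 0) := by
    refine ⟨isOpen_univ, fun p _ => (schField_contDiff _).contDiffAt, continuousOn_const, fun p _ => ?_⟩
    have := schField_pde (EuclideanSpace.basisFun (Fin d) ℝ) (FourierTransform.fourier f) p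
    rw [add_zero]
    have e : ∀ k, (EuclideanSpace.basisFun (Fin d) ℝ) k = stdVec d k := by
      intro k; simp [stdVec, EuclideanSpace.basisFun_apply]
    simp only [e] at this
    exact this
  exact (h0.shift (-t)).mono hI (fun s _ => mem_univ _)

/-- time difference -/
def wd (U : ℝ × EuclideanSpace ℝ (Fin d) → ℂ) (τ : ℝ) (p : ℝ × EuclideanSpace ℝ (Fin d)) : ℂ :=
  U (p + (τ, 0)) - U p

lemma wd_apply (U : ℝ × EuclideanSpace ℝ (Fin d) → ℂ) (τ s : ℝ) (x) :
    wd U τ (s, x) = U (s + τ, x) - U (s, x) := by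
  simp [wd]

/-- nonlinearity difference -/
def gd (U : ℝ × EuclideanSpace ℝ (Fin d) → ℂ) (τ : ℝ) (p : ℝ × EuclideanSpace ℝ (Fin d)) : ℂ :=
  ((‖U (p + (τ, 0))‖ ^ ((4:ℝ)/d) : ℝ) : ℂ) * U (p + (τ, 0)) - ((‖U p‖ ^ ((4:ℝ)/d) : ℝ) : ℂ) * U p

lemma gd_le {I : Set ℝ} {U : ℝ × EuclideanSpace ℝ (Fin d) → ℂ} (h : Sol I U) (τ s : ℝ) (x) :
    ‖gd U τ (s, x)‖ ≤ 5 * ((‖U (s + τ, x)‖ ^ ((4:ℝ)/d) + ‖U (s, x)‖ ^ ((4:ℝ)/d)) * ‖wd U τ (s, x)‖) := by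
  have := h.rp
  have hd1 : (1:ℝ) ≤ d := by exact_mod_cast h.hd
  have := nonlin_lip (p := (4:ℝ)/d) this (by rw [div_le_iff₀ (by linarith)]; linarith) (U (s + τ, x)) (U (s, x))
  simpa [gd, wd] using this

lemma wd_eq {I : Set ℝ} {U : ℝ × EuclideanSpace ℝ (Fin d) → ℂ} (h : Sol I U) (τ : ℝ) :
    SchEq (I ∩ {t | t + τ ∈ I}) (wd U τ) (gd U τ) := by
  have o : IsOpen (I ∩ {t | t + τ ∈ I}) :=
    h.se.op.inter (h.se.op.preimage (by fun_prop : Continuous fun t : ℝ => t + τ))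
  exact ((h.se.shift τ).mono o inter_subset_right).sub (h.se.mono o inter_subset_left)

lemma wd_rd {I : Set ℝ} {U : ℝ × EuclideanSpace ℝ (Fin d) → ℂ} (h : Sol I U) {τ s : ℝ} (hs : s ∈ I)
    (hs' : s + τ ∈ I) : RD (fun x => wd U τ (s, x)) := by
  simp only [wd_apply]
  exact (h.rd0 hs').sub (h.rd0 hs)

lemma wd_dx {I : Set ℝ} {U : ℝ × EuclideanSpace ℝ (Fin d) → ℂ} (h : Sol I U) {τ s : ℝ} (hs : s ∈ I)
    (hs' : s + τ ∈ I) (k : Fin d) (x) :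
    Dv (dx k) (wd U τ) (s, x) = Dv (dx k) U (s + τ, x) - Dv (dx k) U (s, x) := by
  have o : IsOpen (I ∩ {t | t + τ ∈ I}) :=
    h.se.op.inter (h.se.op.preimage (by fun_prop : Continuous fun t : ℝ => t + τ))
  have := Dv_sub ((h.se.shift τ).mono o inter_subset_right).sm (h.se.mono o inter_subset_left).sm (dx k) (s, x) ⟨hs, hs'⟩
  change Dv (dx k) (wd U τ) (s, x) = _ at this
  rw [this, Dv_shift]
  simp

/-- size of the difference in first derivatives -/
lemma wd_dx_sq {I : Set ℝ} {U : ℝ × EuclideanSpace ℝ (Fin d) → ℂ} (h : Sol I U) {τ s B : ℝ} (hs : s ∈ I)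
    (hs' : s + τ ∈ I) (h1 : QA U s ≤ B) (h2 : QA U (s + τ) ≤ B) :
    ∫ x, ∑ k, ‖Dv (dx k) (wd U τ) (s, x)‖ ^ 2 ≤ 4 * B := by
  simp only [wd_dx h hs hs']
  have e : ∀ t, QA U t ≤ B → QK U t ≤ B := fun t ht => by
    have := QV_nonneg (U := U) t; have := QX_nonneg (U := U) t; have := QM_nonneg (U := U) t
    unfold QA at ht; linarith
  have k1 := e _ h1
  have k2 := e _ h2
  calc _ ≤ ∫ x, 2 * ((∑ k, ‖Dv (dx k) U (s + τ, x)‖ ^ 2) + ∑ k, ‖Dv (dx k) U (s, x)‖ ^ 2) := by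
        refine integral_mono (RD.sum fun k => ((h.rd1 hs' k).sub (h.rd1 hs k)).sq).integrable
          (((h.rK hs').add (h.rK hs)).integrable.const_mul 2) fun x => ?_
        change (∑ k, ‖Dv (dx k) U (s + τ, x) - Dv (dx k) U (s, x)‖ ^ 2) ≤ 2 * ((∑ k, ‖Dv (dx k) U (s + τ, x)‖ ^ 2) + ∑ k, ‖Dv (dx k) U (s, x)‖ ^ 2)
        rw [← Finset.sum_add_distrib, Finset.mul_sum]
        refine Finset.sum_le_sum fun k _ => ?_
        have := norm_sub_le (Dv (dx k) U (s + τ, x)) (Dv (dx k) U (s, x))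
        nlinarith [norm_nonneg (Dv (dx k) U (s + τ, x) - Dv (dx k) U (s, x)), sq_nonneg (‖Dv (dx k) U (s + τ, x)‖ - ‖Dv (dx k) U (s, x)‖)]
    _ = 2 * (QK U (s + τ) + QK U s) := by
        rw [integral_const_mul, integral_add (h.rK hs').integrable (h.rK hs).integrable]; rfl
    _ ≤ _ := by linarith

lemma wd_sq {I : Set ℝ} {U : ℝ × EuclideanSpace ℝ (Fin d) → ℂ} (h : Sol I U) {τ s B : ℝ} (hs : s ∈ I)
    (hs' : s + τ ∈ I) (h1 : QA U s ≤ B) (h2 : QA U (s + τ) ≤ B) :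
    ∫ x, ‖wd U τ (s, x)‖ ^ 2 ≤ 4 * B := by
  simp only [wd_apply]
  have e : ∀ t, QA U t ≤ B → QM U t ≤ B := fun t ht => by
    have := QV_nonneg (U := U) t; have := QX_nonneg (U := U) t; have := QK_nonneg (U := U) t
    unfold QA at ht; linarith
  have k1 := e _ h1
  have k2 := e _ h2
  calc _ ≤ ∫ x, 2 * (‖U (s + τ, x)‖ ^ 2 + ‖U (s, x)‖ ^ 2) := by
        refine integral_mono ((h.rd0 hs').sub (h.rd0 hs)).sq.integrable
          (((h.rM hs').add (h.rM hs)).integrable.const_mul 2) fun x => ?_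
        change ‖U (s + τ, x) - U (s, x)‖ ^ 2 ≤ 2 * (‖U (s + τ, x)‖ ^ 2 + ‖U (s, x)‖ ^ 2)
        have := norm_sub_le (U (s + τ, x)) (U (s, x))
        nlinarith [norm_nonneg (U (s + τ, x) - U (s, x)), sq_nonneg (‖U (s + τ, x)‖ - ‖U (s, x)‖)]
    _ = 2 * (QM U (s + τ) + QM U s) := by
        rw [integral_const_mul, integral_add (h.rM hs').integrable (h.rM hs).integrable]; rfl
    _ ≤ _ := by linarith

lemma nr_U {I : Set ℝ} {U : ℝ × EuclideanSpace ℝ (Fin d) → ℂ} (h : Sol I U) {s B : ℝ}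
    (h1 : QA U s ≤ B) : nr ((4:ℝ)/d + 2) (fun x => U (s, x)) ^ ((4:ℝ)/d) ≤ (1 + B) ^ ((4:ℝ)/d) := by
  have hp := h.rp
  have := QV_nonneg (U := U) s; have := QM_nonneg (U := U) s; have := QK_nonneg (U := U) s
  have x0 := QX_nonneg (U := U) s
  have : QX U s ≤ B := by unfold QA at h1; linarith
  refine Real.rpow_le_rpow (nr_nonneg _ _) (nr_le_of_pow (by linarith) _ (by linarith) ?_) hp.le
  change QX U s ≤ _
  calc QX U s ≤ (1 + B) ^ (1:ℝ) := by rw [Real.rpow_one]; linarith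
    _ ≤ _ := Real.rpow_le_rpow_of_exponent_le (by linarith) (by linarith)

/-- pairing with the nonlinear difference -/
lemma gd_pair {I : Set ℝ} {U : ℝ × EuclideanSpace ℝ (Fin d) → ℂ} (h : Sol I U) {τ s B Y : ℝ} (hs : s ∈ I)
    (hs' : s + τ ∈ I) (h1 : QA U s ≤ B) (h2 : QA U (s + τ) ≤ B)
    (hY : nr ((4:ℝ)/d + 2) (fun x => wd U τ (s, x)) ≤ Y) {ψ : EuclideanSpace ℝ (Fin d) → ℂ} (hψ : RD ψ) :
    ∫ x, ‖gd U τ (s, x)‖ * ‖ψ x‖ ≤ 10 * (1 + B) ^ ((4:ℝ)/d) * (Y * nr ((4:ℝ)/d + 2) ψ) := by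
  have hp := h.rp
  have rw0 := wd_rd h hs hs'
  have A1 := holder3 (h.rd0 hs') rw0 hψ hp rfl
  have A2 := holder3 (h.rd0 hs) rw0 hψ hp rfl
  have n1 := nr_nonneg ((4:ℝ)/d + 2) ψ
  have n2 := nr_nonneg ((4:ℝ)/d + 2) (fun x => wd U τ (s, x))
  have b1 : ∀ t, t ∈ I → Integrable (fun x => ‖U (t, x)‖ ^ ((4:ℝ)/d) * (‖wd U τ (s, x)‖ * ‖ψ x‖)) := by
    intro t ht
    obtain ⟨C, hC0, hC⟩ := (h.rd0 ht).bdd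
    refine ((rw0.norm.mul hψ.norm).mul_bdd ((h.rd0 ht).1.norm.rpow_const fun x => Or.inr hp.le) 0 (C ^ ((4:ℝ)/d)) fun x => ?_).integrable
    rw [Real.norm_of_nonneg (by positivity), pow_zero, mul_one]
    gcongr
    exact hC x
  have gc : Continuous fun x => gd U τ (s, x) := slice_cont (wd_eq h τ).gc ⟨hs, hs'⟩
  calc ∫ x, ‖gd U τ (s, x)‖ * ‖ψ x‖ ≤ ∫ x, 5 * (‖U (s + τ, x)‖ ^ ((4:ℝ)/d) * (‖wd U τ (s, x)‖ * ‖ψ x‖) +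
        ‖U (s, x)‖ ^ ((4:ℝ)/d) * (‖wd U τ (s, x)‖ * ‖ψ x‖)) := by
        have i : Integrable (fun x => 5 * (‖U (s + τ, x)‖ ^ ((4:ℝ)/d) * (‖wd U τ (s, x)‖ * ‖ψ x‖) +
          ‖U (s, x)‖ ^ ((4:ℝ)/d) * (‖wd U τ (s, x)‖ * ‖ψ x‖))) := ((b1 _ hs').add (b1 _ hs)).const_mul 5
        have le : ∀ x, ‖gd U τ (s, x)‖ * ‖ψ x‖ ≤ 5 * (‖U (s + τ, x)‖ ^ ((4:ℝ)/d) * (‖wd U τ (s, x)‖ * ‖ψ x‖) +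
          ‖U (s, x)‖ ^ ((4:ℝ)/d) * (‖wd U τ (s, x)‖ * ‖ψ x‖)) := by
          intro x
          calc _ ≤ 5 * ((‖U (s + τ, x)‖ ^ ((4:ℝ)/d) + ‖U (s, x)‖ ^ ((4:ℝ)/d)) * ‖wd U τ (s, x)‖) * ‖ψ x‖ := by
                gcongr; exact gd_le h τ s x
            _ = _ := by ring
        refine integral_mono (i.mono' (gc.norm.mul hψ.1.norm).aestronglyMeasurable (ae_of_all _ fun x => ?_)) i le
        rw [Real.norm_of_nonneg (by positivity)]; exact le x
    _ = 5 * ((∫ x, ‖U (s + τ, x)‖ ^ ((4:ℝ)/d) * (‖wd U τ (s, x)‖ * ‖ψ x‖)) +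
        ∫ x, ‖U (s, x)‖ ^ ((4:ℝ)/d) * (‖wd U τ (s, x)‖ * ‖ψ x‖)) := by
        rw [integral_const_mul, integral_add (b1 _ hs') (b1 _ hs)]
    _ ≤ 5 * ((1 + B) ^ ((4:ℝ)/d) * (Y * nr ((4:ℝ)/d + 2) ψ) + (1 + B) ^ ((4:ℝ)/d) * (Y * nr ((4:ℝ)/d + 2) ψ)) := by
        have g1 := nr_U h h1
        have g2 := nr_U h h2
        have := QV_nonneg (U := U) s; have := QM_nonneg (U := U) s; have := QK_nonneg (U := U) s
        have x0 := QX_nonneg (U := U) s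
        have : 0 ≤ 1 + B := by unfold QA at h1; linarith
        refine mul_le_mul_of_nonneg_left (add_le_add (A1.trans ?_) (A2.trans ?_)) (by norm_num)
        · gcongr
        · gcongr
    _ = _ := by ring

end
end
end

section
open MeasureTheory Set Filter Topology SchwartzMap FourierTransform
open scoped ENNReal NNReal

noncomputable section

set_option linter.unusedSectionVars false

section
variable {d : ℕ}

local notation "cj" => starRingEnd ℂ

/-- dispersive exponent -/
def dE (d : ℕ) : ℝ := (d:ℝ)/2 * ((4:ℝ)/d + 2 - 2) / ((4:ℝ)/d + 2)

/-- dual exponent -/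
def dq (d : ℕ) : ℝ := ((4:ℝ)/d + 2) / ((4:ℝ)/d + 2 - 1)

/-- dispersive constant -/
def dD (d : ℕ) : ℝ := (4 * ((4:ℝ)/d + 2) / ((4:ℝ)/d + 2 - 2) * 2 ^ ((4:ℝ)/d + 2 - dq d)) ^ (1/((4:ℝ)/d + 2)) *
  (4 * Real.pi) ^ (-(d:ℝ)/2 * ((4:ℝ)/d + 2-2) / ((4:ℝ)/d + 2))

lemma dD_nonneg (hd : 0 < d) : 0 ≤ dD d := by
  have hp : 0 < (4:ℝ)/d := by positivity
  have := Real.pi_pos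
  have e : 0 < (4:ℝ)/d + 2 - 2 := by linarith
  unfold dD; positivity

lemma dE_pos (hd : 0 < d) : 0 < dE d := by
  have hp : 0 < (4:ℝ)/d := by positivity
  have e : 0 < (4:ℝ)/d + 2 - 2 := by linarith
  unfold dE; positivity

lemma dE_lt (hd : 0 < d) : dE d < 1 := by
  have hp : 0 < (4:ℝ)/d := by positivity
  have h0 : (0:ℝ) < d := by positivity
  unfold dE
  rw [div_lt_one (by positivity)]
  have : (d:ℝ)/2 * ((4:ℝ)/d + 2 - 2) = 2 := by field_simp; ring
  rw [this]; linarith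

lemma dq_one (hd : 0 < d) : 1 ≤ dq d := by
  have hp : 0 < (4:ℝ)/d := by positivity
  unfold dq
  rw [le_div_iff₀] <;> linarith

lemma disp' (hd : 0 < d) (f : 𝓢(EuclideanSpace ℝ (Fin d), ℂ)) (hf : HasCompactSupport f) {s : ℝ} (hs : s ≠ 0) :
    nr ((4:ℝ)/d + 2) (schEvol s f) ≤ dD d * |s| ^ (-dE d) * nr (dq d) f := by
  have hp : 0 < (4:ℝ)/d := by positivity
  have := disp (r := (4:ℝ)/d + 2) (q := dq d) (by linarith) rfl f hf s hs
  refine this.trans (le_of_eq ?_)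
  unfold dD dE
  congr 3
  ring

lemma dual_step {I : Set ℝ} {U : ℝ × EuclideanSpace ℝ (Fin d) → ℂ} (h : Sol I U) {τ t0 t B Y : ℝ}
    (hI : ∀ s ∈ uIcc t0 t, s ∈ I) (hI' : ∀ s ∈ uIcc t0 t, s + τ ∈ I)
    (hB : ∀ s ∈ uIcc t0 t, QA U s ≤ B) (hB' : ∀ s ∈ uIcc t0 t, QA U (s + τ) ≤ B)
    (hY : ∀ s ∈ uIcc t0 t, nr ((4:ℝ)/d + 2) (fun x => wd U τ (s, x)) ≤ Y) (hne : t0 ≠ t)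
    (f : 𝓢(EuclideanSpace ℝ (Fin d), ℂ)) (hf : HasCompactSupport f) :
    ‖∫ x, wd U τ (t, x) * cj (f x)‖ ≤
      (nr (dq d) (fun x => wd U τ (t0, x)) * (dD d * |t0 - t| ^ (-dE d)) +
       10 * (1 + B) ^ ((4:ℝ)/d) * Y * dD d * |t - t0| ^ (1 - dE d) / (1 - dE d)) * nr (dq d) f := by
  have hp := h.rp
  have D0 := dD_nonneg h.hd
  obtain ⟨c, hc0, hc⟩ := cut_pd_bounds d
  have hE0 := dE_pos h.hd
  have hE1 := dE_lt h.hd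
  have m0 : t0 ∈ uIcc t0 t := left_mem_uIcc
  have mt : t ∈ uIcc t0 t := right_mem_uIcc
  have B0 : 0 ≤ B := by
    have := hB t0 m0
    have := QV_nonneg (U := U) t0; have := QM_nonneg (U := U) t0; have := QK_nonneg (U := U) t0
    have := QX_nonneg (U := U) t0
    unfold QA at *; linarith
  have Y0 : 0 ≤ Y := (nr_nonneg _ _).trans (hY t0 m0)
  have nq := nr_nonneg (dq d) f
  have o := (wd_eq h τ).op
  have rψ : ∀ s, RD (fun x => psi f t (s, x)) := fun s => by
    simp only [psi_apply]; exact RD.schwartz _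
  set Ψ : ℝ := ∫ x, ‖f x‖ ^ 2 with hΨ
  have Ψ0 : 0 ≤ Ψ := integral_nonneg fun x => by positivity
  have ψ2 : ∀ s, ∫ x, ‖psi f t (s, x)‖ ^ 2 = Ψ := fun s => by
    simp only [psi_apply]; exact schEvol_l2 _ f
  have ψr : ∀ s, s ≠ t → nr ((4:ℝ)/d + 2) (fun x => psi f t (s, x)) ≤ dD d * |s - t| ^ (-dE d) * nr (dq d) f := by
    intro s hs
    simp only [psi_apply]
    exact disp' h.hd f hf (sub_ne_zero.2 hs)
  set c2 := 10 * (1 + B) ^ ((4:ℝ)/d) * Y * dD d * nr (dq d) f with hc2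
  have c20 : 0 ≤ c2 := by positivity
  set K := 2 * c * (d+1) * (Ψ + (8 * B + 8 * d * B)) with hK
  have K0 : 0 ≤ K := by positivity
  -- bound for each cut-off
  have key : ∀ n : ℕ, ‖∫ x, (cut d n x : ℂ) * (wd U τ (t, x) * cj (psi f t (t, x)))‖ ≤
      nr (dq d) (fun x => wd U τ (t0, x)) * (dD d * |t0 - t| ^ (-dE d) * nr (dq d) f) +
        K / (n+1) * |t - t0| + c2 * |t - t0| ^ (1 - dE d) / (1 - dE d) := by
    intro n
    have SB := sing_bound (t0 := t0) (t := t) (c1 := K / (n+1)) (c2 := c2) hE0 hE1 (by positivity) c20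
      (fun s hs => dual_deriv (wd_eq h τ) (psi_eq o f t) (cut_contDiff d n) (cut_compact d n) ⟨hI s hs, hI' s hs⟩)
      (by
        intro s hs hst
        have rW := wd_rd h (hI s hs) (hI' s hs)
        have rW1 : ∀ k, RD (fun x => Dv (dx k) (wd U τ) (s, x)) := fun k => by
          simp only [wd_dx h (hI s hs) (hI' s hs)]
          exact (h.rd1 (hI' s hs) k).sub (h.rd1 (hI s hs) k)
        refine (norm_add_le _ _).trans (add_le_add ?_ ?_)
        · rw [norm_mul, Complex.norm_I, one_mul, norm_neg]
          have rF : ∀ k, RD (fun x => (((‖Dv (dx k) (wd U τ) (s, x)‖ + ‖wd U τ (s, x)‖ : ℝ)) : ℂ)) := fun k => by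
            have := ((rW1 k).norm.add rW.norm)
            refine this.le (Complex.continuous_ofReal.comp this.1) fun x => ?_
            rw [Complex.norm_real]
          refine (sum_bound (f := fun x => psi f t (s, x))
            (F := fun k x => (((‖Dv (dx k) (wd U τ) (s, x)‖ + ‖wd U τ (s, x)‖ : ℝ)) : ℂ))
            (c := 2 * c / (n+1)) (by positivity) (rψ s) rF ?_).trans ?_
          · intro k x
            have g1 := (hc n k x).1
            have g2 := ((hc n k x).2.2 k).1
            refine (norm_add_le _ _).trans ?_
            simp only [norm_mul, Complex.norm_real, RCLike.norm_conj, RCLike.norm_ofNat, Real.norm_eq_abs]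
            rw [abs_of_nonneg (a := ‖Dv (dx k) (wd U τ) (s, x)‖ + _) (by positivity)]
            calc _ ≤ 2 * (c / (n+1)) * (‖Dv (dx k) (wd U τ) (s, x)‖ * ‖psi f t (s, x)‖) +
                  2 * (c / (n+1)) * (‖wd U τ (s, x)‖ * ‖psi f t (s, x)‖) := by
                  have : 0 ≤ c / (n+1) := by positivity
                  gcongr
                  linarith
              _ = _ := by ring
          · rw [ψ2 s]
            have : ∫ x, ∑ k : Fin d, ‖(((‖Dv (dx k) (wd U τ) (s, x)‖ + ‖wd U τ (s, x)‖ : ℝ)) : ℂ)‖ ^ 2 ≤ 8 * B + 8 * d * B := by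
              have i1 := (RD.sum (s := Finset.univ) fun k => (rW1 k).sq).integrable
              have i2 := rW.sq.integrable
              calc _ ≤ ∫ x, (2 * (∑ k : Fin d, ‖Dv (dx k) (wd U τ) (s, x)‖ ^ 2) + 2 * d * ‖wd U τ (s, x)‖ ^ 2) := by
                    refine integral_mono (RD.sum fun k => (rF k).sq).integrable
                      ((i1.const_mul 2).add (i2.const_mul (2 * d))) fun x => ?_
                    have : (2 * d * ‖wd U τ (s, x)‖ ^ 2 : ℝ) = ∑ k : Fin d, 2 * ‖wd U τ (s, x)‖ ^ 2 := by
                      rw [Finset.sum_const, Finset.card_univ, Fintype.card_fin, nsmul_eq_mul]; ring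
                    simp only [this]
                    rw [Finset.mul_sum, ← Finset.sum_add_distrib]
                    refine Finset.sum_le_sum fun k _ => ?_
                    rw [Complex.norm_real, Real.norm_of_nonneg (by positivity)]
                    nlinarith [sq_nonneg (‖Dv (dx k) (wd U τ) (s, x)‖ - ‖wd U τ (s, x)‖)]
                _ = 2 * (∫ x, ∑ k : Fin d, ‖Dv (dx k) (wd U τ) (s, x)‖ ^ 2) + 2 * d * ∫ x, ‖wd U τ (s, x)‖ ^ 2 := by
                    rw [integral_add (i1.const_mul 2) (i2.const_mul _), integral_const_mul, integral_const_mul]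
                _ ≤ 2 * (4 * B) + 2 * d * (4 * B) := by
                    gcongr
                    · exact wd_dx_sq h (hI s hs) (hI' s hs) (hB s hs) (hB' s hs)
                    · exact wd_sq h (hI s hs) (hI' s hs) (hB s hs) (hB' s hs)
                _ = _ := by ring
            calc _ ≤ 2 * c / (n+1) * (d+1) * (Ψ + (8 * B + 8 * d * B)) := by gcongr
              _ = _ := by rw [hK]; ring
        · rw [norm_mul, Complex.norm_I, one_mul]
          have gc : Continuous fun x => gd U τ (s, x) := slice_cont (wd_eq h τ).gc ⟨hI s hs, hI' s hs⟩
          have P := gd_pair h (hI s hs) (hI' s hs) (hB s hs) (hB' s hs) (hY s hs) (rψ s)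
          have igd : Integrable (fun x => ‖gd U τ (s, x)‖ * ‖psi f t (s, x)‖) := by
            have r1 : RD (fun x => gd U τ (s, x)) := by
              have := (((h.rd0 (hI' s hs)).npow hp.le).sub ((h.rd0 (hI s hs)).npow hp.le))
              simpa [gd] using this
            exact (r1.norm.mul (rψ s).norm).integrable
          refine (norm_integral_le_of_norm_le igd (ae_of_all _ fun x => ?_)).trans (P.trans ?_)
          · rw [norm_mul, norm_mul, Complex.norm_real, RCLike.norm_conj, Real.norm_of_nonneg (cut_nonneg d n x)]
            exact mul_le_of_le_one_left (by positivity) (cut_le_one d n x)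
          · calc _ ≤ 10 * (1 + B) ^ ((4:ℝ)/d) * (Y * (dD d * |s - t| ^ (-dE d) * nr (dq d) f)) := by
                  gcongr; exact ψr s hst
              _ = _ := by rw [hc2]; ring)
    refine SB.trans ?_
    gcongr
    have rW := wd_rd h (hI t0 m0) (hI' t0 m0)
    refine (norm_integral_le_of_norm_le (rW.norm.mul (rψ t0).norm).integrable (ae_of_all _ fun x => ?_)).trans
      ((holder2 rW (rψ t0) (r := (4:ℝ)/d + 2) (q := dq d) (by linarith) rfl).trans ?_)
    · rw [norm_mul, norm_mul, Complex.norm_real, RCLike.norm_conj, Real.norm_of_nonneg (cut_nonneg d n x)]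
      exact mul_le_of_le_one_left (by positivity) (cut_le_one d n x)
    · have := nr_nonneg (dq d) (fun x => wd U τ (t0, x))
      gcongr
      exact ψr t0 hne
  have rW := wd_rd h (hI t mt) (hI' t mt)
  have l1 : Tendsto (fun n : ℕ => ∫ x, (cut d n x : ℂ) * (wd U τ (t, x) * cj (psi f t (t, x)))) atTop
      (𝓝 (∫ x, wd U τ (t, x) * cj (f x))) := by
    refine tendsto_integral_of_dominated_convergence (fun x => ‖wd U τ (t, x)‖ * ‖psi f t (t, x)‖) (fun n => ?_)
      (rW.norm.mul (rψ t).norm).integrable (fun n => ae_of_all _ fun x => ?_) (ae_of_all _ fun x => ?_)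
    · exact ((Complex.continuous_ofReal.comp (cut_contDiff d n).continuous).mul (cont_cj rW.1 (rψ t).1)).aestronglyMeasurable
    · rw [norm_mul, norm_mul, Complex.norm_real, RCLike.norm_conj, Real.norm_of_nonneg (cut_nonneg d n x)]
      exact mul_le_of_le_one_left (by positivity) (cut_le_one d n x)
    · have := ((Complex.continuous_ofReal.tendsto _).comp (cut_tendsto d x)).mul_const (wd U τ (t, x) * cj (f x))
      rw [Complex.ofReal_one, one_mul] at this
      have e : psi f t (t, x) = f x := by rw [psi_apply, sub_self, schEvol_zero]
      rw [e]
      exact this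
  have l2 : Tendsto (fun n : ℕ => nr (dq d) (fun x => wd U τ (t0, x)) * (dD d * |t0 - t| ^ (-dE d) * nr (dq d) f) +
        K / (n+1) * |t - t0| + c2 * |t - t0| ^ (1 - dE d) / (1 - dE d)) atTop
      (𝓝 (nr (dq d) (fun x => wd U τ (t0, x)) * (dD d * |t0 - t| ^ (-dE d) * nr (dq d) f) +
        0 + c2 * |t - t0| ^ (1 - dE d) / (1 - dE d))) := by
    refine Tendsto.add_const _ (Tendsto.const_add _ ?_)
    have := (tendsto_one_div_add_atTop_nhds_zero_nat (𝕜 := ℝ)).mul_const (K * |t - t0|)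
    rw [zero_mul] at this
    refine this.congr fun n => ?_
    ring
  refine (le_of_tendsto_of_tendsto' l1.norm l2 key).trans (le_of_eq ?_)
  rw [hc2]; ring

end
end
end

section
open MeasureTheory Set Filter Topology SchwartzMap FourierTransform
open scoped ENNReal NNReal

noncomputable section

set_option linter.unusedSectionVars false

section
variable {d : ℕ}

local notation "cj" => starRingEnd ℂ

variable {I : Set ℝ} {U : ℝ × EuclideanSpace ℝ (Fin d) → ℂ}

lemma time_cont (h : Sol I U) {a b : ℝ} (hI : Icc a b ⊆ I) (x) :
    ContinuousOn (fun t => Dv (dt d) U (t, x)) (Icc a b) := by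
  refine (Dv_smI h.se.sm (dt d)).cont.comp (by fun_prop) fun t ht => ?_
  exact ⟨hI ht, mem_univ _⟩

lemma base_pt (h : Sol I U) {a b : ℝ} (hab : a < b) (hI : Icc a b ⊆ I) :
    ∃ t0 δ N : ℝ, 0 < δ ∧ 0 ≤ N ∧ Icc (t0 - δ) (t0 + δ) ⊆ Icc a b ∧
      ∀ t ∈ Icc (t0 - δ) (t0 + δ), ∀ x, (1 + ‖x‖) ^ (d+1) * ‖Dv (dt d) U (t, x)‖ ≤ N := by
  set Z : ℕ → Set ℝ := fun n => ⋂ x : EuclideanSpace ℝ (Fin d),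
    (Icc a b ∩ (fun t => (1 + ‖x‖) ^ (d+1) * ‖Dv (dt d) U (t, x)‖) ⁻¹' Iic (n:ℝ)) with hZ
  have cZ : ∀ n, IsClosed (Z n) := by
    intro n
    refine isClosed_iInter fun x => ?_
    exact ContinuousOn.preimage_isClosed_of_isClosed (continuousOn_const.mul (time_cont h hI x).norm)
      isClosed_Icc isClosed_Iic
  have cW : ∀ n, IsClosed (Z n ∪ (Ioo a b)ᶜ) := fun n => (cZ n).union isOpen_Ioo.isClosed_compl
  have uW : ⋃ n, (Z n ∪ (Ioo a b)ᶜ) = univ := by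
    rw [eq_univ_iff_forall]
    intro t
    rw [mem_iUnion]
    by_cases ht : t ∈ Ioo a b
    · obtain ⟨C, hC⟩ := (h.rdt (hI (Ioo_subset_Icc_self ht))).2 (d+1)
      obtain ⟨n, hn⟩ := exists_nat_ge C
      exact ⟨n, Or.inl (mem_iInter.2 fun x => ⟨Ioo_subset_Icc_self ht, (hC x).trans hn⟩)⟩
    · exact ⟨0, Or.inr ht⟩
  have dn := dense_iUnion_interior_of_closed cW uW
  obtain ⟨t0, h0, h1⟩ := dn.exists_mem_open isOpen_Ioo (nonempty_Ioo.2 hab)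
  obtain ⟨n, hn⟩ := mem_iUnion.1 h0
  obtain ⟨ε, hε, hb⟩ := Metric.nhds_basis_closedBall.mem_iff.1
    ((isOpen_interior.inter isOpen_Ioo).mem_nhds ⟨hn, h1⟩)
  rw [Real.closedBall_eq_Icc] at hb
  refine ⟨t0, ε, n, hε, by positivity, fun t ht => Ioo_subset_Icc_self (hb ht).2, fun t ht x => ?_⟩
  rcases interior_subset (hb ht).1 with h2 | h2
  · exact (mem_iInter.1 h2 x).2
  · exact absurd (hb ht).2 h2

lemma wd_small (h : Sol I U) {t0 δ N : ℝ} (hI : Icc (t0 - δ) (t0 + δ) ⊆ I)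
    (hN : ∀ t ∈ Icc (t0 - δ) (t0 + δ), ∀ x, (1 + ‖x‖) ^ (d+1) * ‖Dv (dt d) U (t, x)‖ ≤ N)
    {τ t : ℝ} (hτ : 0 < τ) (ht : t ∈ Icc (t0 - δ) (t0 + δ)) (ht' : t + τ ∈ Icc (t0 - δ) (t0 + δ)) (x) :
    (1 + ‖x‖) ^ (d+1) * ‖wd U τ (t, x)‖ ≤ N * τ := by
  have hp : 0 < (1 + ‖x‖) ^ (d+1) := by positivity
  have := mean_bound (h := fun s => U (s, x)) (h' := fun s => Dv (dt d) U (s, x)) (c := N / (1 + ‖x‖) ^ (d+1))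
    (fun s hs => h.se.sm.time (hI hs) x) (fun s hs => by
      rw [le_div_iff₀ hp, mul_comm]; exact hN s hs x) ht ht'
  rw [wd_apply]
  rw [add_sub_cancel_left, abs_of_pos hτ, div_mul_eq_mul_div, le_div_iff₀ hp, mul_comm] at this
  exact this

/-- weight integral -/
def jK (d : ℕ) : ℝ := ∫ x : EuclideanSpace ℝ (Fin d), ((1 + ‖x‖) ^ (d+1))⁻¹

lemma jK_nonneg : 0 ≤ jK d := integral_nonneg fun x => by positivity

lemma nr_weight' {w : EuclideanSpace ℝ (Fin d) → ℂ} (hw : RD w) {ρ c : ℝ} (hρ : 1 ≤ ρ) (hc : 0 ≤ c)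
    (h : ∀ x, (1 + ‖x‖) ^ (d+1) * ‖w x‖ ≤ c) : nr ρ w ≤ c * jK d ^ (1/ρ) := by
  have k0 := jK_nonneg (d := d)
  refine nr_le_of_pow (by linarith) w (by positivity) ((nr_weight hw hρ hc h).trans (le_of_eq ?_))
  rw [Real.mul_rpow hc (by positivity), ← Real.rpow_mul k0, one_div_mul_cancel (by linarith), Real.rpow_one]
  rfl

lemma wd_nr_bound (h : Sol I U) {a b B t0 δ N : ℝ} (hI : Icc a b ⊆ I)
    (hB : ∀ t ∈ Icc a b, QA U t ≤ B)
    (hT : 10 * (1 + B) ^ ((4:ℝ)/d) * dD d * (b - a) ^ (1 - dE d) / (1 - dE d) ≤ 1/2)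
    (hδ : 0 < δ) (hN0 : 0 ≤ N) (hsub : Icc (t0 - δ) (t0 + δ) ⊆ Icc a b)
    (hN : ∀ t ∈ Icc (t0 - δ) (t0 + δ), ∀ x, (1 + ‖x‖) ^ (d+1) * ‖Dv (dt d) U (t, x)‖ ≤ N) :
    ∃ C : ℝ, 0 ≤ C ∧ ∀ τ : ℝ, 0 < τ → τ < δ/2 → ∀ t ∈ Icc a (b - τ),
      nr ((4:ℝ)/d + 2) (fun x => wd U τ (t, x)) ≤ C * τ := by
  have hp := h.rp
  have D0 := dD_nonneg h.hd
  have E0 := dE_pos h.hd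
  have E1 := dE_lt h.hd
  have k0 := jK_nonneg (d := d)
  have q1 := dq_one h.hd
  have hsubI := hsub.trans hI
  set C1 := N * jK d ^ (1/((4:ℝ)/d + 2)) with hC1
  set C2 := N * jK d ^ (1/dq d) * (dD d * (δ/2) ^ (-dE d)) with hC2
  have C10 : 0 ≤ C1 := by positivity
  have C20 : 0 ≤ C2 := by positivity
  refine ⟨2 * (C1 + C2), by positivity, fun τ hτ hτδ => ?_⟩
  have t0m : t0 ∈ Icc a (b - τ) := by
    have m1 := hsub (⟨by linarith, by linarith⟩ : t0 ∈ Icc (t0 - δ) (t0 + δ))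
    have m2 := hsub (⟨by linarith, by linarith⟩ : t0 + δ ∈ Icc (t0 - δ) (t0 + δ))
    exact ⟨m1.1, by linarith [m2.2]⟩
  have mI : ∀ s ∈ Icc a (b - τ), s ∈ Icc a b := fun s hs => ⟨hs.1, by linarith [hs.2]⟩
  have mI' : ∀ s ∈ Icc a (b - τ), s + τ ∈ Icc a b := fun s hs => ⟨by linarith [hs.1], by linarith [hs.2]⟩
  have B0 : 0 ≤ B := (QA_nonneg (U := U) t0).trans (hB t0 (mI _ t0m))
  have rd : ∀ s ∈ Icc a (b - τ), RD (fun x => wd U τ (s, x)) := fun s hs =>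
    wd_rd h (hI (mI s hs)) (hI (mI' s hs))
  have near : ∀ s, |s - t0| ≤ δ/2 → ∀ x, (1 + ‖x‖) ^ (d+1) * ‖wd U τ (s, x)‖ ≤ N * τ := by
    intro s hs x
    rw [abs_le] at hs
    exact wd_small h hsubI hN hτ ⟨by linarith [hs.1], by linarith [hs.2]⟩
      ⟨by linarith [hs.1], by linarith [hs.2]⟩ x
  -- one step
  have step : ∀ Y, (∀ s ∈ Icc a (b - τ), nr ((4:ℝ)/d + 2) (fun x => wd U τ (s, x)) ≤ Y) →
      ∀ t ∈ Icc a (b - τ), nr ((4:ℝ)/d + 2) (fun x => wd U τ (t, x)) ≤ (C1 + C2) * τ + Y / 2 := by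
    intro Y hY t ht
    have Y0 : 0 ≤ Y := (nr_nonneg _ _).trans (hY t0 t0m)
    by_cases hn : |t - t0| ≤ δ/2
    · have := nr_weight' (rd t ht) (ρ := (4:ℝ)/d + 2) (by linarith) (by positivity) (near t hn)
      have e : N * τ * jK d ^ (1/((4:ℝ)/d + 2)) = C1 * τ := by rw [hC1]; ring
      rw [e] at this
      have : 0 ≤ C2 * τ := by positivity
      linarith
    · push Not at hn
      have us : uIcc t0 t ⊆ Icc a (b - τ) := uIcc_subset_Icc t0m ht
      have hne : t0 ≠ t := by
        rintro rfl; simp at hn; linarith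
      have ab : |t - t0| ≤ b - a := by
        rw [abs_le]; exact ⟨by linarith [ht.1, t0m.2], by linarith [ht.2, t0m.1]⟩
      set K := nr (dq d) (fun x => wd U τ (t0, x)) * (dD d * |t0 - t| ^ (-dE d)) +
       10 * (1 + B) ^ ((4:ℝ)/d) * Y * dD d * |t - t0| ^ (1 - dE d) / (1 - dE d) with hK
      have e10 : 0 < 1 - dE d := by linarith
      have nq := nr_nonneg (dq d) (fun x => wd U τ (t0, x))
      have K0 : 0 ≤ K := by positivity
      have r := dual_norm (rd t ht) ((wd_eq h τ).sm.slice ⟨hI (mI t ht), hI (mI' t ht)⟩) hp rfl rfl K0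
        (fun f hf => dual_step h (fun s hs => hI (mI s (us hs))) (fun s hs => hI (mI' s (us hs)))
          (fun s hs => hB _ (mI s (us hs))) (fun s hs => hB _ (mI' s (us hs)))
          (fun s hs => hY s (us hs)) hne f hf)
      refine r.trans ?_
      have n0 := nr_weight' (rd t0 t0m) q1 (by positivity) (near t0 (by simp; linarith))
      have b1 : nr (dq d) (fun x => wd U τ (t0, x)) * (dD d * |t0 - t| ^ (-dE d)) ≤ C2 * τ := by
        rw [hC2]
        calc _ ≤ (N * τ * jK d ^ (1/dq d)) * (dD d * (δ/2) ^ (-dE d)) := by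
              have e : |t0 - t| ^ (-dE d) ≤ (δ/2) ^ (-dE d) := by
                rw [abs_sub_comm]
                exact Real.rpow_le_rpow_of_nonpos (by positivity) hn.le (by linarith)
              exact mul_le_mul n0 (mul_le_mul_of_nonneg_left e D0) (by positivity) (by positivity)
          _ = _ := by ring
      have b2 : 10 * (1 + B) ^ ((4:ℝ)/d) * Y * dD d * |t - t0| ^ (1 - dE d) / (1 - dE d) ≤ Y / 2 := by
        calc _ ≤ 10 * (1 + B) ^ ((4:ℝ)/d) * Y * dD d * (b - a) ^ (1 - dE d) / (1 - dE d) := by gcongr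
          _ = (10 * (1 + B) ^ ((4:ℝ)/d) * dD d * (b - a) ^ (1 - dE d) / (1 - dE d)) * Y := by ring
          _ ≤ 1/2 * Y := by gcongr
          _ = Y/2 := by ring
      have : 0 ≤ C1 * τ := by positivity
      rw [hK]; linarith
  -- a priori finiteness
  set S := (fun t => nr ((4:ℝ)/d + 2) (fun x => wd U τ (t, x))) '' Icc a (b - τ) with hS
  have bdd : BddAbove S := by
    refine ⟨(2 ^ ((4:ℝ)/d + 2) * (B + B)) ^ (1/((4:ℝ)/d + 2)), ?_⟩
    rintro _ ⟨s, hs, rfl⟩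
    have XB : ∀ t, QA U t ≤ B → QX U t ≤ B := fun t ht => by
      have := QV_nonneg (U := U) t; have := QM_nonneg (U := U) t; have := QK_nonneg (U := U) t
      unfold QA at ht; linarith
    have := ir_sub (h.rd0 (hI (mI' s hs))) (h.rd0 (hI (mI s hs))) (r := (4:ℝ)/d + 2) (by linarith)
    simp only [nr]
    refine Real.rpow_le_rpow (ir_nonneg _ _) ?_ (by positivity)
    simp only [wd_apply]
    refine this.trans ?_
    have x1 := XB _ (hB _ (mI' s hs)); have x2 := XB _ (hB _ (mI s hs))
    unfold QX at x1 x2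
    gcongr
  have sY : ∀ s ∈ Icc a (b - τ), nr ((4:ℝ)/d + 2) (fun x => wd U τ (s, x)) ≤ sSup S := fun s hs =>
    le_csSup bdd ⟨s, hs, rfl⟩
  have : sSup S ≤ (C1 + C2) * τ + sSup S / 2 := by
    refine csSup_le ⟨_, t0, t0m, rfl⟩ ?_
    rintro _ ⟨s, hs, rfl⟩
    exact step _ sY s hs
  intro t ht
  have := sY t ht
  linarith

end
end
end

section
open MeasureTheory Set Filter Topology SchwartzMap FourierTransform
open scoped ENNReal NNReal

noncomputable section

set_option linter.unusedSectionVars false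

section
variable {d : ℕ}

local notation "cj" => starRingEnd ℂ

variable {I : Set ℝ} {U : ℝ × EuclideanSpace ℝ (Fin d) → ℂ}

lemma lim_inv_mul (A : ℝ) : Tendsto (fun n : ℕ => 1 / ((n:ℝ)+1) * A) atTop (𝓝 0) := by
  have := (tendsto_one_div_add_atTop_nhds_zero_nat (𝕜 := ℝ)).mul_const A
  rwa [zero_mul] at this

/-- L2 control of time differences -/
lemma wd_l2_bound (h : Sol I U) {a b B t0 τ Y K0 : ℝ} (hI : Icc a b ⊆ I) (hτ : 0 < τ)
    (hB : ∀ t ∈ Icc a b, QA U t ≤ B) (ht0 : t0 ∈ Icc a (b - τ))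
    (hY : ∀ t ∈ Icc a (b - τ), nr ((4:ℝ)/d + 2) (fun x => wd U τ (t, x)) ≤ Y)
    (h0 : ∫ x, ‖wd U τ (t0, x)‖ ^ 2 ≤ K0) {t : ℝ} (ht : t ∈ Icc a (b - τ)) :
    ∫ x, ‖wd U τ (t, x)‖ ^ 2 ≤ K0 + 20 * (1 + B) ^ ((4:ℝ)/d) * Y ^ 2 * (b - a) := by
  have hp := h.rp
  obtain ⟨c, hc0, hc⟩ := cut_pd_bounds d
  have mI : ∀ s ∈ Icc a (b - τ), s ∈ Icc a b := fun s hs => ⟨hs.1, by linarith [hs.2]⟩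
  have mI' : ∀ s ∈ Icc a (b - τ), s + τ ∈ Icc a b := fun s hs => ⟨by linarith [hs.1], by linarith [hs.2]⟩
  have B0 : 0 ≤ B := (QA_nonneg (U := U) t0).trans (hB t0 (mI _ ht0))
  have Y0 : 0 ≤ Y := (nr_nonneg _ _).trans (hY t0 ht0)
  have rd : ∀ s ∈ Icc a (b - τ), RD (fun x => wd U τ (s, x)) := fun s hs =>
    wd_rd h (hI (mI s hs)) (hI (mI' s hs))
  have mem : ∀ s ∈ Icc a (b - τ), s ∈ I ∩ {t | t + τ ∈ I} := fun s hs => ⟨hI (mI s hs), hI (mI' s hs)⟩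
  have bd : ∀ n : ℕ, ∀ s ∈ Icc a (b - τ), ‖(2 * (∫ x, ∑ k, pd k (cut d n) x * (cj (wd U τ (s, x)) * Dv (dx k) (wd U τ) (s, x)).im)
        - 2 * ∫ x, cut d n x * (cj (wd U τ (s, x)) * gd U τ (s, x)).im)‖
        ≤ 2 * (c / (n+1) * (d+1) * (4 * B + 4 * B)) + 2 * (10 * (1 + B) ^ ((4:ℝ)/d) * (Y * Y)) := by
    intro n s hs
    have hs1 := hI (mI s hs)
    have hs2 := hI (mI' s hs)
    refine (norm_sub_le _ _).trans ?_
    rw [norm_mul, norm_mul, Real.norm_ofNat]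
    have s1 := sum_bound (T := fun k x => pd k (cut d n) x * (cj (wd U τ (s, x)) * Dv (dx k) (wd U τ) (s, x)).im)
      (f := fun x => wd U τ (s, x)) (F := fun k x => Dv (dx k) (wd U τ) (s, x)) (c := c / (n+1)) (by positivity)
      (rd s hs) (fun k => by
        simp only [wd_dx h hs1 hs2]
        exact (h.rd1 hs2 k).sub (h.rd1 hs1 k)) (by
        intro k x
        rw [norm_mul]
        gcongr
        · exact (hc n k x).1
        · refine (Complex.abs_im_le_norm _).trans (le_of_eq ?_)
          rw [norm_mul, RCLike.norm_conj])
    have w1 := wd_sq h hs1 hs2 (hB _ (mI s hs)) (hB _ (mI' s hs))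
    have w2 := wd_dx_sq h hs1 hs2 (hB _ (mI s hs)) (hB _ (mI' s hs))
    have gp := gd_pair h hs1 hs2 (hB _ (mI s hs)) (hB _ (mI' s hs)) (hY s hs) (rd s hs)
    have g1 : ‖∫ x, cut d n x * (cj (wd U τ (s, x)) * gd U τ (s, x)).im‖ ≤ ∫ x, ‖gd U τ (s, x)‖ * ‖wd U τ (s, x)‖ := by
      have gr : RD (fun x => gd U τ (s, x)) := by
        have e : (fun x => gd U τ (s, x)) = fun x => ((‖U (s + τ, x)‖ ^ ((4:ℝ)/d) : ℝ) : ℂ) * U (s + τ, x)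
            - ((‖U (s, x)‖ ^ ((4:ℝ)/d) : ℝ) : ℂ) * U (s, x) := by
          funext x; simp [gd]
        rw [e]
        exact ((h.rd0 hs2).npow hp.le).sub ((h.rd0 hs1).npow hp.le)
      refine norm_integral_le_of_norm_le (gr.norm.mul (rd s hs).norm).integrable (ae_of_all _ fun x => ?_)
      rw [norm_mul, Real.norm_of_nonneg (cut_nonneg d n x)]
      calc _ ≤ 1 * ‖cj (wd U τ (s, x)) * gd U τ (s, x)‖ := by
            gcongr
            · exact cut_le_one d n x
            · exact Complex.abs_im_le_norm _
        _ = _ := by rw [one_mul, norm_mul, RCLike.norm_conj, mul_comm]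
    have e1 : ‖∫ x, ∑ k, pd k (cut d n) x * (cj (wd U τ (s, x)) * Dv (dx k) (wd U τ) (s, x)).im‖ ≤
      c / (n+1) * (d+1) * (4 * B + 4 * B) := s1.trans (by gcongr)
    have e2 : ‖∫ x, cut d n x * (cj (wd U τ (s, x)) * gd U τ (s, x)).im‖ ≤ 10 * (1 + B) ^ ((4:ℝ)/d) * (Y * Y) := by
      refine g1.trans (gp.trans ?_)
      have := hY s hs
      gcongr
    linarith
  have key : ∀ n : ℕ, (∫ x, cut d n x * ‖wd U τ (t, x)‖ ^ 2) - ∫ x, cut d n x * ‖wd U τ (t0, x)‖ ^ 2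
      ≤ 20 * (1 + B) ^ ((4:ℝ)/d) * Y ^ 2 * (b - a) + 1 / ((n:ℝ)+1) * (2 * (c * (d+1) * (8 * B)) * |t - t0|) := by
    intro n
    have m := mean_bound (fun s hs => mass_deriv (wd_eq h τ) (cut_contDiff d n) (cut_compact d n) (mem s hs)) (bd n) ht0 ht
    have ab : |t - t0| ≤ b - a := by
      rw [abs_le]; exact ⟨by linarith [ht.1, ht0.2], by linarith [ht.2, ht0.1]⟩
    refine (le_abs_self _).trans (m.trans ?_)
    rw [add_mul, add_comm]
    refine add_le_add ?_ (le_of_eq ?_)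
    · calc _ ≤ 2 * (10 * (1 + B) ^ ((4:ℝ)/d) * (Y * Y)) * (b - a) := by gcongr
        _ = _ := by ring
    · field_simp; ring
  have l1 := (cut_lim (rd t ht).sq).sub (cut_lim (rd t0 ht0).sq)
  have l2 := (lim_inv_mul (2 * (c * (d+1) * (8 * B)) * |t - t0|)).const_add (20 * (1 + B) ^ ((4:ℝ)/d) * Y ^ 2 * (b - a))
  have := le_of_tendsto_of_tendsto' l1 l2 key
  linarith

lemma cut_time_cont (h : Sol I U) (n : ℕ) :
    ContinuousOn (fun t => ∫ x, cut d n x * ‖Dv (dt d) U (t, x)‖ ^ 2) I := by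
  refine continuousOn_integral_of_compact_support (f := fun t x => cut d n x * ‖Dv (dt d) U (t, x)‖ ^ 2)
    (cut_compact d n) ?_ ?_
  · exact ((cut_contDiff d n).continuous.comp continuous_snd).continuousOn.mul
      ((Dv_smI h.se.sm (dt d)).cont.norm.pow 2)
  · intro t x _ hx
    rw [image_eq_zero_of_notMem_tsupport hx, zero_mul]

lemma quot_bound (h : Sol I U) {t b M τ : ℝ} (hI : Icc t b ⊆ I) (x : EuclideanSpace ℝ (Fin d))
    (hM : ∀ s ∈ Icc t b, ‖Dv (dt d) U (s, x)‖ ≤ M) (h0 : 0 < τ) (hb : t + τ ≤ b) :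
    ‖τ⁻¹ • wd U τ (t, x)‖ ≤ M := by
  have := mean_bound (h := fun s => U (s, x)) (h' := fun s => Dv (dt d) U (s, x)) (c := M) (a := t) (b := b)
    (fun s hs => h.se.sm.time (hI hs) x) hM ⟨le_rfl, by linarith⟩
    (⟨by linarith, hb⟩ : t + τ ∈ Icc t b)
  rw [add_sub_cancel_left, abs_of_pos h0] at this
  rw [norm_smul, norm_inv, Real.norm_of_nonneg h0.le, wd_apply, inv_mul_le_iff₀ h0, mul_comm τ]
  exact this

/-- passing from difference quotients to the time derivative -/
lemma quot_limit (h : Sol I U) {t b C ε : ℝ} (hI : Icc t b ⊆ I) (htb : t < b) (hε : 0 < ε) (n : ℕ)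
    (hC : ∀ τ, 0 < τ → τ < ε → t + τ ≤ b → ∫ x, cut d n x * ‖wd U τ (t, x)‖ ^ 2 ≤ C * τ ^ 2) :
    ∫ x, cut d n x * ‖Dv (dt d) U (t, x)‖ ^ 2 ≤ C := by
  have hc := cut_compact d n
  obtain ⟨M, hM⟩ := (isCompact_Icc.prod hc).exists_bound_of_continuousOn (f := Dv (dt d) U) (s := Icc t b ×ˢ tsupport (cut d n))
    ((Dv_smI h.se.sm (dt d)).cont.mono (prod_mono hI (subset_univ _)))
  have tI : t ∈ I := hI ⟨le_rfl, htb.le⟩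
  have ev : ∀ᶠ τ in 𝓝[>] (0:ℝ), 0 < τ ∧ τ < ε ∧ t + τ ≤ b := by
    have e1 : Ioo (0:ℝ) (min ε (b - t)) ∈ 𝓝[>] (0:ℝ) := Ioo_mem_nhdsGT (lt_min hε (by linarith))
    filter_upwards [e1] with τ hτ
    have := lt_min_iff.1 hτ.2
    exact ⟨hτ.1, this.1, by linarith [this.2]⟩
  have lim : Tendsto (fun τ => ∫ x, cut d n x * ‖τ⁻¹ • wd U τ (t, x)‖ ^ 2) (𝓝[>] (0:ℝ))
      (𝓝 (∫ x, cut d n x * ‖Dv (dt d) U (t, x)‖ ^ 2)) := by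
    refine tendsto_integral_filter_of_dominated_convergence (fun x => cut d n x * M ^ 2) ?_ ?_ ?_ ?_
    · filter_upwards [ev] with τ hτ
      have r := wd_rd h tI (hI ⟨by linarith [hτ.1], hτ.2.2⟩ : t + τ ∈ I)
      have c1 : Continuous (fun x => τ⁻¹ • wd U τ (t, x)) := r.1.const_smul τ⁻¹
      have c2 : Continuous (fun x => cut d n x * ‖τ⁻¹ • wd U τ (t, x)‖ ^ 2) :=
        (cut_contDiff d n).continuous.mul (c1.norm.pow 2)
      exact c2.aestronglyMeasurable
    · filter_upwards [ev] with τ hτ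
      refine ae_of_all _ fun x => ?_
      rw [Real.norm_of_nonneg (mul_nonneg (cut_nonneg d n x) (by positivity))]
      by_cases hx : x ∈ tsupport (cut d n)
      · refine mul_le_mul_of_nonneg_left ?_ (cut_nonneg d n x)
        exact pow_le_pow_left₀ (norm_nonneg _) (quot_bound h hI x (fun s hs => hM (s, x) ⟨hs, hx⟩) hτ.1 hτ.2.2) 2
      · rw [image_eq_zero_of_notMem_tsupport hx]; simp
    · exact (((cut_contDiff d n).continuous).integrable_of_hasCompactSupport hc).mul_const _
    · refine ae_of_all _ fun x => ?_
      have := (h.se.sm.time tI x).tendsto_slope_zero_right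
      refine (Tendsto.pow (Tendsto.norm ?_) 2).const_mul _
      simp only [wd_apply]
      exact this
  refine le_of_tendsto lim ?_
  filter_upwards [ev] with τ hτ
  have := hC τ hτ.1 hτ.2.1 hτ.2.2
  have e : ∀ x, cut d n x * ‖τ⁻¹ • wd U τ (t, x)‖ ^ 2 = (τ⁻¹)^2 * (cut d n x * ‖wd U τ (t, x)‖ ^ 2) := by
    intro x
    rw [norm_smul, norm_inv, Real.norm_of_nonneg hτ.1.le]; ring
  simp only [e]
  rw [integral_const_mul, inv_pow, inv_mul_le_iff₀ (by have := hτ.1; positivity), mul_comm]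
  exact this

/-- L2 control of the time derivative on short intervals -/
lemma dt_l2 (h : Sol I U) {a b B : ℝ} (hab : a < b) (hI : Icc a b ⊆ I) (hB : ∀ t ∈ Icc a b, QA U t ≤ B)
    (hT : 10 * (1 + B) ^ ((4:ℝ)/d) * dD d * (b - a) ^ (1 - dE d) / (1 - dE d) ≤ 1/2) :
    ∃ C, ∀ t ∈ Icc a b, ∫ x, ‖Dv (dt d) U (t, x)‖ ^ 2 ≤ C := by
  obtain ⟨t0, δ, N, hδ, hN0, hsub, hN⟩ := base_pt h hab hI
  obtain ⟨C, hC0, hC⟩ := wd_nr_bound h hI hB hT hδ hN0 hsub hN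
  have k0 := jK_nonneg (d := d)
  set D := N ^ 2 * jK d + 20 * (1 + B) ^ ((4:ℝ)/d) * C ^ 2 * (b - a) with hD
  have m1 := hsub (⟨by linarith, by linarith⟩ : t0 ∈ Icc (t0 - δ) (t0 + δ))
  have m2 := hsub (⟨by linarith, by linarith⟩ : t0 + δ ∈ Icc (t0 - δ) (t0 + δ))
  have l2 : ∀ τ, 0 < τ → τ < δ/2 → ∀ t ∈ Icc a (b - τ), ∫ x, ‖wd U τ (t, x)‖ ^ 2 ≤ D * τ ^ 2 := by
    intro τ hτ hτδ t ht
    have t0m : t0 ∈ Icc a (b - τ) := ⟨m1.1, by linarith [m2.2]⟩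
    have rd := wd_rd h (τ := τ) (hI m1) (hI ⟨by linarith [m1.1], by linarith [t0m.2]⟩)
    have w := nr_weight rd (ρ := 2) (c := N * τ) (by norm_num) (by positivity)
      (wd_small h (hsub.trans hI) hN hτ ⟨by linarith, by linarith⟩ ⟨by linarith, by linarith⟩)
    have w' : ∫ x, ‖wd U τ (t0, x)‖ ^ 2 ≤ (N * τ) ^ 2 * jK d := by
      simpa only [Real.rpow_two, jK] using w
    refine (wd_l2_bound h hI hτ hB t0m (hC τ hτ hτδ) w' ht).trans (le_of_eq ?_)
    rw [hD]; ring
  have b1 : ∀ n : ℕ, ∀ t ∈ Ico a b, ∫ x, cut d n x * ‖Dv (dt d) U (t, x)‖ ^ 2 ≤ D := by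
    intro n t ht
    refine quot_limit h ((Icc_subset_Icc_left ht.1).trans hI) ht.2 (half_pos hδ) n fun τ h1 h2 h3 => ?_
    refine le_trans ?_ (l2 τ h1 h2 t ⟨ht.1, by linarith⟩)
    have r := wd_rd h (hI ⟨ht.1, ht.2.le⟩) (hI ⟨by linarith [ht.1], h3⟩ : t + τ ∈ I)
    refine integral_mono_of_nonneg (ae_of_all _ fun x => mul_nonneg (cut_nonneg d n x) (by positivity))
      r.sq.integrable (ae_of_all _ fun x => ?_)
    exact mul_le_of_le_one_left (by positivity) (cut_le_one d n x)
  have b2 : ∀ n : ℕ, ∀ t ∈ Icc a b, ∫ x, cut d n x * ‖Dv (dt d) U (t, x)‖ ^ 2 ≤ D := by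
    intro n t ht
    have c1 := ContinuousOn.preimage_isClosed_of_isClosed ((cut_time_cont h n).mono hI) isClosed_Icc (isClosed_Iic (a := D))
    have : closure (Ico a b) ⊆ Icc a b ∩ (fun t => ∫ x, cut d n x * ‖Dv (dt d) U (t, x)‖ ^ 2) ⁻¹' Iic D := closure_minimal (fun s hs => ⟨Ico_subset_Icc_self hs, b1 n s hs⟩) c1
    rw [closure_Ico hab.ne] at this
    exact (this ht).2
  exact ⟨D, fun t ht => le_of_tendsto' (cut_lim (h.rdt (hI ht)).sq) fun n => b2 n t ht⟩

end
end
end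

section
open MeasureTheory Set Filter Topology SchwartzMap FourierTransform
open scoped ENNReal NNReal

noncomputable section

set_option linter.unusedSectionVars false

section
variable {d : ℕ}

local notation "cj" => starRingEnd ℂ

variable {I : Set ℝ} {U : ℝ × EuclideanSpace ℝ (Fin d) → ℂ}

lemma Sol.rE (h : Sol I U) {t} (ht : t ∈ I) :
    RD (fun x => (1/2) * ∑ k, ‖Dv (dx k) U (t, x)‖ ^ 2 - (1 / (4/d + 2)) * ‖U (t, x)‖ ^ ((4:ℝ)/d + 2)) :=
  ((h.rK ht).const_mul (1/2)).sub ((h.rX ht).const_mul (1 / (4/d + 2)))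

lemma Sol.iE (h : Sol I U) {t} (ht : t ∈ I) :
    ∫ x, ((1/2) * ∑ k, ‖Dv (dx k) U (t, x)‖ ^ 2 - (1 / (4/d + 2)) * ‖U (t, x)‖ ^ ((4:ℝ)/d + 2)) = QE U t := by
  rw [integral_sub ((h.rK ht).integrable.const_mul _) ((h.rX ht).integrable.const_mul _),
    integral_const_mul, integral_const_mul]
  rfl

lemma energy_short (h : Sol I U) {a b B : ℝ} (hab : a < b) (hI : Icc a b ⊆ I) (hB : ∀ t ∈ Icc a b, QA U t ≤ B)
    (hT : 10 * (1 + B) ^ ((4:ℝ)/d) * dD d * (b - a) ^ (1 - dE d) / (1 - dE d) ≤ 1/2) {s t : ℝ}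
    (hs : s ∈ Icc a b) (ht : t ∈ Icc a b) : QE U t = QE U s := by
  obtain ⟨c, hc0, hc⟩ := cut_pd_bounds d
  obtain ⟨C, hC⟩ := dt_l2 h hab hI hB hT
  have bd : ∀ n : ℕ, ∀ s ∈ Icc a b,
      ‖(-∫ x, ∑ k, pd k (cut d n) x * (cj (Dv (dx k) U (s, x)) * Dv (dt d) U (s, x)).re)‖
        ≤ c / (n+1) * (d+1) * (C + B) := by
    intro n s hs
    rw [norm_neg]
    have := sum_bound (T := fun k x => pd k (cut d n) x * (cj (Dv (dx k) U (s, x)) * Dv (dt d) U (s, x)).re)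
      (f := fun x => Dv (dt d) U (s, x)) (F := fun k x => Dv (dx k) U (s, x)) (c := c / (n+1)) (by positivity)
      (h.rdt (hI hs)) (h.rd1 (hI hs)) (by
        intro k x
        rw [norm_mul]
        gcongr
        · exact (hc n k x).1
        · refine (Complex.abs_re_le_norm _).trans (le_of_eq ?_)
          rw [norm_mul, RCLike.norm_conj, mul_comm])
    refine this.trans ?_
    have k1 : QK U s ≤ B := by
      refine le_trans ?_ (hB s hs)
      have := QV_nonneg (U := U) s; have := QX_nonneg (U := U) s; have := QM_nonneg (U := U) s
      unfold QA; linarith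
    have := hC s hs
    unfold QK at k1
    gcongr
  have key : ∀ n : ℕ, ‖(∫ x, cut d n x * ((1/2) * ∑ k, ‖Dv (dx k) U (t, x)‖ ^ 2
        - (1 / (4/d + 2)) * ‖U (t, x)‖ ^ ((4:ℝ)/d + 2))) - ∫ x, cut d n x * ((1/2) * ∑ k, ‖Dv (dx k) U (s, x)‖ ^ 2
        - (1 / (4/d + 2)) * ‖U (s, x)‖ ^ ((4:ℝ)/d + 2))‖
      ≤ c / (n+1) * (d+1) * (C + B) * |t - s| := fun n =>
    mean_bound (fun s hs => energy_deriv h (cut_contDiff d n) (cut_compact d n) (hI hs)) (bd n) hs ht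
  have l1 := ((cut_lim (h.rE (hI ht))).sub (cut_lim (h.rE (hI hs)))).norm
  have l2 : Tendsto (fun n : ℕ => c / ((n:ℝ)+1) * (d+1) * (C + B) * |t - s|) atTop (𝓝 0) := by
    refine (lim_inv_mul (c * (d+1) * (C+B) * |t - s|)).congr fun n => ?_
    ring
  have := le_of_tendsto_of_tendsto' l1 l2 key
  rw [h.iE (hI ht), h.iE (hI hs)] at this
  exact sub_eq_zero.1 (norm_le_zero_iff.1 this)

lemma short_time (hd : 0 < d) (B : ℝ) (hB : 0 ≤ B) : ∃ T : ℝ, 0 < T ∧ ∀ L, 0 < L → L ≤ T →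
    10 * (1 + B) ^ ((4:ℝ)/d) * dD d * L ^ (1 - dE d) / (1 - dE d) ≤ 1/2 := by
  have D0 := dD_nonneg hd
  have E1 := dE_lt hd
  have e : 0 < 1 - dE d := by linarith
  set A := 10 * (1 + B) ^ ((4:ℝ)/d) * dD d / (1 - dE d) with hA
  have A0 : 0 ≤ A := by positivity
  refine ⟨(1 / (2 * (A + 1))) ^ (1 / (1 - dE d)), by positivity, fun L h0 hL => ?_⟩
  have h1 : L ^ (1 - dE d) ≤ 1 / (2 * (A+1)) := by
    calc _ ≤ ((1 / (2 * (A + 1))) ^ (1 / (1 - dE d))) ^ (1 - dE d) :=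
          Real.rpow_le_rpow h0.le hL e.le
      _ = _ := by rw [← Real.rpow_mul (by positivity), one_div_mul_cancel e.ne', Real.rpow_one]
  calc _ = A * L ^ (1 - dE d) := by rw [hA]; ring
    _ ≤ A * (1 / (2 * (A+1))) := by gcongr
    _ ≤ 1/2 := by
      rw [mul_one_div, div_le_div_iff₀ (by positivity) (by norm_num)]; linarith

lemma energy_const (h : Sol I U) {a b B : ℝ} (hI : Icc a b ⊆ I) (hB : ∀ t ∈ Icc a b, QA U t ≤ B) {s t : ℝ}
    (hs : s ∈ Icc a b) (ht : t ∈ Icc a b) : QE U t = QE U s := by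
  have B0 : 0 ≤ B := (QA_nonneg (U := U) s).trans (hB s hs)
  obtain ⟨T, hT0, hT⟩ := short_time h.hd B B0
  have near : ∀ s t, s ∈ Icc a b → t ∈ Icc a b → s < t → t - s ≤ T → QE U t = QE U s := by
    intro s t hs ht hst hl
    have sub : Icc s t ⊆ Icc a b := Icc_subset_Icc hs.1 ht.2
    exact energy_short h hst (sub.trans hI) (fun r hr => hB r (sub hr)) (hT _ (by linarith) hl)
      ⟨le_rfl, hst.le⟩ ⟨hst.le, le_rfl⟩
  have main : ∀ s t, s ∈ Icc a b → t ∈ Icc a b → s < t → QE U t = QE U s := by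
    intro s t hs ht hst
    obtain ⟨n, hn⟩ := exists_nat_gt ((t - s) / T)
    have hn0 : (0:ℝ) < n := lt_trans (by have : 0 < t - s := by linarith
                                         positivity) hn
    have hl : (t - s) / n ≤ T := by
      rw [div_lt_iff₀ hT0] at hn
      rw [div_le_iff₀ hn0]; linarith
    have hl0 : 0 < (t - s) / n := by have : 0 < t - s := by linarith
                                     positivity
    have ind : ∀ k : ℕ, k ≤ n → QE U (s + k * ((t - s)/n)) = QE U s := by
      intro k
      induction k with
      | zero => intro _; simp
      | succ k ih =>
        intro hk
        rw [← ih (by omega)]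
        have mem : ∀ j : ℕ, j ≤ n → s + j * ((t-s)/n) ∈ Icc a b := by
          intro j hj
          have hj' : (j:ℝ) ≤ n := by exact_mod_cast hj
          have : (j:ℝ) * ((t-s)/n) ≤ t - s := by
            calc _ ≤ (n:ℝ) * ((t-s)/n) := by gcongr
              _ = _ := by field_simp
          have : 0 ≤ (j:ℝ) * ((t-s)/n) := by positivity
          exact ⟨by linarith [hs.1], by linarith [ht.2]⟩
        refine near _ _ (mem k (by omega)) (mem (k+1) hk) ?_ ?_
        · push_cast; linarith
        · push_cast; linarith
    have := ind n le_rfl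
    rwa [mul_div_cancel₀ _ hn0.ne', add_sub_cancel] at this
  rcases lt_trichotomy s t with h1 | h1 | h1
  · exact main s t hs ht h1
  · rw [h1]
  · exact (main t s ht hs h1).symm

/-- conservation laws and variance on an interval with bounded size -/
lemma cons_interval (h : Sol I U) {a b B : ℝ} (hI : Icc a b ⊆ I) (hB : ∀ t ∈ Icc a b, QA U t ≤ B) {s t : ℝ}
    (hs : s ∈ Icc a b) (ht : t ∈ Icc a b) : QM U t = QM U s ∧ QE U t = QE U s ∧
      QV U t = QV U s + QP U s * (t - s) + 8 * QE U s * (t - s) ^ 2 :=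
  ⟨mass_const h hI hB hs ht, energy_const h hI hB hs ht,
    var_quad h hI hB (fun r hr => energy_const h hI hB hs hr) hs ht⟩

end
end
end

section
open MeasureTheory Set Filter Topology SchwartzMap FourierTransform
open scoped ENNReal NNReal

noncomputable section

set_option linter.unusedSectionVars false

section
variable {d : ℕ}

local notation "cj" => starRingEnd ℂ

variable {I : Set ℝ} {U : ℝ × EuclideanSpace ℝ (Fin d) → ℂ}

/-- density of the total size -/
def qa (U : ℝ × EuclideanSpace ℝ (Fin d) → ℂ) (t : ℝ) (x : EuclideanSpace ℝ (Fin d)) : ℝ :=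
  ‖U (t, x)‖ ^ 2 + ‖x‖ ^ 2 * ‖U (t, x)‖ ^ 2 + (∑ k, ‖Dv (dx k) U (t, x)‖ ^ 2) + ‖U (t, x)‖ ^ ((4:ℝ)/d + 2)

lemma qa_nonneg (t : ℝ) (x) : 0 ≤ qa U t x := by
  unfold qa
  have : 0 ≤ ∑ k, ‖Dv (dx k) U (t, x)‖ ^ 2 := Finset.sum_nonneg fun _ _ => by positivity
  positivity

lemma Sol.rA (h : Sol I U) {t} (ht : t ∈ I) : RD (qa U t) :=
  (((h.rM ht).add (h.rV ht)).add (h.rK ht)).add (h.rX ht)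

lemma Sol.iA (h : Sol I U) {t} (ht : t ∈ I) : ∫ x, qa U t x = QA U t := by
  have i1 := (h.rM ht).integrable
  have i2 := (h.rV ht).integrable
  have i3 := (h.rK ht).integrable
  have i4 := (h.rX ht).integrable
  unfold qa QA QM QV QK QX
  have e0 := integral_add ((i1.add i2).add i3) i4
  have e1 := integral_add (i1.add i2) i3
  have e2 := integral_add i1 i2
  simp only [Pi.add_apply] at e0 e1 e2
  rw [e0, e1, e2]

lemma cut_qa_cont (h : Sol I U) (n : ℕ) : ContinuousOn (fun t => ∫ x, cut d n x * qa U t x) I := by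
  have hp := h.rp
  refine continuousOn_integral_of_compact_support (f := fun t x => cut d n x * qa U t x)
    (cut_compact d n) ?_ ?_
  · have c0 := h.se.sm.cont.norm
    have c1 : ContinuousOn (fun p : ℝ × EuclideanSpace ℝ (Fin d) => qa U p.1 p.2) (I ×ˢ univ) := by
      unfold qa
      refine (((c0.pow 2).add (ContinuousOn.mul (by fun_prop) (c0.pow 2))).add ?_).add
        (c0.rpow_const fun _ _ => Or.inr (by linarith))
      exact continuousOn_finsetSum _ fun k _ => (Dv_smI h.se.sm (dx k)).cont.norm.pow 2
    exact ((cut_contDiff d n).continuous.comp continuous_snd).continuousOn.mul c1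
  · intro t x _ hx
    rw [image_eq_zero_of_notMem_tsupport hx, zero_mul]

lemma QA_le_iff (h : Sol I U) {t} (ht : t ∈ I) (c : ℝ) :
    QA U t ≤ c ↔ ∀ n : ℕ, ∫ x, cut d n x * qa U t x ≤ c := by
  rw [← h.iA ht]
  constructor
  · intro hc n
    refine le_trans ?_ hc
    refine integral_mono_of_nonneg (ae_of_all _ fun x => mul_nonneg (cut_nonneg d n x) (qa_nonneg t x))
      (h.rA ht).integrable (ae_of_all _ fun x => ?_)
    exact mul_le_of_le_one_left (qa_nonneg t x) (cut_le_one d n x)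
  · intro hc
    exact le_of_tendsto' (cut_lim (h.rA ht)) hc

lemma QA_closure (h : Sol I U) {a b c : ℝ} (hab : a < b) (hI : Icc a b ⊆ I) (hc : ∀ t ∈ Ioo a b, QA U t ≤ c) :
    ∀ t ∈ Icc a b, QA U t ≤ c := by
  intro t ht
  rw [QA_le_iff h (hI ht)]
  intro n
  have c1 := ContinuousOn.preimage_isClosed_of_isClosed ((cut_qa_cont h n).mono hI) isClosed_Icc (isClosed_Iic (a := c))
  have : closure (Ioo a b) ⊆ Icc a b ∩ (fun t => ∫ x, cut d n x * qa U t x) ⁻¹' Iic c :=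
    closure_minimal (fun s hs => ⟨Ioo_subset_Icc_self hs,
      (QA_le_iff h (hI (Ioo_subset_Icc_self hs)) c).1 (hc s hs) n⟩) c1
  rw [closure_Ioo hab.ne] at this
  exact (this ht).2

lemma QP_le (h : Sol I U) {t} (ht : t ∈ I) : |QP U t| ≤ 2 * (d + 1) * QA U t := by
  unfold QP
  have key : ∀ k : Fin d, |∫ x, (4 * x k) * (cj (U (t, x)) * Dv (dx k) U (t, x)).im| ≤
      2 * (QV U t + ∫ x, ‖Dv (dx k) U (t, x)‖ ^ 2) := by
    intro k
    have i1 := (h.rV ht).integrable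
    have i2 := (h.rd1 ht k).sq.integrable
    unfold QV
    rw [← integral_add i1 i2, ← integral_const_mul]
    rw [← Real.norm_eq_abs]
    refine norm_integral_le_of_norm_le ((i1.add i2).const_mul 2) (ae_of_all _ fun x => ?_)
    rw [norm_mul]
    have a1 : ‖4 * x k‖ ≤ 4 * ‖x‖ := by
      rw [norm_mul, Real.norm_ofNat]; gcongr; exact coord_le x k
    have a2 : ‖(cj (U (t, x)) * Dv (dx k) U (t, x)).im‖ ≤ ‖U (t, x)‖ * ‖Dv (dx k) U (t, x)‖ := by
      refine (Complex.abs_im_le_norm _).trans (le_of_eq ?_)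
      rw [norm_mul, RCLike.norm_conj]
    calc _ ≤ (4 * ‖x‖) * (‖U (t, x)‖ * ‖Dv (dx k) U (t, x)‖) := by gcongr
      _ ≤ _ := by nlinarith [sq_nonneg (‖x‖ * ‖U (t, x)‖ - ‖Dv (dx k) U (t, x)‖)]
  have sK : ∑ k, ∫ x, ‖Dv (dx k) U (t, x)‖ ^ 2 = QK U t := by
    unfold QK
    rw [integral_finsetSum _ fun k _ => (h.rd1 ht k).sq.integrable]
  refine (Finset.abs_sum_le_sum_abs _ _).trans ((Finset.sum_le_sum fun k _ => key k).trans ?_)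
  rw [← Finset.mul_sum, Finset.sum_add_distrib, sK, Finset.sum_const, Finset.card_univ, Fintype.card_fin,
    nsmul_eq_mul]
  have h1 := QV_nonneg (U := U) t; have := QX_nonneg (U := U) t; have := QM_nonneg (U := U) t
  have h2 := QK_nonneg (U := U) t
  have hd0 : (0:ℝ) ≤ d := by positivity
  unfold QA
  nlinarith [mul_nonneg hd0 h1, mul_nonneg hd0 h2, mul_nonneg hd0 (QX_nonneg (U := U) t), mul_nonneg hd0 (QM_nonneg (U := U) t)]

lemma QE_le (h : Sol I U) (t : ℝ) : |QE U t| ≤ QA U t := by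
  have h1 := QV_nonneg (U := U) t; have h3 := QX_nonneg (U := U) t; have := QM_nonneg (U := U) t
  have h2 := QK_nonneg (U := U) t
  have hp := h.rp
  have c0 : 0 ≤ (1 / ((4:ℝ)/d + 2)) := by positivity
  have c1 : (1 / ((4:ℝ)/d + 2)) ≤ 1 := by rw [div_le_one (by positivity)]; linarith
  have m0 := mul_nonneg c0 h3
  have m1 := mul_le_mul_of_nonneg_right c1 h3
  unfold QA QE
  rw [abs_le]
  constructor <;> linarith

lemma ext_bound (h : Sol I U) {p q : ℝ} (hI : Icc p q ⊆ I) (C : ℝ) : ∃ C', ∀ α t, α ∈ Icc p q → t ∈ Icc p q →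
    QA U α ≤ C → (∃ B, ∀ s ∈ uIcc α t, QA U s ≤ B) → QA U t ≤ C' := by
  set B' := C + 2 * (d + 1) * C * (q - p) + 8 * C * (q - p) ^ 2 with hB'
  obtain ⟨C', hC'⟩ := gna h isCompact_Icc hI B'
  refine ⟨C', fun α t hα ht hC ⟨B, hB⟩ => ?_⟩
  have C0 : 0 ≤ C := (QA_nonneg (U := U) α).trans hC
  have us : uIcc α t ⊆ Icc p q := uIcc_subset_Icc hα ht
  have qp : 0 ≤ q - p := by linarith [hα.1, hα.2]
  obtain ⟨e1, e2, e3⟩ := cons_interval h (a := min α t) (b := max α t) (B := B) (us.trans hI) hB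
    (s := α) (t := t) left_mem_uIcc right_mem_uIcc
  have h1 := QV_nonneg (U := U) α; have h3 := QX_nonneg (U := U) α; have h4 := QM_nonneg (U := U) α
  have h2 := QK_nonneg (U := U) α
  have ee := QE_le h α
  have pp := QP_le h (hI hα)
  have ab : |t - α| ≤ q - p := by
    rw [abs_le]; exact ⟨by linarith [ht.1, hα.2], by linarith [ht.2, hα.1]⟩
  have p1 : 0 ≤ 2 * (d + 1) * C * (q - p) := by positivity
  have p2 : 0 ≤ 8 * C * (q - p) ^ 2 := by positivity
  have b1 : QP U α * (t - α) ≤ 2 * (d + 1) * C * (q - p) := by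
    refine (le_abs_self _).trans ?_
    rw [abs_mul]
    have : |QP U α| ≤ 2 * (d+1) * C := pp.trans (by gcongr)
    gcongr
  have b2 : 8 * QE U α * (t - α) ^ 2 ≤ 8 * C * (q - p) ^ 2 := by
    rw [← sq_abs (t - α)]
    have : QE U α ≤ C := (le_abs_self _).trans (ee.trans hC)
    gcongr
  refine hC' t ht ?_ ?_ ?_
  · rw [e1]; unfold QA at hC; linarith
  · rw [e3]
    have : QV U α ≤ C := by unfold QA at hC; linarith
    linarith
  · rw [e2]
    have : QE U α ≤ C := (le_abs_self _).trans (ee.trans hC)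
    linarith

/-- times of local boundedness -/
def gset (U : ℝ × EuclideanSpace ℝ (Fin d) → ℂ) : Set ℝ := {t | ∃ B, ∀ᶠ s in 𝓝 t, QA U s ≤ B}

lemma gset_open : IsOpen (gset U) := by
  rw [isOpen_iff_mem_nhds]
  rintro t ⟨B, hB⟩
  filter_upwards [eventually_eventually_nhds.2 hB] with s hs
  exact ⟨B, hs⟩

lemma gset_compact {K : Set ℝ} (hK : IsCompact K) (hG : K ⊆ gset U) : ∃ B, ∀ s ∈ K, QA U s ≤ B := by
  refine hK.induction_on (p := fun S => ∃ B, ∀ s ∈ S, QA U s ≤ B) ⟨0, by simp⟩ ?_ ?_ ?_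
  · rintro S T hST ⟨B, hB⟩
    exact ⟨B, fun s hs => hB s (hST hs)⟩
  · rintro S T ⟨B, hB⟩ ⟨B', hB'⟩
    refine ⟨max B B', fun s hs => ?_⟩
    rcases hs with hs | hs
    · exact (hB s hs).trans (le_max_left _ _)
    · exact (hB' s hs).trans (le_max_right _ _)
  · intro t ht
    obtain ⟨B, hB⟩ := hG ht
    exact ⟨_, mem_nhdsWithin_of_mem_nhds hB, B, fun s hs => hs⟩

lemma closed_bound (h : Sol I U) {a b : ℝ} (hab : a < b) (hI : Icc a b ⊆ I) (hG : Ioo a b ⊆ gset U) :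
    ∃ B, ∀ t ∈ Icc a b, QA U t ≤ B := by
  obtain ⟨C', hC'⟩ := ext_bound h hI (QA U ((a+b)/2))
  have m : (a+b)/2 ∈ Ioo a b := ⟨by linarith, by linarith⟩
  refine ⟨C', QA_closure h hab hI fun t ht => ?_⟩
  refine hC' _ t (Ioo_subset_Icc_self m) (Ioo_subset_Icc_self ht) le_rfl ?_
  refine gset_compact isCompact_uIcc (Subset.trans ?_ hG)
  exact (ordConnected_Ioo).uIcc_subset m ht

lemma gset_all (h : Sol I U) : I ⊆ gset U := by
  by_contra hne
  have hI := h.se.op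
  have hF : (I ∩ (gset U)ᶜ).Nonempty := by
    obtain ⟨t, ht, ht'⟩ := not_subset.1 hne
    exact ⟨t, ht, ht'⟩
  set F := I ∩ (gset U)ᶜ with hFd
  have lc : IsLocallyClosed F := hI.isLocallyClosed.inter gset_open.isClosed_compl.isLocallyClosed
  haveI : LocallyCompactSpace F := lc.locallyCompactSpace
  haveI : Nonempty F := hF.to_subtype
  have cl : ∀ n : ℕ, IsClosed {t : F | QA U (t:ℝ) ≤ n} := by
    intro n
    have e : {t : F | QA U (t:ℝ) ≤ n} = ⋂ m : ℕ, {t : F | ∫ x, cut d m x * qa U (t:ℝ) x ≤ n} := by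
      ext t
      rw [mem_iInter]
      exact QA_le_iff h t.2.1 n
    rw [e]
    refine isClosed_iInter fun m => ?_
    refine isClosed_le ?_ continuous_const
    exact (cut_qa_cont h m).comp_continuous continuous_subtype_val (fun t => t.2.1)
  have un : ⋃ n : ℕ, {t : F | QA U (t:ℝ) ≤ n} = univ := by
    rw [eq_univ_iff_forall]
    intro t
    obtain ⟨n, hn⟩ := exists_nat_ge (QA U (t:ℝ))
    exact mem_iUnion.2 ⟨n, hn⟩
  obtain ⟨n, t1, ht1⟩ := nonempty_interior_of_iUnion_of_closed cl un
  have nb : {t : F | QA U (t:ℝ) ≤ n} ∈ 𝓝 t1 := mem_interior_iff_mem_nhds.1 ht1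
  rw [nhds_subtype_eq_comap, mem_comap] at nb
  obtain ⟨V, hV, hVs⟩ := nb
  obtain ⟨ε, hε, hb⟩ := Metric.nhds_basis_closedBall.mem_iff.1 (inter_mem hV (hI.mem_nhds t1.2.1))
  rw [Real.closedBall_eq_Icc] at hb
  set t2 : ℝ := (t1:ℝ) with ht2
  have JI : Icc (t2 - ε) (t2 + ε) ⊆ I := fun s hs => (hb hs).2
  have JF : ∀ s ∈ Icc (t2 - ε) (t2 + ε), s ∉ gset U → QA U s ≤ n := by
    intro s hs hs'
    exact hVs (show (⟨s, JI hs, hs'⟩ : F) ∈ _ from (hb hs).1)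
  obtain ⟨C', hC'⟩ := ext_bound h JI n
  have t2m : t2 ∈ Icc (t2 - ε) (t2 + ε) := ⟨by linarith, by linarith⟩
  have t2G : t2 ∉ gset U := t1.2.2
  have all : ∀ t ∈ Icc (t2 - ε) (t2 + ε), QA U t ≤ max (n:ℝ) C' := by
    intro t ht
    by_cases hg : t ∈ gset U
    · refine le_trans ?_ (le_max_right _ _)
      have hnt : t2 ≠ t := fun e => t2G (e ▸ hg)
      rcases lt_or_gt_of_ne hnt with hlt | hlt
      · have cS : IsCompact ((gset U)ᶜ ∩ Icc t2 t) := isCompact_Icc.inter_left gset_open.isClosed_compl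
        obtain ⟨α, hα, hα2⟩ := cS.exists_isGreatest ⟨t2, t2G, le_rfl, hlt.le⟩
        have αt : α < t := lt_of_le_of_ne hα.2.2 fun e => hα.1 (e ▸ hg)
        have αm : α ∈ Icc (t2 - ε) (t2 + ε) := ⟨by linarith [hα.2.1], by linarith [hα.2.2, ht.2]⟩
        have sub : Ioo α t ⊆ gset U := by
          intro s hs
          by_contra hs'
          have := hα2 ⟨hs', hα.2.1.trans hs.1.le, hs.2.le⟩
          linarith [hs.1]
        have := closed_bound h αt ((Icc_subset_Icc αm.1 ht.2).trans JI) sub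
        rw [← uIcc_of_le αt.le] at this
        exact hC' α t αm ht (JF α αm hα.1) this
      · have cS : IsCompact ((gset U)ᶜ ∩ Icc t t2) := isCompact_Icc.inter_left gset_open.isClosed_compl
        obtain ⟨α, hα, hα2⟩ := cS.exists_isLeast ⟨t2, t2G, hlt.le, le_rfl⟩
        have αt : t < α := lt_of_le_of_ne hα.2.1 fun e => hα.1 (e ▸ hg)
        have αm : α ∈ Icc (t2 - ε) (t2 + ε) := ⟨by linarith [hα.2.1, ht.1], by linarith [hα.2.2]⟩
        have sub : Ioo t α ⊆ gset U := by
          intro s hs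
          by_contra hs'
          have := hα2 ⟨hs', hs.1.le, hs.2.le.trans hα.2.2⟩
          linarith [hs.2]
        have := closed_bound h αt ((Icc_subset_Icc ht.1 αm.2).trans JI) sub
        rw [← uIcc_of_ge αt.le] at this
        exact hC' α t αm ht (JF α αm hα.1) this
    · exact (JF t ht hg).trans (le_max_left _ _)
  exact t2G ⟨max (n:ℝ) C', by
    filter_upwards [Icc_mem_nhds (by linarith : t2 - ε < t2) (by linarith : t2 < t2 + ε)] with s hs
    exact all s hs⟩

/-- the virial identity for space-time functions -/
lemma virial (h : Sol I U) {t : ℝ} (ht : t ∈ I) : deriv (deriv (QV U)) t = 16 * QE U t := by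
  obtain ⟨B, hB⟩ := gset_all h ht
  obtain ⟨ε, hε, hb⟩ := Metric.nhds_basis_closedBall.mem_iff.1 (inter_mem hB (h.se.op.mem_nhds ht))
  rw [Real.closedBall_eq_Icc] at hb
  have tm : t ∈ Icc (t - ε) (t + ε) := ⟨by linarith, by linarith⟩
  have quad : ∀ s ∈ Icc (t - ε) (t + ε), QV U s = QV U t + QP U t * (s - t) + 8 * QE U t * (s - t) ^ 2 :=
    fun s hs => (cons_interval h (fun r hr => (hb hr).2) (fun r hr => (hb hr).1) tm hs).2.2
  have ev : QV U =ᶠ[𝓝 t] fun s => QV U t + QP U t * (s - t) + 8 * QE U t * (s - t) ^ 2 := by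
    filter_upwards [Icc_mem_nhds (by linarith : t - ε < t) (by linarith : t < t + ε)] with s hs
    exact quad s hs
  have d1 : deriv (fun s => QV U t + QP U t * (s - t) + 8 * QE U t * (s - t) ^ 2) =
      fun s => QP U t + 16 * QE U t * (s - t) := by
    funext s
    have h1 : HasDerivAt (fun s : ℝ => s - t) 1 s := (hasDerivAt_id s).sub_const t
    have := ((h1.const_mul (QP U t)).const_add (QV U t)).add ((h1.pow 2).const_mul (8 * QE U t))
    refine (HasDerivAt.congr_deriv this ?_).deriv
    simp; ring
  have d2 : HasDerivAt (fun s => QP U t + 16 * QE U t * (s - t)) (16 * QE U t) t := by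
    have h1 : HasDerivAt (fun s : ℝ => s - t) 1 t := (hasDerivAt_id t).sub_const t
    refine HasDerivAt.congr_deriv ((h1.const_mul (16 * QE U t)).const_add (QP U t)) (by ring)
  rw [ev.deriv.deriv_eq, d1, d2.deriv]

end
end
end

section
open MeasureTheory Set Filter Topology SchwartzMap FourierTransform
open scoped ENNReal NNReal

noncomputable section

set_option linter.unusedSectionVars false

section
variable {d : ℕ}

lemma dirDeriv_eq {f : EuclideanSpace ℝ (Fin d) → ℂ} (hf : ContDiff ℝ (⊤ : ℕ∞) f) (k : Fin d) (x) :
    dirDeriv f (stdVec d k) x = pd k f x := by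
  have h1 := ((hf.differentiable (by simp)) (x + (0:ℝ) • stdVec d k)).hasFDerivAt
  have h2 : HasDerivAt (fun s : ℝ => x + s • stdVec d k) (stdVec d k) 0 := by
    have := ((hasDerivAt_id (0:ℝ)).smul_const (stdVec d k)).const_add x
    simpa using this
  have := (h1.comp_hasDerivAt (0:ℝ) h2).deriv
  simp only [zero_smul, add_zero] at this
  exact this

lemma sol_of {I : Set ℝ} (hd : 0 < d) (hI : IsOpen I) {u : ℝ → EuclideanSpace ℝ (Fin d) → ℂ}
    (hsmooth : ContDiffOn ℝ (⊤ : ℕ∞) (fun p : ℝ × EuclideanSpace ℝ (Fin d) => u p.1 p.2)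
      (I ×ˢ Set.univ))
    (hdecay : ∀ t ∈ I, SchwartzDecay (u t))
    (hu : IsNLSSolutionOn d I u) : Sol I (fun p : ℝ × EuclideanSpace ℝ (Fin d) => u p.1 p.2) := by
  have hp : 0 < (4:ℝ)/d := by positivity
  have sm : SmI I (fun p : ℝ × EuclideanSpace ℝ (Fin d) => u p.1 p.2) := by
    intro p hp
    exact hsmooth.contDiffAt ((hI.prod isOpen_univ).mem_nhds ⟨hp, mem_univ _⟩)
  refine ⟨hd, ⟨hI, sm, ?_, ?_⟩, hdecay⟩
  · exact (Complex.continuous_ofReal.comp_continuousOn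
      (sm.cont.norm.rpow_const fun _ _ => Or.inr hp.le)).mul sm.cont
  · rintro ⟨t, x⟩ ht
    have e := hu t ht x
    have st := (sm.time ht x).deriv
    have l : lap (u t) x = ∑ k, Dv (dx k) (Dv (dx k) (fun p : ℝ × EuclideanSpace ℝ (Fin d) => u p.1 p.2)) (t, x) := by
      unfold lap
      refine Finset.sum_congr rfl fun k _ => ?_
      have s0 : ContDiff ℝ (⊤ : ℕ∞) (u t) := sm.slice ht
      have e1 : (fun y => dirDeriv (u t) (stdVec d k) y) = pd k (u t) := by
        funext y; exact dirDeriv_eq s0 k y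
      rw [e1, dirDeriv_eq (pd_contDiff s0 k)]
      have e2 : pd k (u t) = fun x => Dv (dx k) (fun p : ℝ × EuclideanSpace ℝ (Fin d) => u p.1 p.2) (t, x) :=
        sm.pd_slice ht k
      rw [e2]
      exact congrFun ((Dv_smI sm (dx k)).pd_slice ht k) x
    have st' : deriv (fun s => u s x) t = Dv (dt d) (fun p : ℝ × EuclideanSpace ℝ (Fin d) => u p.1 p.2) (t, x) := st
    rw [l, st'] at e
    have I2 : Complex.I * Complex.I = -1 := Complex.I_mul_I
    linear_combination (-Complex.I) * e + Dv (dt d) (fun p : ℝ × EuclideanSpace ℝ (Fin d) => u p.1 p.2) (t, x) * I2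

end

end
end

/-- Virial identity: for a smooth, rapidly decaying solution of the mass-critical NLS,
`d²/dt² ∫ |x|² |u(t,x)|² dx = 16 E(u(t))`. -/
theorem stmt_11 (d : ℕ) (hd : 0 < d) (I : Set ℝ) (hI : IsOpen I)
    (u : ℝ → EuclideanSpace ℝ (Fin d) → ℂ)
    (hsmooth : ContDiffOn ℝ (⊤ : ℕ∞) (fun p : ℝ × EuclideanSpace ℝ (Fin d) => u p.1 p.2)
      (I ×ˢ Set.univ))
    (hdecay : ∀ t ∈ I, SchwartzDecay (u t))
    (hu : IsNLSSolutionOn d I u) :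
    ∀ t ∈ I,
      deriv (deriv (fun s => ∫ x, ‖x‖ ^ 2 * ‖u s x‖ ^ 2)) t = 16 * energy d (u t) := by
  intro t ht
  have h := sol_of hd hI hsmooth hdecay hu
  have v := virial h ht
  have e : QE (fun p : ℝ × EuclideanSpace ℝ (Fin d) => u p.1 p.2) t = energy d (u t) := by
    unfold QE QK QX energy
    have s0 : ContDiff ℝ (⊤ : ℕ∞) (u t) := h.se.sm.slice ht
    have e2 : ∀ k, pd k (u t) = fun x => Dv (dx k) (fun p : ℝ × EuclideanSpace ℝ (Fin d) => u p.1 p.2) (t, x) :=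
      fun k => h.se.sm.pd_slice ht k
    have e1 : ∀ k x, dirDeriv (u t) (stdVec d k) x = Dv (dx k) (fun p : ℝ × EuclideanSpace ℝ (Fin d) => u p.1 p.2) (t, x) := by
      intro k x
      rw [dirDeriv_eq s0 k, e2]
    have d0 : (0:ℝ) < d := by exact_mod_cast hd
    have c : (1 / ((4:ℝ)/d + 2)) = (d : ℝ) / (2 * d + 4) := by field_simp; ring
    simp only [e1, c, add_comm (2:ℝ) ((4:ℝ)/d)]
  rw [← e, ← v]
  rfl

end
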